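/- arXiv:1809.03649 — 2 statements merged into one kernel-verified Lean document; each statement's English description precedes it below -/
import Mathlib

section
/- Let K = ℚ(√10, √(-13)). Then the relative different ideal Diff_{K/F} of K over its maximal totally real subfield F = ℚ(√10) is not a principal ideal of O_K, and consequently K contains no Weil generator. -/
open NumberField

/-- `α` is a Weil generator of the CM field `K` with complex conjugation `c`:
`α` is an algebraic integer, `α·ᾱ ∈ ℤ`, and `ℤ[α, ᾱ] = 𝓞 K`. -/
def IsWeilGenerator (K : Type*) [Field K] (c : K ≃+* K) (α : K) : Prop :=
  α ∈ integralClosure ℤ K ∧ (∃ n : ℤ, α * c α = (n : K)) ∧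
    Algebra.adjoin ℤ ({α, c α} : Set K) = integralClosure ℤ K



theorem aux_trace {F E : Type*} [Field F] [Field E] [CharZero F] [Algebra F E] [FiniteDimensional F E]
    (s : E) (d : F) (hs : s ^ 2 = algebraMap F E d) (hd : ∀ x : F, x ^ 2 ≠ d)
    (hgen : ∀ x : E, ∃ a b : F, x = algebraMap F E a + algebraMap F E b * s) (a b : F) :
    Algebra.trace F E (algebraMap F E a + algebraMap F E b * s) = 2 * a := by
  have hirr : Irreducible (Polynomial.X ^ 2 - Polynomial.C d) := by
    refine X_pow_sub_C_irreducible_of_prime Nat.prime_two hd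
  have hmin : minpoly F s = Polynomial.X ^ 2 - Polynomial.C d := by
    symm
    refine minpoly.eq_of_irreducible_of_monic hirr ?_ (Polynomial.monic_X_pow_sub_C d two_ne_zero)
    simp [hs]
  have htop : IntermediateField.adjoin F {s} = ⊤ := by
    rw [eq_top_iff]
    intro x _
    obtain ⟨a, b, rfl⟩ := hgen x
    exact add_mem (IntermediateField.algebraMap_mem _ a)
      (mul_mem (IntermediateField.algebraMap_mem _ b) (IntermediateField.mem_adjoin_simple_self F s))
  have hrank : Module.finrank F E = 2 := by
    rw [← IntermediateField.finrank_top', ← htop, IntermediateField.adjoin.finrank (.of_finite F s),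
      hmin, Polynomial.natDegree_X_pow_sub_C]
  have hts : Algebra.trace F E s = 0 := by
    rw [trace_eq_finrank_mul_minpoly_nextCoeff, hmin]
    have : (Polynomial.X ^ 2 - Polynomial.C d).nextCoeff = 0 := by
      rw [Polynomial.nextCoeff_of_natDegree_pos] <;> simp [Polynomial.coeff_X_pow]
    simp [this]
  rw [map_add, ← Algebra.smul_def, map_smul, hts, Algebra.trace_algebraMap, hrank]
  simp

theorem aux_uniq {F E : Type*} [Field F] [Field E] [Algebra F E] 
    (s : E) (d : F) (hs : s ^ 2 = algebraMap F E d) (hd : ∀ x : F, x ^ 2 ≠ d)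
    {a b a' b' : F} (h : algebraMap F E a + algebraMap F E b * s = 
      algebraMap F E a' + algebraMap F E b' * s) : a = a' ∧ b = b' := by
  have hb : b = b' := by
    by_contra hne
    have h0 : algebraMap F E (b - b') ≠ 0 := by simpa [sub_eq_zero] using hne
    apply hd ((a' - a) / (b - b'))
    apply (algebraMap F E).injective
    rw [← hs, map_pow, map_div₀]
    congr 1
    rw [div_eq_iff h0]
    simp only [map_sub]
    linear_combination -h
  subst hb
  simpa using h

theorem aux_span {F E : Type*} [Field F] [Field E] [Algebra F E] 
    (s : E) (d : F) (hs : s ^ 2 = algebraMap F E d) (x : E) (hx : x ∈ Algebra.adjoin F {s}) :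
    ∃ a b : F, x = algebraMap F E a + algebraMap F E b * s := by
  induction hx using Algebra.adjoin_induction with
  | mem x hx => exact ⟨0, 1, by simp_all⟩
  | algebraMap r => exact ⟨r, 0, by simp⟩
  | add x y _ _ hx hy =>
    obtain ⟨a, b, rfl⟩ := hx
    obtain ⟨a', b', rfl⟩ := hy
    exact ⟨a + a', b + b', by simp only [map_add]; ring⟩
  | mul x y _ _ hx hy =>
    obtain ⟨a, b, rfl⟩ := hx
    obtain ⟨a', b', rfl⟩ := hy
    refine ⟨a * a' + d * b * b', a * b' + a' * b, ?_⟩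
    simp only [map_add, map_mul, ← hs]; ring

theorem aux_rat10 (x : ℚ) : x ^ 2 ≠ 10 := by
  intro h
  have h10 : ¬ IsSquare (10 : ℚ) := by
    rw [Rat.isSquare_iff]; 
    rintro ⟨⟨y, hy⟩, -⟩
    have : y < 4 := by nlinarith [show (10:ℚ).num = 10 from rfl]
    have : -4 < y := by nlinarith [show (10:ℚ).num = 10 from rfl]
    rw [show (10:ℚ).num = 10 from rfl] at hy
    interval_cases y <;> omega
  exact h10 ⟨x, by rw [← h]; ring⟩

theorem aux_int {F : Type*} [Field F] (n : ℤ) : IsIntegral ℤ (n : F) :=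
  isIntegral_algebraMap (R := ℤ) (A := F) (x := n)

theorem aux_congr {F : Type*} [Field F] {x y : F} (h : IsIntegral ℤ y) (e : x = y) : IsIntegral ℤ x :=
  e ▸ h


theorem F_uniq {F : Type*} [Field F] [NumberField F] (t : F) (ht : t ^ 2 = 10)
    {a b a' b' : ℚ} (h : (a : F) + b * t = a' + b' * t) : a = a' ∧ b = b' :=
  aux_uniq (F := ℚ) t 10 (by simp [ht]) aux_rat10 (by simpa using h)

theorem F_uniqZ {F : Type*} [Field F] [NumberField F] (t : F) (ht : t ^ 2 = 10)
    {a b a' b' : ℤ} (h : (a : F) + b * t = a' + b' * t) : a = a' ∧ b = b' := by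
  have := F_uniq t ht (a := a) (b := b) (a' := a') (b' := b') (by simpa using h)
  exact_mod_cast this

theorem F_int_of {F : Type*} [Field F] [NumberField F] (t : F) (ht : t ^ 2 = 10)
    (k l : ℤ) : IsIntegral ℤ ((k : F) + l * t) := by
  have h1 : IsIntegral ℤ t := by
    refine IsIntegral.of_pow (n := 2) (by norm_num) ?_
    rw [ht]; exact_mod_cast aux_int (F := F) 10
  have h (k : ℤ) : IsIntegral ℤ (k : F) := isIntegral_algebraMap (R := ℤ) (A := F) (x := k)
  exact (h k).add ((h l).mul h1)


theorem F_int {F : Type*} [Field F] [NumberField F] (t : F) (ht : t ^ 2 = 10)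
    (hgen : ∀ x : F, ∃ a b : ℚ, x = (a : F) + (b : F) * t)
    {x : F} (hx : IsIntegral ℤ x) : ∃ k l : ℤ, x = k + l * t := by
  obtain ⟨a, b, rfl⟩ := hgen x
  have htr := aux_trace (F := ℚ) t 10 (by simp [ht]) aux_rat10 (by simpa using hgen) a b
  have h1 : IsIntegral ℤ (2 * a) := by
    rw [← htr]; exact Algebra.isIntegral_trace (by simpa using hx)
  obtain ⟨m, hm⟩ := IsIntegrallyClosed.isIntegral_iff.mp h1
  have h2 : IsIntegral ℤ (a ^ 2 - 10 * b ^ 2) := by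
    have h3 : IsIntegral ℤ (((2 * a : ℚ) : F) - (a + b * t)) := 
      IsIntegral.sub (by rw [← hm]; simpa only [algebraMap_int_eq, eq_intCast, Rat.cast_intCast] using aux_int (F := F) m) hx
    have h4 := hx.mul h3
    have : ((a:F) + b * t) * (((2 * a : ℚ) : F) - (a + b * t)) = algebraMap ℚ F (a ^ 2 - 10 * b ^ 2) := by
      simp; linear_combination (-b^2 : F) * ht
    rw [this] at h4
    exact (isIntegral_algebraMap_iff (algebraMap ℚ F).injective).mp h4
  obtain ⟨n, hn⟩ := IsIntegrallyClosed.isIntegral_iff.mp h2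
  simp only [algebraMap_int_eq, eq_intCast] at hm hn
  -- 40 b^2 = m^2 - 4 n
  have h5 : IsIntegral ℤ (20 * b) := by
    refine IsIntegral.of_pow (n := 2) (by norm_num) ?_
    have : (20 * b) ^ 2 = algebraMap ℤ ℚ (10 * (m ^ 2 - 4 * n)) := by
      simp [hm, hn]; ring
    rw [this]; exact isIntegral_algebraMap
  obtain ⟨q, hq⟩ := IsIntegrallyClosed.isIntegral_iff.mp h5
  simp only [algebraMap_int_eq, eq_intCast] at hq
  have h6 : q ^ 2 = 10 * (m ^ 2 - 4 * n) := by
    have : (q : ℚ) ^ 2 = 10 * (m ^ 2 - 4 * n) := by rw [hm, hn, hq]; ring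
    exact_mod_cast this
  have h10 : (10 : ℤ) ∣ q := by
    have : (10 : ℤ) ∣ q ^ 2 := ⟨_, h6⟩
    have h2 : (2 : ℤ) ∣ q := Int.prime_two.dvd_of_dvd_pow ((by norm_num : (2:ℤ) ∣ 10).trans this)
    have h5 : (5 : ℤ) ∣ q := (show Prime (5 : ℤ) by norm_num).dvd_of_dvd_pow ((by norm_num : (5:ℤ) ∣ 10).trans this)
    omega
  obtain ⟨q, rfl⟩ := h10
  have h7 : 10 * q ^ 2 = m ^ 2 - 4 * n := by linarith
  obtain ⟨m, rfl⟩ : (2 : ℤ) ∣ m := Int.prime_two.dvd_of_dvd_pow (n := 2) ⟨5 * q ^ 2 + 2 * n, by linarith⟩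
  obtain ⟨q, rfl⟩ : (2 : ℤ) ∣ q := by
    have : (2:ℤ) ∣ 5 * q ^ 2 := ⟨m ^ 2 - n, by linarith⟩
    rcases Int.prime_two.dvd_mul.mp this with h | h
    · omega
    · exact Int.prime_two.dvd_of_dvd_pow h
  refine ⟨m, q, ?_⟩
  have e1 : a = m := by push_cast at hm; linarith
  have e2 : b = q := by push_cast at hq; linarith
  simp [e1, e2]

theorem F_13 {F : Type*} [Field F] [NumberField F] (t : F) (ht : t ^ 2 = 10)
    (hgen : ∀ x : F, ∃ a b : ℚ, x = (a : F) + (b : F) * t)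
    {x : F} (hx : IsIntegral ℤ (13 * x ^ 2)) : IsIntegral ℤ x := by
  have h1 : IsIntegral ℤ (13 * x) := by
    refine IsIntegral.of_pow (n := 2) (by norm_num) ?_
    have : (13 * x) ^ 2 = ((13 : ℤ) : F) * (13 * x ^ 2) := by push_cast; ring
    rw [this]
    exact (isIntegral_algebraMap (R := ℤ) (A := F) (x := 13)).mul hx
  obtain ⟨k, l, h⟩ := F_int t ht hgen h1
  obtain ⟨m, n, h'⟩ := F_int t ht hgen hx
  have h2 := F_uniqZ t ht (a := k ^ 2 + 10 * l ^ 2) (b := 2 * k * l) (a' := 13 * m) (b' := 13 * n)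
    (by push_cast; linear_combination (-l^2 : F) * ht - (k + l * t + 13 * x) * h + 13 * h')
  have p : Prime (13 : ℤ) := by norm_num
  have hkl : (13 : ℤ) ∣ k ∧ (13 : ℤ) ∣ l := by
    have h3 : (13 : ℤ) ∣ 2 * k * l := ⟨n, h2.2⟩
    have h4 : (13 : ℤ) ∣ k ^ 2 + 10 * l ^ 2 := ⟨m, h2.1⟩
    rcases p.dvd_mul.mp h3 with h | h
    · have hk : (13 : ℤ) ∣ k := by omega
      refine ⟨hk, ?_⟩
      have : (13 : ℤ) ∣ 10 * l ^ 2 := (dvd_add_right (dvd_pow hk two_ne_zero)).mp h4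
      rcases p.dvd_mul.mp this with h | h
      · omega
      · exact p.dvd_of_dvd_pow h
    · refine ⟨?_, h⟩
      exact p.dvd_of_dvd_pow ((dvd_add_left (Dvd.dvd.mul_left (dvd_pow h two_ne_zero) _)).mp h4)
  obtain ⟨⟨k, rfl⟩, ⟨l, rfl⟩⟩ := hkl
  have : x = k + l * t := by
    have h13 : (13 : F) ≠ 0 := by norm_num
    apply mul_left_cancel₀ h13
    rw [h]; push_cast; ring
  rw [this]; exact F_int_of t ht k l

theorem F_sq {F : Type*} [Field F] [NumberField F] (t : F) (ht : t ^ 2 = 10)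
    (hgen : ∀ x : F, ∃ a b : ℚ, x = (a : F) + (b : F) * t)
    (x : F) : x ^ 2 ≠ -13 := by
  intro h
  obtain ⟨a, b, rfl⟩ := hgen x
  have := F_uniq t ht (a := a ^ 2 + 10 * b ^ 2) (b := 2 * a * b) (a' := -13) (b' := 0)
    (by push_cast; linear_combination h - (b^2 : F) * ht)
  nlinarith [this.1, sq_nonneg a, sq_nonneg b]

/-- if `e` is a unit of `ℤ[t]` with `a ^ 2 * c = 2 * e`... -/
theorem F_no {F : Type*} [Field F] [NumberField F] (t : F) (ht : t ^ 2 = 10)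
    (hgen : ∀ x : F, ∃ a b : ℚ, x = (a : F) + (b : F) * t)
    {x y z : F} (c : ℤ) (hc : c = 1 ∨ c = -13) (hx : IsIntegral ℤ x) (hy : IsIntegral ℤ y) (hz : IsIntegral ℤ z)
    (hyz : y * z = 1) (h : c * x ^ 2 = 2 * y) : False := by
  obtain ⟨p, q, rfl⟩ := F_int t ht hgen hx
  obtain ⟨k, l, rfl⟩ := F_int t ht hgen hy
  obtain ⟨m, n, rfl⟩ := F_int t ht hgen hz
  have h1 := F_uniqZ t ht (a := c * (p ^ 2 + 10 * q ^ 2)) (b := 2 * c * p * q) (a' := 2 * k) (b' := 2 * l)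
    (by push_cast; linear_combination h - (c * q^2 : F) * ht)
  have h2 := F_uniqZ t ht (a := k * m + 10 * l * n) (b := k * n + l * m) (a' := 1) (b' := 0)
    (by push_cast; linear_combination hyz - (l * n : F) * ht)
  have h3 : (k ^ 2 - 10 * l ^ 2) * (m ^ 2 - 10 * n ^ 2) = 1 := by
    linear_combination (k * m + 10 * l * n + 1) * h2.1 - 10 * (k * n + l * m) * h2.2
  have h4 : (c * (p ^ 2 - 10 * q ^ 2)) ^ 2 = 4 * (k ^ 2 - 10 * l ^ 2) := by
    linear_combination (c * (p ^ 2 + 10 * q ^ 2) + 2 * k) * h1.1 - 10 * (2 * c * p * q + 2 * l) * h1.2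
  have h5 : k ^ 2 - 10 * l ^ 2 = 1 := by
    rcases Int.eq_one_or_neg_one_of_mul_eq_one h3 with h | h
    · exact h
    · rw [h] at h4; nlinarith [sq_nonneg (c * (p ^ 2 - 10 * q ^ 2))]
  rw [h5] at h4
  have h6 : c * (p ^ 2 - 10 * q ^ 2) = 2 ∨ c * (p ^ 2 - 10 * q ^ 2) = -2 := by
    apply sq_eq_sq_iff_eq_or_eq_neg.mp; linarith
  rcases hc with rfl | rfl
  · have : p ^ 2 % 5 = 2 ∨ p ^ 2 % 5 = 3 := by omega
    have h5 : p % 5 = 0 ∨ p % 5 = 1 ∨ p % 5 = 2 ∨ p % 5 = 3 ∨ p % 5 = 4 := by omega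
    rcases h5 with h | h | h | h | h <;> simp [pow_two, Int.mul_emod, h] at this
  · omega



theorem K_tr {F K : Type*} [Field F] [NumberField F] [Field K] [NumberField K] [Algebra F K]
    (t : F) (ht : t ^ 2 = 10)
    (hgen : ∀ x : F, ∃ a b : ℚ, x = (a : F) + (b : F) * t)
    (s : K) (hs : s ^ 2 = -13)
    (hgenK : ∀ x : K, ∃ a b : F, x = algebraMap F K a + algebraMap F K b * s)
    (a b : F) : Algebra.trace F K (algebraMap F K a + algebraMap F K b * s) = 2 * a :=
  aux_trace s (-13) (by simp [hs, map_ofNat]) (F_sq t ht hgen) hgenK a b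

theorem K_tr_int {F K : Type*} [Field F] [NumberField F] [Field K] [NumberField K] [Algebra F K]
    (t : F) (ht : t ^ 2 = 10)
    (hgen : ∀ x : F, ∃ a b : ℚ, x = (a : F) + (b : F) * t)
    (s : K) (hs : s ^ 2 = -13)
    (hgenK : ∀ x : K, ∃ a b : F, x = algebraMap F K a + algebraMap F K b * s)
    {a b : F} (h : IsIntegral ℤ (algebraMap F K a + algebraMap F K b * s)) :
    IsIntegral ℤ (2 * a) := by
  rw [← K_tr t ht hgen s hs hgenK a b]; exact Algebra.isIntegral_trace h

theorem K_conj {F K : Type*} [Field F] [NumberField F] [Field K] [NumberField K] [Algebra F K]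
    (t : F) (ht : t ^ 2 = 10)
    (hgen : ∀ x : F, ∃ a b : ℚ, x = (a : F) + (b : F) * t)
    (s : K) (hs : s ^ 2 = -13)
    (hgenK : ∀ x : K, ∃ a b : F, x = algebraMap F K a + algebraMap F K b * s)
    {a b : F} (h : IsIntegral ℤ (algebraMap F K a + algebraMap F K b * s)) :
    IsIntegral ℤ (algebraMap F K a - algebraMap F K b * s) := by
  have h1 := (K_tr_int t ht hgen s hs hgenK h).algebraMap (B := K)
  have := h1.sub h
  refine aux_congr (this) ?_
  simp only [map_mul, map_ofNat]; ring

theorem K_norm {F K : Type*} [Field F] [NumberField F] [Field K] [NumberField K] [Algebra F K]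
    (t : F) (ht : t ^ 2 = 10)
    (hgen : ∀ x : F, ∃ a b : ℚ, x = (a : F) + (b : F) * t)
    (s : K) (hs : s ^ 2 = -13)
    (hgenK : ∀ x : K, ∃ a b : F, x = algebraMap F K a + algebraMap F K b * s)
    {a b : F} (h : IsIntegral ℤ (algebraMap F K a + algebraMap F K b * s)) :
    IsIntegral ℤ (a ^ 2 + 13 * b ^ 2) := by
  have h1 := h.mul (K_conj t ht hgen s hs hgenK h)
  have h2 : (algebraMap F K a + algebraMap F K b * s) * (algebraMap F K a - algebraMap F K b * s)
    = algebraMap F K (a ^ 2 + 13 * b ^ 2) := by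
    simp only [map_add, map_mul, map_pow, map_ofNat]
    linear_combination -(algebraMap F K b)^2 * hs
  rw [h2] at h1
  exact (isIntegral_algebraMap_iff (algebraMap F K).injective).mp h1

theorem K_int {F K : Type*} [Field F] [NumberField F] [Field K] [NumberField K] [Algebra F K]
    (t : F) (ht : t ^ 2 = 10)
    (hgen : ∀ x : F, ∃ a b : ℚ, x = (a : F) + (b : F) * t)
    (s : K) (hs : s ^ 2 = -13)
    (hgenK : ∀ x : K, ∃ a b : F, x = algebraMap F K a + algebraMap F K b * s)
    {a b : F} (h : IsIntegral ℤ (algebraMap F K a + algebraMap F K b * s)) :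
    IsIntegral ℤ (2 * b) ∧ IsIntegral ℤ (t * b) := by
  have hA := K_tr_int t ht hgen s hs hgenK h
  have hN := K_norm t ht hgen s hs hgenK h
  have hB : IsIntegral ℤ (2 * b) := by
    apply F_13 t ht hgen
    have := ((aux_int (F := F) 4).mul hN).sub (hA.pow 2)
    refine aux_congr (this) ?_
    push_cast; ring
  refine ⟨hB, ?_⟩
  obtain ⟨k, l, hkl⟩ := F_int t ht hgen hA
  obtain ⟨m, n, hmn⟩ := F_int t ht hgen hB
  obtain ⟨p, q, hpq⟩ := F_int t ht hgen hN
  have h1 := F_uniqZ t ht (a := k ^ 2 + 10 * l ^ 2 + 13 * (m ^ 2 + 10 * n ^ 2)) 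
    (b := 2 * k * l + 26 * m * n) (a' := 4 * p) (b' := 4 * q)
    (by push_cast; linear_combination (-l^2 - 13 * n ^ 2 : F) * ht - (k + l * t + 2 * a) * hkl 
          - 13 * (m + n * t + 2 * b) * hmn + 4 * hpq)
  obtain ⟨e1, e2⟩ := h1
  have hm : (2 : ℤ) ∣ m := by
    by_contra hm
    obtain ⟨m', rfl⟩ : ∃ m', m = 2 * m' + 1 := ⟨m / 2, by omega⟩
    have hk : ∃ k', k = 2 * k' + 1 := by
      refine ⟨k / 2, ?_⟩
      rcases Int.even_or_odd' k with ⟨k', rfl | rfl⟩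
      · ring_nf at e1; omega
      · omega
    obtain ⟨k', rfl⟩ := hk
    rcases Int.even_or_odd' l with ⟨l', rfl | rfl⟩ <;> rcases Int.even_or_odd' n with ⟨n', rfl | rfl⟩ <;>
      ring_nf at e1 e2 <;> omega
  obtain ⟨m, rfl⟩ := hm
  have : t * b = ((5 * n : ℤ) : F) + m * t := by
    have h2 : (2 : F) ≠ 0 := by norm_num
    apply mul_left_cancel₀ h2
    push_cast at hmn ⊢
    linear_combination t * hmn + (n : F) * ht
  rw [this]; exact F_int_of t ht _ _

theorem K_unit {F K : Type*} [Field F] [NumberField F] [Field K] [NumberField K] [Algebra F K]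
    (t : F) (ht : t ^ 2 = 10)
    (hgen : ∀ x : F, ∃ a b : ℚ, x = (a : F) + (b : F) * t)
    (s : K) (hs : s ^ 2 = -13)
    (hgenK : ∀ x : K, ∃ a b : F, x = algebraMap F K a + algebraMap F K b * s)
    {a b : F} (h : IsIntegral ℤ (algebraMap F K a + algebraMap F K b * s))
    (h1 : a ^ 2 + 13 * b ^ 2 = 1) : b = 0 ∧ (a = 1 ∨ a = -1) := by
  obtain ⟨k, l, hkl⟩ := F_int t ht hgen (K_tr_int t ht hgen s hs hgenK h)
  obtain ⟨m, n, hmn⟩ := F_int t ht hgen (K_int t ht hgen s hs hgenK h).1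
  have e := (F_uniqZ t ht (a := k ^ 2 + 10 * l ^ 2 + 13 * (m ^ 2 + 10 * n ^ 2)) 
    (b := 2 * k * l + 26 * m * n) (a' := 4) (b' := 0)
    (by push_cast; linear_combination (-l^2 - 13 * n ^ 2 : F) * ht - (k + l * t + 2 * a) * hkl 
          - 13 * (m + n * t + 2 * b) * hmn + 4 * h1)).1
  have hl : l = 0 := by
    by_contra h0
    have : 0 < l ^ 2 := by positivity
    nlinarith [sq_nonneg k, sq_nonneg m, sq_nonneg n]
  have hm : m = 0 := by
    by_contra h0
    have : 0 < m ^ 2 := by positivity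
    nlinarith [sq_nonneg k, sq_nonneg l, sq_nonneg n]
  have hn : n = 0 := by
    by_contra h0
    have : 0 < n ^ 2 := by positivity
    nlinarith [sq_nonneg k, sq_nonneg l, sq_nonneg m]
  subst hl hm hn
  have hb : b = 0 := by simpa using hmn
  refine ⟨hb, ?_⟩
  apply sq_eq_sq_iff_eq_or_eq_neg.mp
  rw [hb] at h1; linear_combination h1

theorem K_core {F K : Type*} [Field F] [NumberField F] [Field K] [NumberField K] [Algebra F K]
    (t : F) (ht : t ^ 2 = 10)
    (hgen : ∀ x : F, ∃ a b : ℚ, x = (a : F) + (b : F) * t)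
    (s : K) (hs : s ^ 2 = -13)
    (hgenK : ∀ x : K, ∃ a b : F, x = algebraMap F K a + algebraMap F K b * s)
    {g : K} (h0 : g ≠ 0) (h1 : IsIntegral ℤ (g ^ 2 / 2)) (h2 : IsIntegral ℤ (2 / g ^ 2)) :
    False := by
  have hinj := (algebraMap F K).injective
  have hsF : ∀ x, x ^ 2 ≠ (-13 : F) := F_sq t ht hgen
  obtain ⟨a, b, rfl⟩ := hgenK g
  have hN0 : a ^ 2 + 13 * b ^ 2 ≠ 0 := by
    intro h
    by_cases hb : b = 0
    · subst hb; simp at h; subst h; simp at h0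
    · apply hsF (a / b); field_simp; linear_combination h
  have hN0' : algebraMap F K a ^ 2 + 13 * algebraMap F K b ^ 2 ≠ 0 := by
    have := (map_ne_zero (algebraMap F K)).mpr hN0
    simpa [map_ofNat] using this
  have hc : IsIntegral ℤ ((algebraMap F K a - algebraMap F K b * s) ^ 2 / 2) := by
    have e : (algebraMap F K a + algebraMap F K b * s) ^ 2 / 2 = 
      algebraMap F K ((a ^ 2 - 13 * b ^ 2) / 2) + algebraMap F K (a * b) * s := by
      simp only [map_sub, map_mul, map_pow, map_div₀, map_ofNat]
      linear_combination (algebraMap F K b)^2 / 2 * hs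
    rw [e] at h1
    have := K_conj t ht hgen s hs hgenK h1
    refine aux_congr (this) ?_
    simp only [map_sub, map_mul, map_pow, map_div₀, map_ofNat]
    linear_combination (algebraMap F K b)^2 / 2 * hs
  have hu : IsIntegral ℤ ((algebraMap F K a - algebraMap F K b * s) / (algebraMap F K a + algebraMap F K b * s)) := by
    refine IsIntegral.of_pow (n := 2) (by norm_num) ?_
    refine aux_congr (hc.mul h2) ?_
    rw [div_pow, div_mul_div_comm, mul_comm _ (2 : K), mul_div_mul_left _ _ two_ne_zero]
  have e : (algebraMap F K a - algebraMap F K b * s) / (algebraMap F K a + algebraMap F K b * s) =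
     algebraMap F K ((a ^ 2 - 13 * b ^ 2) / (a ^ 2 + 13 * b ^ 2)) + 
      algebraMap F K (- 2 * a * b / (a ^ 2 + 13 * b ^ 2)) * s := by
    simp only [map_sub, map_mul, map_pow, map_div₀, map_ofNat, map_add, map_neg]
    rw [div_eq_iff h0, div_mul_eq_mul_div, ← add_div, div_mul_eq_mul_div, eq_div_iff hN0']
    linear_combination (algebraMap F K a * algebraMap F K b ^ 2 * 2) * hs 
  rw [e] at hu
  obtain ⟨u1, u2⟩ := K_unit t ht hgen s hs hgenK hu (by field_simp; ring)
  have hab : a = 0 ∨ b = 0 := by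
    have : -2 * a * b = 0 := by
      rcases div_eq_zero_iff.mp u1 with h | h
      · exact h
      · exact absurd h hN0
    simpa using this
  rcases hab with rfl | rfl
  · have hb0 : b ≠ 0 := by rintro rfl; simp at h0
    have e1 : (algebraMap F K 0 + algebraMap F K b * s) ^ 2 / 2 = algebraMap F K (-13 * b ^ 2 / 2) := by
      simp [mul_pow, hs, mul_comm, map_ofNat]
    have e2 : 2 / (algebraMap F K 0 + algebraMap F K b * s) ^ 2 = algebraMap F K (2 / (-13 * b ^ 2)) := by
      simp [mul_pow, hs, mul_comm, map_ofNat]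
    rw [e1, isIntegral_algebraMap_iff hinj] at h1
    rw [e2, isIntegral_algebraMap_iff hinj] at h2
    have hb : IsIntegral ℤ b := by
      apply F_13 t ht hgen
      refine aux_congr ((aux_int (F := F) (-2)).mul h1) ?_
      push_cast; ring
    exact F_no t ht hgen (-13) (Or.inr rfl) hb h1 h2 (by field_simp) (by push_cast; ring)
  · have hb0 : a ≠ 0 := by rintro rfl; simp at h0
    have e1 : (algebraMap F K a + algebraMap F K 0 * s) ^ 2 / 2 = algebraMap F K (a ^ 2 / 2) := by
      simp [map_ofNat]
    have e2 : 2 / (algebraMap F K a + algebraMap F K 0 * s) ^ 2 = algebraMap F K (2 / a ^ 2) := by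
      simp [map_ofNat]
    rw [e1, isIntegral_algebraMap_iff hinj] at h1
    rw [e2, isIntegral_algebraMap_iff hinj] at h2
    have hb : IsIntegral ℤ a := by
      refine IsIntegral.of_pow (n := 2) (by norm_num) ?_
      refine aux_congr ((aux_int (F := F) 2).mul h1) ?_
      push_cast; ring
    exact F_no t ht hgen 1 (Or.inl rfl) hb h1 h2 (by field_simp) (by push_cast; ring)

/-- criterion in terms of the trace dual -/
theorem K_dual {F K : Type*} [Field F] [NumberField F] [Field K] [NumberField K] [Algebra F K]
    (t : F) (ht : t ^ 2 = 10)
    (hgen : ∀ x : F, ∃ a b : ℚ, x = (a : F) + (b : F) * t)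
    (s : K) (hs : s ^ 2 = -13)
    (hgenK : ∀ x : K, ∃ a b : F, x = algebraMap F K a + algebraMap F K b * s)
    {δ : K} (h0 : δ ≠ 0) 
    (hδ : ∀ w : K, (∀ z : K, IsIntegral ℤ z → IsIntegral ℤ (Algebra.trace F K (w * z))) ↔ 
      IsIntegral ℤ (δ * w)) : False := by
  have s0 : s ≠ 0 := by rintro rfl; norm_num at hs
  have hT : algebraMap F K t ^ 2 = 10 := by rw [← map_pow, ht, map_ofNat]
  have t0 : algebraMap F K t ≠ 0 := by intro h; rw [h] at hT; norm_num at hT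
  have tr := K_tr t ht hgen s hs hgenK
  have hsI : IsIntegral ℤ s := by
    refine IsIntegral.of_pow (n := 2) (by norm_num) ?_
    rw [hs]; exact_mod_cast aux_int (F := K) (-13)
  have htI : IsIntegral ℤ (algebraMap F K t) := by
    refine IsIntegral.of_pow (n := 2) (by norm_num) ?_
    rw [hT]; exact_mod_cast aux_int (F := K) 10
  -- lower bounds
  have l1 : IsIntegral ℤ (δ * (s / 13)) := by
    rw [← hδ]
    intro z hz
    obtain ⟨a, b, rfl⟩ := hgenK z
    have e : s / 13 * (algebraMap F K a + algebraMap F K b * s) = 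
      algebraMap F K (-b) + algebraMap F K (a / 13) * s := by
      simp only [map_neg, map_div₀, map_ofNat]; linear_combination algebraMap F K b / 13 * hs
    rw [e, tr]
    refine aux_congr ((K_int t ht hgen s hs hgenK hz).1.neg) ?_
    ring
  have l2 : IsIntegral ℤ (δ * (algebraMap F K t * s / 26)) := by
    rw [← hδ]
    intro z hz
    obtain ⟨a, b, rfl⟩ := hgenK z
    have e : algebraMap F K t * s / 26 * (algebraMap F K a + algebraMap F K b * s) = 
      algebraMap F K (-(t * b) / 2) + algebraMap F K (t * a / 26) * s := by
      simp only [map_neg, map_div₀, map_ofNat, map_mul]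
      linear_combination algebraMap F K t * algebraMap F K b / 26 * hs
    rw [e, tr]
    refine aux_congr ((K_int t ht hgen s hs hgenK hz).2.neg) ?_
    ring
  -- upper bounds
  have hw := (hδ δ⁻¹).mpr (by rw [mul_inv_cancel₀ h0]; exact_mod_cast aux_int (F := K) 1)
  obtain ⟨u, v, huv⟩ := hgenK δ⁻¹
  rw [huv] at hw
  have w1 : IsIntegral ℤ (2 * u) := by
    have := hw 1 (by exact_mod_cast aux_int (F := K) 1)
    rwa [mul_one, tr] at this
  have w2 : IsIntegral ℤ (26 * v) := by
    have := hw s hsI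
    have e : (algebraMap F K u + algebraMap F K v * s) * s = 
      algebraMap F K (-13 * v) + algebraMap F K u * s := by
      simp only [map_neg, map_mul, map_ofNat]; linear_combination algebraMap F K v * hs
    rw [e, tr] at this
    refine aux_congr (this.neg) ?_
    ring
  have hm : IsIntegral ℤ (algebraMap F K t * (1 + s) / 2) := by
    refine IsIntegral.of_pow (n := 2) (by norm_num) ?_
    have : (algebraMap F K t * (1 + s) / 2) ^ 2 = ((-30 : ℤ) : K) + ((5 : ℤ) : K) * s := by
      push_cast; linear_combination (1 + s) ^ 2 / 4 * hT + 10 / 4 * hs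
    rw [this]
    exact (aux_int _).add ((aux_int _).mul hsI)
  have w3 : IsIntegral ℤ (t * (u - 13 * v)) := by
    have := hw _ hm
    have e : (algebraMap F K u + algebraMap F K v * s) * (algebraMap F K t * (1 + s) / 2) = 
      algebraMap F K (t * (u - 13 * v) / 2) + algebraMap F K (t * (u + v) / 2) * s := by
      simp only [map_sub, map_add, map_div₀, map_mul, map_ofNat]
      linear_combination algebraMap F K t * algebraMap F K v / 2 * hs
    rw [e, tr] at this
    refine aux_congr (this) ?_
    ring
  have m1 : IsIntegral ℤ (2 * s * δ⁻¹) := by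
    rw [huv]
    refine aux_congr (((w1.algebraMap (B := K)).mul hsI).sub (w2.algebraMap (B := K))) ?_
    simp only [map_mul, map_ofNat]; linear_combination 2 * algebraMap F K v * hs
  have m2 : IsIntegral ℤ (algebraMap F K t * s * δ⁻¹) := by
    rw [huv]
    have := (((w1.algebraMap (B := K)).mul hm).add (w3.algebraMap (B := K))).sub 
      ((w1.algebraMap (B := K)).mul htI) 
    refine aux_congr (this) ?_
    simp only [map_mul, map_ofNat, map_sub]; linear_combination algebraMap F K t * algebraMap F K v * hs
  refine K_core t ht hgen s hs hgenK (g := δ * (s / 13)) (by simp [h0, s0]) ?_ ?_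
  · refine aux_congr ((l2.pow 2).sub ((aux_int (F := K) 2).mul (l1.pow 2))) ?_
    push_cast
    linear_combination - δ ^ 2 * s ^ 2 / 676 * hT
  · refine aux_congr ((m2.pow 2).sub ((aux_int (F := K) 2).mul (m1.pow 2))) ?_
    push_cast
    field_simp
    rw [show s ^ 4 = 169 by linear_combination (s ^ 2 - 13) * hs, hT]
    norm_num


theorem diff_dual {F K : Type*} [Field F] [NumberField F] [Field K] [NumberField K] [Algebra F K]
    (h : (differentIdeal (𝓞 F) (𝓞 K)).IsPrincipal) :
    ∃ δ : K, δ ≠ 0 ∧ 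
      ∀ w : K, (∀ z : K, IsIntegral ℤ z → IsIntegral ℤ (Algebra.trace F K (w * z))) ↔ 
      IsIntegral ℤ (δ * w) := by
  obtain ⟨d, hd⟩ := h
  have hd : differentIdeal (𝓞 F) (𝓞 K) = Ideal.span {d} := hd
  have h1 := coeIdeal_differentIdeal (𝓞 F) F K (𝓞 K)
  have hd0 : d ≠ 0 := by
    rintro rfl
    have : differentIdeal (𝓞 F) (𝓞 K) ≠ ⊥ := differentIdeal_ne_bot
    apply this
    rw [hd]; simp
  have hdK : algebraMap (𝓞 K) K d ≠ 0 := by simpa using hd0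
  refine ⟨algebraMap (𝓞 K) K d, hdK, ?_⟩
  intro w
  have h2 : FractionalIdeal.dual (𝓞 F) F (1 : FractionalIdeal (nonZeroDivisors (𝓞 K)) K) = 
      FractionalIdeal.spanSingleton _ (algebraMap (𝓞 K) K d)⁻¹ := by
    rw [← inv_inv (FractionalIdeal.dual (𝓞 F) F (1 : FractionalIdeal (nonZeroDivisors (𝓞 K)) K)), ← h1, hd, 
      FractionalIdeal.coeIdeal_span_singleton, FractionalIdeal.spanSingleton_inv]
  have h3 : w ∈ FractionalIdeal.dual (𝓞 F) F (1 : FractionalIdeal (nonZeroDivisors (𝓞 K)) K) ↔ 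
      (∀ z : K, IsIntegral ℤ z → IsIntegral ℤ (Algebra.trace F K (w * z))) := by
    rw [FractionalIdeal.mem_dual (I := (1 : FractionalIdeal (nonZeroDivisors (𝓞 K)) K)) one_ne_zero]
    constructor
    · intro H z hz
      obtain ⟨y, hy⟩ := H z ((FractionalIdeal.mem_one_iff _).mpr ⟨⟨z, hz⟩, rfl⟩)
      rw [Algebra.traceForm_apply] at hy
      rw [← hy]; exact y.2
    · intro H z hz
      obtain ⟨y, rfl⟩ := (FractionalIdeal.mem_one_iff _).mp hz
      exact ⟨⟨_, H _ y.2⟩, rfl⟩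
  rw [← h3, h2, FractionalIdeal.mem_spanSingleton]
  constructor
  · rintro ⟨z, rfl⟩
    rw [Algebra.smul_def]
    refine aux_congr z.2 ?_
    show _ = algebraMap (𝓞 K) K z
    field_simp
  · intro H
    let y : 𝓞 K := ⟨_, H⟩
    have hy : algebraMap (𝓞 K) K y = algebraMap (𝓞 K) K d * w := rfl
    refine ⟨y, ?_⟩
    rw [Algebra.smul_def, hy]
    field_simp

theorem weil_principal {F K : Type*} [Field F] [NumberField F] [Field K] [NumberField K] [Algebra F K]
    (c : K ≃ₐ[F] K) (α : K) (hα : IsIntegral ℤ α) 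
    (τ : F) (hτ : α + c α = algebraMap F K τ)
    (h : Algebra.adjoin ℤ ({α, c α} : Set K) = integralClosure ℤ K) :
    (differentIdeal (𝓞 F) (𝓞 K)).IsPrincipal := by
  set a : 𝓞 K := ⟨α, hα⟩ with ha
  have hcα : IsIntegral ℤ (c α) := hα.map (c.toAlgHom.restrictScalars ℤ)
  have hτi : IsIntegral ℤ τ := by
    rw [← isIntegral_algebraMap_iff (algebraMap F K).injective, ← hτ]; exact hα.add hcα
  have key : ∀ x : K, x ∈ Algebra.adjoin ℤ ({α, c α} : Set K) → 
      ∃ y ∈ Algebra.adjoin (𝓞 F) {a}, algebraMap (𝓞 K) K y = x := by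
    intro x hx
    induction hx using Algebra.adjoin_induction with
    | mem x hx => 
      rcases hx with rfl | rfl
      · exact ⟨a, Algebra.self_mem_adjoin_singleton _ _, rfl⟩
      · refine ⟨algebraMap (𝓞 F) (𝓞 K) ⟨τ, hτi⟩ - a, sub_mem (Subalgebra.algebraMap_mem _ _) (Algebra.self_mem_adjoin_singleton _ _), ?_⟩
        rw [map_sub]
        show algebraMap F K τ - α = _
        rw [← hτ]; ring
    | algebraMap r => exact ⟨algebraMap ℤ (𝓞 K) r, by simp, by simp⟩
    | add x y _ _ hx hy =>
      obtain ⟨a, ha, rfl⟩ := hx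
      obtain ⟨b, hb, rfl⟩ := hy
      exact ⟨a + b, add_mem ha hb, by simp⟩
    | mul x y _ _ hx hy =>
      obtain ⟨a, ha, rfl⟩ := hx
      obtain ⟨b, hb, rfl⟩ := hy
      exact ⟨a * b, mul_mem ha hb, by simp⟩
  have htop : Algebra.adjoin (𝓞 F) {a} = ⊤ := by
    rw [eq_top_iff]
    intro x _
    obtain ⟨y, hy, e⟩ := key (x : K) (by rw [h]; exact x.2)
    have : y = x := by exact RingOfIntegers.ext e
    rwa [← this]
  have htopK : Algebra.adjoin F {algebraMap (𝓞 K) K a} = ⊤ := by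
    rw [eq_top_iff]
    intro x _
    have h1 : ∀ y : 𝓞 K, algebraMap (𝓞 K) K y ∈ Algebra.adjoin F {algebraMap (𝓞 K) K a} := by
      intro y
      have hy : y ∈ Algebra.adjoin (𝓞 F) {a} := by rw [htop]; trivial
      induction hy using Algebra.adjoin_induction with
      | mem x hx => 
        rw [Set.mem_singleton_iff.mp hx]; exact Algebra.self_mem_adjoin_singleton _ _
      | algebraMap r => exact Subalgebra.algebraMap_mem (Algebra.adjoin F {algebraMap (𝓞 K) K a}) (r : F)
      | add x y _ _ hx hy => rw [map_add]; exact add_mem hx hy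
      | mul x y _ _ hx hy => rw [map_mul]; exact mul_mem hx hy
    obtain ⟨p, q, hq, rfl⟩ := IsFractionRing.div_surjective (A := 𝓞 K) x
    rw [div_eq_mul_inv]
    exact mul_mem (h1 p) (Subalgebra.inv_mem_of_algebraic _ (x := ⟨_, h1 q⟩)
      (Algebra.IsAlgebraic.isAlgebraic _))
  have := conductor_mul_differentIdeal (𝓞 F) F K a htopK
  rw [conductor_eq_top_of_adjoin_eq_top htop, Ideal.top_mul] at this
  rw [this]
  exact ⟨⟨_, rfl⟩⟩

theorem stmt7 (F K : Type*) [Field F] [Field K] [NumberField F] [NumberField K]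
    [Algebra F K]
    (r s : K) (hr : r ^ 2 = 10) (hs : s ^ 2 = -13)
    (hKgen : Algebra.adjoin ℚ ({r, s} : Set K) = ⊤)
    (t : F) (ht : t ^ 2 = 10) (hFgen : Algebra.adjoin ℚ ({t} : Set F) = ⊤)
    (hrt : algebraMap F K t = r) :
    ¬ (differentIdeal (𝓞 F) (𝓞 K)).IsPrincipal ∧
      ∀ c : K ≃ₐ[F] K, c ≠ AlgEquiv.refl →
        ∀ α : K, ¬ IsWeilGenerator K c.toRingEquiv α := by
  have hgen : ∀ x : F, ∃ a b : ℚ, x = (a : F) + (b : F) * t := by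
    intro x
    simpa using aux_span (F := ℚ) t 10 (by simp [ht]) x (by rw [hFgen]; trivial)
  have hsF : s ^ 2 = algebraMap F K (-13) := by simp [hs, map_ofNat]
  have hgenK : ∀ x : K, ∃ a b : F, x = algebraMap F K a + algebraMap F K b * s := by
    intro x
    refine aux_span s (-13) hsF x ?_
    have hx : x ∈ Algebra.adjoin ℚ ({r, s} : Set K) := by rw [hKgen]; trivial
    have hle : Algebra.adjoin ℚ ({r, s} : Set K) ≤ (Algebra.adjoin F {s}).restrictScalars ℚ := by
      rw [Algebra.adjoin_le_iff]
      rintro y (rfl | rfl)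
      · rw [← hrt]; exact Subalgebra.algebraMap_mem (Algebra.adjoin F {s}) t
      · exact Algebra.self_mem_adjoin_singleton F y
    exact hle hx
  have hnp : ¬ (differentIdeal (𝓞 F) (𝓞 K)).IsPrincipal := by
    intro h
    obtain ⟨δ, h0, hδ⟩ := diff_dual h
    exact K_dual t ht hgen s hs hgenK h0 hδ
  refine ⟨hnp, ?_⟩
  rintro c hc α ⟨hα, -, hadj⟩
  apply hnp
  obtain ⟨a, b, hab⟩ := hgenK α
  have hcs : c s = s ∨ c s = -s := by
    apply sq_eq_sq_iff_eq_or_eq_neg.mp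
    rw [← map_pow, hsF, AlgEquiv.commutes]
  have hcs' : c s = -s := by
    refine hcs.resolve_left fun h => hc ?_
    ext x
    obtain ⟨a, b, rfl⟩ := hgenK x
    simp [h]
  refine weil_principal c α hα (2 * a) ?_ hadj
  rw [hab]
  simp only [map_add, map_mul, AlgEquiv.commutes, hcs', map_ofNat]
  ring
end

section
/- Let K be a CM field of degree 2g with g ≥ 3. Then the set of Weil generators of K is finite. -/
/-- `K` is totally imaginary: no complex embedding has real image. -/
def TotallyImaginary (K : Type*) [Field K] : Prop :=
  ∀ φ : K →+* ℂ, ∃ x : K, (starRingEnd ℂ) (φ x) ≠ φ x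

section
open Finset in
lemma wg_fac_prod (s k i : ℕ) (h1 : s ≤ i) (h2 : i ≤ k) :
    |∏ x ∈ (Icc s k).erase i, ((i:ℤ) - x)| = ((i - s).factorial * (k - i).factorial : ℕ) := by
  have hA : ∀ n : ℕ, ∏ x ∈ Ico s (s+n), |((s+n : ℕ):ℤ) - x| = (n.factorial : ℤ) := by
    intro n
    rw [Finset.prod_Ico_eq_prod_range, ← Finset.prod_range_reflect, ← Finset.prod_range_add_one_eq_factorial]
    push_cast
    simp only [Nat.add_sub_cancel_left]
    refine Finset.prod_congr rfl fun x hx => ?_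
    have := Finset.mem_range.1 hx
    have e : ((n - 1 - x : ℕ) : ℤ) = n - 1 - x := by omega
    rw [e, abs_of_nonneg (by omega)]; ring
  have hB : ∀ n : ℕ, ∏ x ∈ Ioc i (i+n), |(i:ℤ) - x| = (n.factorial : ℤ) := by
    intro n
    induction n with
    | zero => simp
    | succ n ih =>
      rw [← add_assoc, Finset.prod_Ioc_succ_top (by omega), ih, Nat.factorial_succ]
      push_cast
      rw [abs_of_neg (by omega)]; ring
  have hU : (Icc s k).erase i = Ico s i ∪ Ioc i k := by
    ext x; simp only [mem_erase, mem_Icc, mem_union, mem_Ico, mem_Ioc]; omega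
  have hd : Disjoint (Ico s i) (Ioc i k) := by
    rw [Finset.disjoint_left]; intro x; simp only [mem_Ico, mem_Ioc]; omega
  rw [Finset.abs_prod, hU, Finset.prod_union hd]
  have a := hA (i - s); have b := hB (k - i)
  rw [Nat.add_sub_cancel' h1] at a
  rw [Nat.add_sub_cancel' h2] at b
  rw [a, b]; push_cast; rfl

open Finset in
lemma wg_weight0 (m s k i : ℕ) (hm : 0 < m) (hs : s ≤ 1) (hk : 1 ≤ k) (h1 : s ≤ i) (h2 : i ≤ k) :
    ∃ z : ℤ, (z:ℚ) = (k.factorial : ℚ) * (m:ℚ)^k * ∏ x ∈ (Icc s k).erase i, ((m:ℚ)*i - m * x)⁻¹ ∧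
      |(z:ℝ)| ≤ ((4*m)^k : ℝ) := by
  set P : ℤ := ∏ x ∈ (Icc s k).erase i, ((i:ℤ) - x) with hP
  have hPabs := wg_fac_prod s k i h1 h2
  have hcard : ((Icc s k).erase i).card = k - s := by
    rw [card_erase_of_mem (by simp; omega), Nat.card_Icc]; omega
  have hdvd : (i - s).factorial * (k - i).factorial ∣ k.factorial :=
    (Nat.factorial_mul_factorial_dvd_factorial_add (i-s) (k-i)).trans
      (Nat.factorial_dvd_factorial (by omega))
  have hPd : P ∣ (k.factorial : ℤ) := by
    rw [← abs_dvd, hPabs]; exact_mod_cast hdvd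
  obtain ⟨y, hy⟩ := hPd
  have hP0 : P ≠ 0 := by
    intro h; rw [h] at hy; simp at hy; exact absurd hy (Nat.factorial_ne_zero k)
  refine ⟨y * m^s, ?_, ?_⟩
  · have : ∏ x ∈ (Icc s k).erase i, ((m:ℚ)*i - m * x)⁻¹ = ((m:ℚ)^(k-s))⁻¹ * (P:ℚ)⁻¹ := by
      rw [Finset.prod_inv_distrib, ← mul_inv]
      congr 1
      rw [← hcard, ← Finset.prod_const, hP, Int.cast_prod, ← Finset.prod_mul_distrib]
      refine Finset.prod_congr rfl fun x _ => ?_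
      push_cast; ring
    rw [this]
    have hyq : (k.factorial : ℚ) = P * y := by exact_mod_cast hy
    have hPq : (P:ℚ) ≠ 0 := by exact_mod_cast hP0
    have hmq : (m:ℚ) ≠ 0 := by positivity
    rw [hyq]
    have : (m:ℚ)^k = m^(k-s) * m^s := by rw [← pow_add]; congr 1; omega
    rw [this]; push_cast; field_simp
  · have hyb : |(y:ℝ)| ≤ 4^k := by
      have e1 : |P| * |y| = (k.factorial : ℤ) := by
        rw [← abs_mul, ← hy]; simp
      rw [hPabs] at e1
      have e2 : k.factorial ≤ ((i - s).factorial * (k - i).factorial) * 4^k := by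
        have c1 : ((i-s)+(k-i)).choose (i-s) * (i-s).factorial * (k-i).factorial = ((i-s)+(k-i)).factorial := by
          have := Nat.choose_mul_factorial_mul_factorial (Nat.le_add_right (i-s) (k-i))
          rwa [Nat.add_sub_cancel_left] at this
        have c2 : ((i-s)+(k-i)).choose (i-s) ≤ 2^((i-s)+(k-i)) := Nat.choose_le_two_pow _ _
        have c3 : k.factorial ≤ k * ((i-s)+(k-i)).factorial := by
          interval_cases s
          · have : i - 0 + (k - i) = k := by omega
            rw [this]; exact Nat.le_mul_of_pos_left _ (by omega)
          · have : i - 1 + (k - i) = k - 1 := by omega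
            rw [this, Nat.mul_factorial_pred (by omega)]
        have c4 : k ≤ 2^k := Nat.lt_two_pow_self.le
        have c5 : 2^((i-s)+(k-i)) ≤ 2^k := Nat.pow_le_pow_right (by norm_num) (by omega)
        calc k.factorial ≤ k * ((i-s)+(k-i)).factorial := c3
          _ = k * (((i-s)+(k-i)).choose (i-s) * (i-s).factorial * (k-i).factorial) := by rw [c1]
          _ ≤ 2^k * (2^k * (i-s).factorial * (k-i).factorial) := by gcongr; omega
          _ = _ := by
            have : (4:ℕ)^k = 2^k*2^k := by rw [← mul_pow]; norm_num
            rw [this]; ring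
      have e3 : (0:ℤ) < ((i - s).factorial * (k - i).factorial : ℕ) := by positivity
      have e4 : |y| ≤ 4^k := by
        have : (k.factorial : ℤ) ≤ (((i - s).factorial * (k - i).factorial : ℕ):ℤ) * 4^k := by exact_mod_cast e2
        rw [← e1] at this
        exact le_of_mul_le_mul_left this e3
      exact_mod_cast e4
    push_cast
    rw [abs_mul, mul_pow, abs_of_nonneg (by positivity : (0:ℝ) ≤ (m:ℝ)^s)]
    have : (m:ℝ)^s ≤ (m:ℝ)^k := pow_le_pow_right₀ (by exact_mod_cast hm) (by omega)
    gcongr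

open Finset in
lemma wg_weight1 (D m s k i : ℕ) (d : ℤ) (hd0 : d ≠ 0) (hd : |d| ≤ D) (hm : D < m) (hs : s ≤ 1) (hk : 1 ≤ k)
    (h2 : i ≤ k) :
    ∃ z : ℤ, (z:ℚ) = (k.factorial : ℚ) * (m:ℚ)^k * (Nat.lcmUpto (m*k+D) : ℚ)
        * ∏ x ∈ Icc s k, ((m:ℚ)*i + d - m * x)⁻¹ ∧
      |(z:ℝ)| ≤ (k+1) * ((4*m)^k : ℝ) * Nat.lcmUpto (m*k+D) := by
  set Λ := Nat.lcmUpto (m*k+D)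
  have hm0 : 0 < m := by omega
  have hmq : (m:ℚ) ≠ 0 := by positivity
  have hne : ∀ x : ℕ, ((m:ℤ)*i + d - m*x) ≠ 0 := by
    intro x h
    have : (m:ℤ) ∣ d := ⟨x - i, by linarith⟩
    have := Int.le_of_dvd (abs_pos.2 hd0) ((dvd_abs _ _).2 this)
    omega
  have hdvd : ∀ x ∈ Icc s k, ((m:ℤ)*i + d - m*x) ∣ (Λ:ℤ) := by
    intro x hx
    rw [mem_Icc] at hx
    rw [← Int.natAbs_dvd_natAbs, Int.natAbs_natCast]
    refine Finset.dvd_lcm (f := id) ?_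
    rw [mem_Icc]
    have h3 := hne x
    refine ⟨Int.natAbs_pos.2 h3, ?_⟩
    have h5 : ((m:ℤ)*i + d - m*x) ≤ m*k + D := by
      have := (abs_le.1 hd).2
      have : (m:ℤ)*i ≤ m*k := by gcongr
      have : (0:ℤ) ≤ m*x := by positivity
      omega
    have h6 : -(m*k + D : ℤ) ≤ ((m:ℤ)*i + d - m*x) := by
      have := (abs_le.1 hd).1
      have : (m:ℤ)*x ≤ m*k := by gcongr; omega
      have : (0:ℤ) ≤ m*i := by positivity
      omega
    have : ((((m:ℤ)*i + d - m*x).natAbs : ℕ) : ℤ) ≤ ((m*k+D : ℕ):ℤ) := by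
      rw [Int.natCast_natAbs]; push_cast; exact abs_le.2 ⟨h6, h5⟩
    exact_mod_cast this
  choose! y hy using hdvd
  have hW : ∀ x ∈ Icc s k, _ := fun x hx => wg_weight0 m s k x hm0 hs hk (mem_Icc.1 hx).1 (mem_Icc.1 hx).2
  choose! w hw1 hw2 using hW
  refine ⟨∑ x ∈ Icc s k, w x * y x, ?_, ?_⟩
  · have hinj : Set.InjOn (fun x : ℕ => (m:ℚ) * x) (Icc s k) := by
      intro a _ b _ h
      simpa [hmq] using h
    have hnode : ∀ x ∈ Icc s k, ((m:ℚ)*i + d) ≠ (fun x : ℕ => (m:ℚ) * x) x := by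
      intro x _ h
      apply hne x
      have : ((m:ℚ)*i + d - m*x) = 0 := by simp only at h; rw [h]; ring
      exact_mod_cast this
    have key := Lagrange.eval_interpolate_not_at_node (s := Icc s k) (v := fun x : ℕ => (m:ℚ) * x) 1 hnode
    rw [Lagrange.interpolate_one hinj ⟨k, by simp; omega⟩, Polynomial.eval_one, Lagrange.eval_nodal] at key
    have hprod : ∏ x ∈ Icc s k, ((m:ℚ)*i + d - m * x)⁻¹ = ∑ x ∈ Icc s k,
        Lagrange.nodalWeight (Icc s k) (fun x : ℕ => (m:ℚ) * x) x * ((m:ℚ)*i + d - m * x)⁻¹ := by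
      rw [Finset.prod_inv_distrib]
      simp only [Pi.one_apply, mul_one] at key
      exact (eq_inv_of_mul_eq_one_right key.symm).symm
    rw [hprod, Finset.mul_sum]
    push_cast
    refine Finset.sum_congr rfl fun x hx => ?_
    rw [hw1 x hx]
    have e : (Λ:ℚ) = ((m:ℚ)*i + d - m*x) * y x := by exact_mod_cast hy x hx
    have e0 : ((m:ℚ)*i + d - m*x) ≠ 0 := by exact_mod_cast hne x
    rw [e, Lagrange.nodalWeight]
    field_simp
  · have hyb : ∀ x ∈ Icc s k, |(y x:ℝ)| ≤ Λ := by
      intro x hx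
      have h1 : |y x| ≤ |(Λ:ℤ)| := by
        conv_rhs => rw [hy x hx, abs_mul]
        have := Int.one_le_abs (hne x)
        nlinarith [abs_nonneg (y x)]
      have h2 : |y x| ≤ (Λ:ℤ) := by simpa using h1
      exact_mod_cast h2
    push_cast
    refine (Finset.abs_sum_le_sum_abs _ _).trans ?_
    calc ∑ x ∈ Icc s k, |(w x:ℝ) * y x| ≤ ∑ x ∈ Icc s k, ((4*m)^k : ℝ) * Λ := by
          refine Finset.sum_le_sum fun x hx => ?_
          rw [abs_mul]
          have := hw2 x hx; have := hyb x hx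
          gcongr
      _ ≤ _ := by
          rw [Finset.sum_const, nsmul_eq_mul, Nat.card_Icc, mul_assoc]
          gcongr
          push_cast
          have : ((k + 1 - s : ℕ):ℝ) ≤ ((k+1 : ℕ):ℝ) := by exact_mod_cast Nat.sub_le _ _
          push_cast at this; exact this

lemma wg_lcm_bound (D m k : ℕ) (hm : D < m) (hk : 1 ≤ k) :
    (Nat.lcmUpto (m*k+D) : ℝ) ≤ (Real.exp ((Real.log 4 + 4) * (2*m)))^k := by
  have h1 := Chebyshev.psi_eq_log_lcmUpto (m*k+D)
  have h2 := Chebyshev.psi_le_const_mul_self (x := ((m*k+D : ℕ):ℝ)) (by positivity)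
  rw [h1] at h2
  have hpos : (0:ℝ) < Nat.lcmUpto (m*k+D) := by exact_mod_cast Nat.lcmUpto_pos _
  rw [← Real.exp_nat_mul, ← Real.log_le_iff_le_exp hpos]
  refine h2.trans ?_
  have h3 : ((m*k+D : ℕ):ℝ) ≤ 2*m*k := by
    have : D ≤ m * k := by nlinarith
    have : m*k+D ≤ 2*m*k := by nlinarith
    exact_mod_cast this
  have : 0 ≤ Real.log 4 + 4 := by have := Real.log_nonneg (show (1:ℝ) ≤ 4 by norm_num); linarith
  calc _ ≤ (Real.log 4 + 4) * (2*m*k) := by gcongr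
    _ = _ := by ring
end

section
open Finset in
lemma wg_int_weight (D m k : ℕ) (hm : D < m) (hk : 1 ≤ k) (t : Fin (D+1)) (e : ℕ × Fin (D+1))
    (S : Finset (ℕ × Fin (D+1)))
    (hS : S = (range (k+1) ×ˢ univ).filter (fun e => 1 ≤ e.1 ∨ e.2 = t)) (he : e ∈ S)
    (v : ℕ × Fin (D+1) → ℚ) (hv : v = fun e => (m:ℚ) * e.1 + (e.2 : ℕ)) :
    ∃ z : ℤ, (z:ℚ) = ((k.factorial : ℚ) * (m:ℚ)^k * (Nat.lcmUpto (m*k+D) : ℚ))^(D+1) *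
        Lagrange.nodalWeight S v e ∧
      |(z:ℝ)| ≤ ((8 * m * Real.exp ((Real.log 4 + 4) * (2*m)))^(D+1))^k := by
  classical
  have hw : Lagrange.nodalWeight S v e = ∏ j : Fin (D+1), ∏ i ∈ Icc (if j = t then 0 else 1) k,
      if (i,j) = e then 1 else (v e - v (i,j))⁻¹ := by
    rw [Lagrange.nodalWeight]
    have h1 : ∏ j ∈ S.erase e, (v e - v j)⁻¹ = ∏ j ∈ S, if j = e then 1 else (v e - v j)⁻¹ := by
      rw [← Finset.mul_prod_erase S _ he]
      simp only [if_true, one_mul]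
      exact Finset.prod_congr rfl fun j hj => by rw [if_neg (Finset.ne_of_mem_erase hj)]
    rw [h1, hS, Finset.prod_filter, Finset.prod_product_right]
    refine Finset.prod_congr rfl fun j _ => ?_
    rw [← Finset.prod_filter]
    refine Finset.prod_congr ?_ fun _ _ => rfl
    ext x
    simp only [mem_filter, mem_range, mem_Icc]
    split_ifs with h <;> simp [h] <;> omega
  rw [hw]
  set Λ := Nat.lcmUpto (m*k+D)
  have hΛ : (Λ:ℝ) ≤ _ := wg_lcm_bound D m k hm hk
  have hΛ1 : (1:ℝ) ≤ Λ := by exact_mod_cast Nat.lcmUpto_pos _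
  set B := Real.exp ((Real.log 4 + 4) * (2*m))
  have hfac : ∀ j : Fin (D+1), ∃ z : ℤ, (z:ℚ) = ((k.factorial : ℚ) * (m:ℚ)^k * (Λ : ℚ)) *
      ∏ i ∈ Icc (if j = t then 0 else 1) k, (if (i,j) = e then 1 else (v e - v (i,j))⁻¹) ∧
      |(z:ℝ)| ≤ (8 * m * B)^k := by
    intro j
    have he' := he
    rw [hS, mem_filter, mem_product, mem_range] at he'
    obtain ⟨⟨he1, -⟩, he2⟩ := he'
    have hsle : (if j = t then 0 else 1) ≤ 1 := by split_ifs <;> norm_num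
    by_cases hj : j = e.2
    · obtain ⟨z, hz1, hz2⟩ := wg_weight0 m (if j = t then 0 else 1) k e.1 (by omega) hsle hk
        (by rw [hj]; split_ifs with h
            · omega
            · rcases he2 with h' | h'
              · exact h'
              · exact absurd h' h) (by omega)
      refine ⟨z * Λ, ?_, ?_⟩
      · push_cast
        rw [hz1]
        have : ∏ i ∈ Icc (if j = t then 0 else 1) k, (if (i,j) = e then 1 else (v e - v (i,j))⁻¹)
            = ∏ x ∈ (Icc (if j = t then 0 else 1) k).erase e.1, ((m:ℚ)*e.1 - m * x)⁻¹ := by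
          rw [← Finset.mul_prod_erase (Icc (if j = t then 0 else 1) k) _ (a := e.1)]
          · rw [if_pos (by rw [hj]), one_mul]
            refine Finset.prod_congr rfl fun x hx => ?_
            rw [if_neg (by intro h; exact Finset.ne_of_mem_erase hx (by rw [← h]))]
            rw [hv, hj]; simp
          · rw [mem_Icc]; refine ⟨?_, by omega⟩
            rw [hj]; split_ifs with h
            · omega
            · rcases he2 with h' | h'
              · exact h'
              · exact absurd h' h
        rw [this]; ring
      · push_cast
        rw [abs_mul, Nat.abs_cast, mul_pow]
        have : ((4*m:ℝ))^k ≤ (8*m)^k := by gcongr; norm_num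
        gcongr
        exact hz2.trans this
    · obtain ⟨z, hz1, hz2⟩ := wg_weight1 D m (if j = t then 0 else 1) k e.1 ((e.2:ℕ) - (j:ℕ) : ℤ)
        (by intro h; apply hj; ext; omega) (by rw [abs_le]; omega) hm hsle hk (by omega)
      refine ⟨z, ?_, ?_⟩
      · rw [hz1]
        congr 1
        refine Finset.prod_congr rfl fun x hx => ?_
        rw [if_neg (by intro h; apply hj; rw [← h])]
        rw [hv]; push_cast; congr 1; ring
      · refine hz2.trans ?_
        have h2 : (k+1:ℝ) ≤ 2^k := by exact_mod_cast Nat.lt_two_pow_self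
        have : (8*m*B)^k = 2^k * (4*m)^k * B^k := by rw [← mul_pow, ← mul_pow]; congr 1; ring
        rw [this]
        gcongr
  choose z hz1 hz2 using hfac
  refine ⟨∏ j, z j, ?_, ?_⟩
  · push_cast
    simp_rw [hz1]
    rw [Finset.prod_mul_distrib]
    simp
  · push_cast
    rw [Finset.abs_prod, ← pow_mul, mul_comm (D+1) k, pow_mul]
    calc ∏ j, |(z j:ℝ)| ≤ ∏ j : Fin (D+1), (8 * m * B)^k :=
          Finset.prod_le_prod (fun _ _ => abs_nonneg _) fun j _ => hz2 j
      _ = _ := by simp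

open Finset Polynomial in
lemma wg_det_aux {D m k : ℕ} (hm : 0 < m) (M : Matrix (Fin (D+1)) (Fin (D+1)) ℤ[X])
    (hdeg : ∀ t j, (M t j).natDegree ≤ k)
    (h0 : (M.det).eval 0 ≠ 0)
    (hdvd : ∀ t, (X - C 1 : ℤ[X])^((D+1)*k) ∣ ∑ j, expand ℤ m (M t j) * X^(j:ℕ)) :
    ∃ c : ℤ, c ≠ 0 ∧ M.det = C c * (X - C 1)^((D+1)*k) := by
  set N := (D+1)*k
  have hne : M.det ≠ 0 := by intro h; rw [h] at h0; simp at h0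
  have hd : M.det.natDegree ≤ N := by
    rw [Matrix.det_apply]
    refine natDegree_sum_le_of_forall_le _ _ fun σ _ => ?_
    refine (natDegree_smul_le _ _).trans ?_
    refine (natDegree_prod_le _ _).trans ?_
    calc _ ≤ ∑ i : Fin (D+1), k := Finset.sum_le_sum fun i _ => hdeg _ _
      _ = N := by simp [N]
  have h1 : (X - C 1 : ℤ[X])^N ∣ expand ℤ m M.det := by
    have e1 : expand ℤ m M.det = ((expand ℤ m).toRingHom.mapMatrix M).det :=
      RingHom.map_det (expand ℤ m).toRingHom M
    set M' := (expand ℤ m).toRingHom.mapMatrix M with hM'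
    set y : Fin (D+1) → ℤ[X] := fun j => X^(j:ℕ)
    have e2 : M'.adjugate.mulVec (M'.mulVec y) = M'.det • y := by
      rw [Matrix.mulVec_mulVec, Matrix.adjugate_mul, Matrix.smul_mulVec, Matrix.one_mulVec]
    have e3 := congrFun e2 0
    have e4 : (M'.det • y) 0 = M'.det := by simp [y]
    rw [e1, ← e4, ← e3, Matrix.mulVec, dotProduct]
    refine Finset.dvd_sum fun t _ => Dvd.dvd.mul_left ?_ _
    exact hdvd t
  have h2 : (X - C 1 : ℤ[X])^N ∣ M.det := by
    obtain ⟨g, hg1, hg2⟩ := exists_eq_pow_rootMultiplicity_mul_and_not_dvd M.det hne 1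
    set r := rootMultiplicity 1 M.det
    by_cases hr : N ≤ r
    · rw [hg1]; exact (pow_dvd_pow _ hr).mul_right _
    · exfalso
      push Not at hr
      set s : ℤ[X] := ∑ i ∈ range m, X^i with hs
      have e1 : (X^m - 1 : ℤ[X]) = (X - C 1) * s := by
        rw [hs, mul_comm, map_one, geom_sum_mul]
      have e2 : expand ℤ m M.det = (X - C 1)^r * (s^r * expand ℤ m g) := by
        rw [hg1, map_mul, map_pow, map_sub, expand_X, expand_C, map_one, e1, mul_pow]
        simp only [map_one]; ring
      rw [e2] at h1
      have e3 : (X - C 1 : ℤ[X])^N = (X - C 1)^r * (X - C 1)^(N - r) := by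
        rw [← pow_add]; congr 1; omega
      rw [e3] at h1
      have e4 := (mul_dvd_mul_iff_left (pow_ne_zero r (X_sub_C_ne_zero (1:ℤ)))).1 h1
      have e5 : (X - C 1 : ℤ[X]) ∣ s^r * expand ℤ m g :=
        (dvd_pow_self _ (by omega)).trans e4
      rw [dvd_iff_isRoot, IsRoot.def, eval_mul, eval_pow, expand_eval, one_pow, mul_eq_zero] at e5
      rcases e5 with e5 | e5
      · have := (pow_eq_zero_iff (M₀ := ℤ) (n := r) (by rintro h; rw [h] at e5; simp at e5)).1 e5
        simp [hs, eval_finsetSum] at this; omega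
      · exact hg2 (dvd_iff_isRoot.2 e5)
  obtain ⟨q, hq⟩ := h2
  have hq0 : q ≠ 0 := by intro h; rw [h, mul_zero] at hq; exact hne hq
  have hqd : q.natDegree = 0 := by
    rw [hq, natDegree_mul (pow_ne_zero _ (X_sub_C_ne_zero _)) hq0, natDegree_pow, natDegree_X_sub_C] at hd
    omega
  rw [eq_C_of_natDegree_eq_zero hqd] at hq hq0
  exact ⟨q.coeff 0, by intro h; rw [h] at hq0; simp at hq0, by rw [hq, mul_comm]⟩
end

section
open Finset Polynomial in
lemma wg_pade (D m : ℕ) (hm : D < m) : ∃ B : ℝ, 1 ≤ B ∧ ∀ k : ℕ, 1 ≤ k →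
    ∃ a : Fin (D+1) → ℕ → Fin (D+1) → ℤ,
      (∀ t i j, |(a t i j : ℝ)| ≤ B^k) ∧
      (∀ t, (X - C 1 : ℤ[X])^((D+1)*k) ∣ ∑ i ∈ range (k+1), ∑ j : Fin (D+1),
        C (a t i j) * X^(m*i+j)) ∧
      ∃ c : ℤ, c ≠ 0 ∧ (Matrix.of fun t j => ∑ i ∈ range (k+1), C (a t i j) * X^i : 
        Matrix (Fin (D+1)) (Fin (D+1)) ℤ[X]).det = C c * (X - C 1)^((D+1)*k) := by
  classical
  set B : ℝ := (8 * m * Real.exp ((Real.log 4 + 4) * (2*m)))^(D+1) with hB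
  have hm1 : (1:ℝ) ≤ m := by exact_mod_cast (by omega : 1 ≤ m)
  have hB1 : 1 ≤ B := by
    refine one_le_pow₀ ?_
    have : 1 ≤ Real.exp ((Real.log 4 + 4) * (2*m)) := by
      rw [Real.one_le_exp_iff]
      have := Real.log_nonneg (show (1:ℝ) ≤ 4 by norm_num)
      positivity
    nlinarith
  refine ⟨B, hB1, fun k hk => ?_⟩
  set S : Fin (D+1) → Finset (ℕ × Fin (D+1)) := 
    fun t => (range (k+1) ×ˢ univ).filter (fun e => 1 ≤ e.1 ∨ e.2 = t) with hS
  set v : ℕ × Fin (D+1) → ℚ := fun e => (m:ℚ) * e.1 + (e.2 : ℕ) with hv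
  set T : ℚ := ((k.factorial : ℚ) * (m:ℚ)^k * (Nat.lcmUpto (m*k+D) : ℚ))^(D+1) with hT
  have hT0 : T ≠ 0 := by
    have : (Nat.lcmUpto (m*k+D) : ℚ) ≠ 0 := by exact_mod_cast Nat.lcmUpto_ne_zero _
    have : (m:ℚ) ≠ 0 := by exact_mod_cast (by omega : m ≠ 0)
    positivity
  have hz : ∀ t, ∀ e ∈ S t, _ := fun t e he => wg_int_weight D m k hm hk t e (S t) rfl he v rfl
  choose! z hz1 hz2 using hz
  have hvinj : Function.Injective v := by
    rintro ⟨i, j⟩ ⟨i', j'⟩ h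
    have h1 : m * i + (j:ℕ) = m * i' + (j':ℕ) := by
      simp only [hv] at h; exact_mod_cast h
    have hj := j.2; have hj' := j'.2
    have h2 : (j:ℕ) = j' := by
      have := congrArg (· % m) h1
      simpa [Nat.mul_add_mod, Nat.mod_eq_of_lt (show (j:ℕ) < m by omega), Nat.mod_eq_of_lt (show (j':ℕ) < m by omega)] using this
    have h3 : i = i' := by
      rw [h2] at h1
      exact Nat.eq_of_mul_eq_mul_left (by omega) (Nat.add_right_cancel h1)
    rw [Prod.mk.injEq]; exact ⟨h3, Fin.ext h2⟩
  have hcard : ∀ t, (S t).card = (D+1)*k + 1 := by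
    intro t
    have : S t = insert (0,t) (Icc 1 k ×ˢ univ) := by
      ext ⟨i,j⟩
      simp only [hS, mem_filter, mem_product, mem_range, mem_univ, and_true, mem_insert, Prod.mk.injEq, mem_Icc]
      constructor
      · rintro ⟨h1, h2⟩
        by_cases hi : 1 ≤ i
        · right; omega
        · left; exact ⟨by omega, by tauto⟩
      · rintro (⟨h1, h2⟩ | h)
        · exact ⟨by omega, Or.inr h2⟩
        · omega
    rw [this, card_insert_of_notMem (by simp), card_product]
    simp [mul_comm]
  have hdv : ∀ t, (X - C 1 : ℤ[X])^((D+1)*k) ∣ ∑ i ∈ range (k+1), ∑ j : Fin (D+1),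
        C (if (i,j) ∈ S t then z t (i,j) else 0) * X^(m*i+j) := by
    intro t
    rw [X_sub_C_pow_dvd_iff, X_pow_dvd_iff]
    intro d hd
    have e1 := taylor_coeff (R := ℤ) 1 (∑ i ∈ range (k+1), ∑ j : Fin (D+1),
        C (if (i,j) ∈ S t then z t (i,j) else 0) * X^(m*i+j)) d
    rw [taylor_apply] at e1
    rw [e1]
    simp only [map_sum, eval_finsetSum, hasseDeriv_apply]
    have e2 : ∀ i (j : Fin (D+1)), eval 1 ((C (if (i,j) ∈ S t then z t (i,j) else 0) * X ^ (m * i + (j:ℕ))).sum 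
        fun i r => (monomial (i - d)) (((i.choose d : ℕ) : ℤ) * r)) = 
        ((m*i+j).choose d : ℤ) * (if (i,j) ∈ S t then z t (i,j) else 0) := by
      intro i j
      rw [C_mul_X_pow_eq_monomial, sum_monomial_index _ _ (by simp), eval_monomial]; simp
    simp_rw [e2]
    rw [← Finset.sum_product' (range (k+1)) univ 
      (fun i (j : Fin (D+1)) => ((m*i+j).choose d : ℤ) * (if (i,j) ∈ S t then z t (i,j) else 0))]
    have e3 : ∑ x ∈ range (k+1) ×ˢ (univ : Finset (Fin (D+1))), 
        ((m*x.1+(x.2:ℕ)).choose d : ℤ) * (if (x.1,x.2) ∈ S t then z t (x.1,x.2) else 0) =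
        ∑ x ∈ S t, ((m*x.1+(x.2:ℕ)).choose d : ℤ) * z t x := by
      have hsub : S t ⊆ range (k+1) ×ˢ univ := Finset.filter_subset _ _
      rw [← Finset.sum_subset hsub]
      · exact Finset.sum_congr rfl fun x hx => by rw [if_pos hx]
      · intro x _ hx; rw [if_neg hx, mul_zero]
    rw [e3]
    have e4 : ((∑ x ∈ S t, ((m*x.1+(x.2:ℕ)).choose d : ℤ) * z t x : ℤ) : ℚ) = 0 := by
      push_cast
      have key := Lagrange.coeff_eq_sum (s := S t) (v := v) hvinj.injOn (P := descPochhammer ℚ d) (by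
        rw [hcard]; refine (degree_le_natDegree).trans_lt ?_
        rw [descPochhammer_natDegree]; exact_mod_cast (by omega))
      rw [hcard, coeff_eq_zero_of_natDegree_lt (by rw [descPochhammer_natDegree]; omega)] at key
      have : ∑ x ∈ S t, ((m*x.1+(x.2:ℕ)).choose d : ℚ) * z t x = 
         (T / d.factorial) * ∑ i ∈ S t, (descPochhammer ℚ d).eval (v i) / ∏ j ∈ (S t).erase i, (v i - v j) := by
        rw [Finset.mul_sum]
        refine Finset.sum_congr rfl fun x hx => ?_
        rw [hz1 t x hx, ← hT, Lagrange.nodalWeight, Finset.prod_inv_distrib]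
        have : v x = ((m*x.1+(x.2:ℕ) : ℕ) : ℚ) := by simp [hv]
        have e5 : (descPochhammer ℚ d).eval (v x) = d.factorial * ((m*x.1+(x.2:ℕ)).choose d : ℚ) := by
          rw [this, descPochhammer_eval_eq_descFactorial, Nat.descFactorial_eq_factorial_mul_choose]
          push_cast; rfl
        rw [e5]
        have : (d.factorial : ℚ) ≠ 0 := by positivity
        field_simp
      rw [this, ← key, mul_zero]
    exact_mod_cast e4
  refine ⟨fun t i j => if (i,j) ∈ S t then z t (i,j) else 0, ?_, hdv, ?_⟩
  · intro t i j
    beta_reduce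
    split_ifs with h
    · exact hz2 t _ h
    · simp; positivity
  · refine wg_det_aux (k := k) (m := m) (by omega) _ ?_ ?_ ?_
    · intro t j
      rw [Matrix.of_apply]
      refine natDegree_sum_le_of_forall_le _ _ fun i hi => ?_
      refine (natDegree_C_mul_X_pow_le _ _).trans ?_
      have := mem_range.1 hi; omega
    · have e1 : ∀ M : Matrix (Fin (D+1)) (Fin (D+1)) ℤ[X], M.det.eval 0 = ((evalRingHom (0:ℤ)).mapMatrix M).det :=
        fun M => RingHom.map_det (evalRingHom (0:ℤ)) M
      rw [e1]
      have e2 : ((evalRingHom (0:ℤ)).mapMatrix (Matrix.of fun t j => ∑ i ∈ range (k+1), C (if (i,j) ∈ S t then z t (i,j) else 0) * X^i : 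
        Matrix (Fin (D+1)) (Fin (D+1)) ℤ[X])) = Matrix.diagonal (fun t => z t (0,t)) := by
        ext t j
        rw [RingHom.mapMatrix_apply, Matrix.map_apply, Matrix.of_apply, coe_evalRingHom, eval_finsetSum,
          Finset.sum_range_succ']
        have : ∀ i ∈ range k, eval 0 (C (if (i+1,j) ∈ S t then z t (i+1,j) else 0) * X^(i+1)) = (0:ℤ) := by
          intro i _; rw [eval_mul, eval_pow, eval_X]; simp
        rw [Finset.sum_eq_zero this, zero_add, pow_zero, mul_one, eval_C, Matrix.diagonal_apply]
        by_cases h : t = j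
        · rw [if_pos h, if_pos (by simp [hS, h]), h]
        · rw [if_neg h, if_neg]
          simp [hS, Ne.symm h]
      rw [e2, Matrix.det_diagonal]
      refine Finset.prod_ne_zero_iff.2 fun t _ => ?_
      have hmem : (0,t) ∈ S t := by simp [hS]
      have h1 := hz1 t (0,t) hmem
      intro h
      rw [h] at h1
      have := mul_ne_zero hT0 (Lagrange.nodalWeight_ne_zero (v := v) hvinj.injOn hmem)
      exact this (by rw [← h1]; simp)
    · intro t
      simp only [Matrix.of_apply]
      convert hdv t using 1
      rw [Finset.sum_comm]
      refine Finset.sum_congr rfl fun j _ => ?_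
      rw [map_sum, Finset.sum_mul]
      refine Finset.sum_congr rfl fun i _ => ?_
      rw [map_mul, map_pow, expand_C, expand_X, ← pow_mul, mul_assoc, ← pow_add]
end

section
open NumberField

lemma wg_prod_emb {L : Type*} [Field L] [NumberField L] (z : 𝓞 L) (hz : z ≠ 0) :
    1 ≤ ∏ τ : L →+* ℂ, ‖τ (z:L)‖ := by
  have h1 : ∏ τ : L →+* ℂ, ‖τ (z:L)‖ = ‖((Algebra.norm ℚ (z:L) : ℚ) : ℂ)‖ := by
    have := Algebra.norm_eq_prod_embeddings ℚ ℂ (z:L)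
    rw [eq_ratCast] at this
    rw [this, norm_prod]
    exact Fintype.prod_equiv (RingHom.equivRatAlgHom L ℂ) _ _ (fun τ => rfl)
  have h2 : ((Algebra.norm ℤ z : ℤ) : ℚ) = Algebra.norm ℚ (z:L) := by
    rw [← Algebra.coe_norm_int]
  rw [h1, ← h2]
  have h3 : Algebra.norm ℤ z ≠ 0 := Algebra.norm_ne_zero_iff.2 hz
  have := Int.one_le_abs h3
  simp only [Rat.cast_intCast, Complex.norm_intCast]
  exact_mod_cast this

open Polynomial Finset in
lemma wg_eval_bound {ι : Type*} (s : Finset ι) (a : ι → ℤ) (f : ι → ℕ) (N : ℕ) (E : ℕ)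
    (hE : ∀ i ∈ s, f i ≤ E)
    (h : (X - C 1 : ℤ[X])^N ∣ ∑ i ∈ s, C (a i) * X^(f i)) (y : ℂ) (hy : ‖y - 1‖ ≤ 1) :
    ‖∑ i ∈ s, (a i : ℂ) * y^(f i)‖ ≤ ‖y-1‖^N * ∑ i ∈ s, |(a i : ℝ)| * 2^(f i) := by
  set P : ℤ[X] := ∑ i ∈ s, C (a i) * X^(f i) with hP
  set Q := P.comp (X + C 1) with hQ
  rw [X_sub_C_pow_dvd_iff, X_pow_dvd_iff] at h
  have hc : ∀ n, Q.coeff n = ∑ i ∈ s, a i * ((f i).choose n : ℤ) := by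
    intro n
    rw [hQ, hP, Polynomial.sum_comp, finsetSum_coeff]
    refine Finset.sum_congr rfl fun i _ => ?_
    rw [mul_comp, C_comp, X_pow_comp, coeff_C_mul, map_one, coeff_X_add_one_pow]
  have hdeg : Q.natDegree < E + 1 := by
    rw [Nat.lt_succ_iff]
    refine natDegree_le_iff_coeff_eq_zero.2 fun n hn => ?_
    rw [hc]
    refine Finset.sum_eq_zero fun i hi => ?_
    rw [Nat.choose_eq_zero_of_lt (by have := hE i hi; omega)]; simp
  have e1 : ∑ i ∈ s, (a i : ℂ) * y^(f i) = ∑ n ∈ range (E+1), (Q.coeff n : ℂ) * (y-1)^n := by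
    have e2 : aeval (y-1) Q = ∑ i ∈ s, (a i : ℂ) * y^(f i) := by
      rw [hQ, aeval_comp]
      simp [hP]
    rw [← e2, aeval_eq_sum_range' hdeg]
    simp
  rw [e1]
  refine (norm_sum_le _ _).trans ?_
  calc ∑ n ∈ range (E+1), ‖(Q.coeff n : ℂ) * (y-1)^n‖ 
      ≤ ∑ n ∈ range (E+1), ‖y-1‖^N * ∑ i ∈ s, |(a i : ℝ)| * ((f i).choose n) := by
        refine Finset.sum_le_sum fun n _ => ?_
        by_cases hn : n < N
        · rw [h n hn]; simp; positivity
        · push Not at hn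
          rw [norm_mul, norm_pow, mul_comm]
          refine mul_le_mul (pow_le_pow_of_le_one (norm_nonneg _) hy hn) ?_ (norm_nonneg _) (by positivity)
          rw [hc]; push_cast
          refine (norm_sum_le _ _).trans (le_of_eq ?_)
          refine Finset.sum_congr rfl fun i _ => ?_
          rw [norm_mul, Complex.norm_intCast, Complex.norm_natCast]
    _ = _ := by
        rw [← Finset.mul_sum, Finset.sum_comm]
        congr 1
        refine Finset.sum_congr rfl fun i hi => ?_
        rw [← Finset.mul_sum]
        congr 1
        have := Nat.sum_range_choose (f i)
        have e3 : ∑ n ∈ range (E+1), (f i).choose n = 2^(f i) := by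
          rw [← this]
          refine (Finset.sum_subset (by intro x; simp; have := hE i hi; omega) ?_).symm
          intro x _ hx
          exact Nat.choose_eq_zero_of_lt (by simpa using hx)
        exact_mod_cast e3

set_option maxHeartbeats 2000000 in
open Polynomial Finset in
lemma wg_core {L : Type*} [Field L] [NumberField L] (σ : L →+* ℂ) (D m : ℕ) (hm : D < m)
    (a0 b0 : 𝓞 L) (ha0 : a0 ≠ 0) (hb0 : b0 ≠ 0) (θ : ℂ) (hθ : θ^m * σ b0 = σ a0) :
    ∃ G : ℝ, 1 ≤ G ∧ ∀ k : ℕ, 1 ≤ k → ∀ (u u' : (𝓞 L)ˣ) (H H' : ℝ), 1 ≤ H → 1 ≤ H' →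
      (∀ τ : L →+* ℂ, ‖τ (u : 𝓞 L)‖ ≤ H) → (∀ τ : L →+* ℂ, ‖τ (u'⁻¹ : (𝓞 L)ˣ)‖ ≤ H') →
      a0 * (u:𝓞 L)^m ≠ b0 →
      ‖θ * σ (u : 𝓞 L) - 1‖ ≤ 1/2 → ‖θ * σ (u' : 𝓞 L) - 1‖ ≤ 1/2 →
      1 ≤ G^(k * Module.finrank ℚ L) * (‖θ * σ (u : 𝓞 L) - 1‖^((D+1)*k) + ‖θ * σ (u' : 𝓞 L) - 1‖)
        * (H^(m*k) * (H * H')^D)^(Module.finrank ℚ L) := by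
  classical
  obtain ⟨B, hB1, hpade⟩ := wg_pade D m hm
  obtain ⟨A, hA1, hA⟩ : ∃ A : ℝ, 1 ≤ A ∧ ∀ τ : L →+* ℂ, ‖τ a0‖ ≤ A ∧ ‖τ b0‖ ≤ A := by
    refine ⟨1 + ∑ τ : L →+* ℂ, (‖τ a0‖ + ‖τ b0‖), ?_, fun τ => ?_⟩
    · have : 0 ≤ ∑ τ : L →+* ℂ, (‖τ a0‖ + ‖τ b0‖) := by positivity
      linarith
    · have := Finset.single_le_sum (f := fun τ : L →+* ℂ => ‖τ a0‖ + ‖τ b0‖) (fun _ _ => by positivity) (mem_univ τ)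
      constructor <;> linarith [norm_nonneg (τ a0), norm_nonneg (τ b0)]
  set G : ℝ := 2 * (D+1)^2 * 8^D * 8^m * A * B with hG
  have h8D : (1:ℝ) ≤ 8^D := one_le_pow₀ (by norm_num)
  have h8m : (1:ℝ) ≤ 8^m := one_le_pow₀ (by norm_num)
  have hD1 : (1:ℝ) ≤ (D+1)^2 := one_le_pow₀ (by have : (0:ℝ) ≤ D := by positivity
                                                linarith)
  have hGAB : A * B ≤ G := by
    rw [hG]
    have : (1:ℝ) ≤ 2 * (D+1)^2 * 8^D * 8^m := by
      have := one_le_mul_of_one_le_of_one_le (one_le_mul_of_one_le_of_one_le hD1 h8D) h8m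
      nlinarith
    have : 0 ≤ A * B := by positivity
    nlinarith
  have hG1 : 1 ≤ G := (one_le_mul_of_one_le_of_one_le hA1 hB1).trans hGAB
  refine ⟨G, hG1, fun k hk u u' H H' hH hH' hu hu' hne hY hY' => ?_⟩
  obtain ⟨a, haB, hdvd, c, hc0, hdet⟩ := hpade k hk
  set n := Module.finrank ℚ L with hn
  set Y := θ * σ (u : 𝓞 L) with hYdef
  set Y' := θ * σ (u' : 𝓞 L) with hYdef'
  have hb0L : (b0 : L) ≠ 0 := by exact_mod_cast hb0
  set w : L := a0 * (u : 𝓞 L)^m / b0 with hw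
  have hw1 : w ≠ 1 := by
    intro h
    rw [hw, div_eq_one_iff_eq hb0L] at h
    exact hne (by exact_mod_cast h)
  set ρ : 𝓞 L := ((u * u'⁻¹ : (𝓞 L)ˣ) : 𝓞 L) with hρ
  -- nonvanishing
  obtain ⟨t, ht⟩ : ∃ t : Fin (D+1), ∑ j : Fin (D+1), (∑ i ∈ range (k+1), (a t i j : L) * w^i) * (ρ:L)^(j:ℕ) ≠ 0 := by
    by_contra hcon
    push Not at hcon
    set M : Matrix (Fin (D+1)) (Fin (D+1)) ℤ[X] := (Matrix.of fun t j => ∑ i ∈ range (k+1), C (a t i j) * X^i)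
    have e1 : ((aeval w : ℤ[X] →ₐ[ℤ] L).toRingHom.mapMatrix M).det = aeval w M.det :=
      (RingHom.map_det (aeval w : ℤ[X] →ₐ[ℤ] L).toRingHom M).symm
    have e2 : aeval w M.det ≠ 0 := by
      rw [hdet]
      simp only [map_mul, map_pow, map_sub, aeval_X, map_one]
      refine mul_ne_zero (by simpa using hc0) (pow_ne_zero _ (sub_ne_zero.2 hw1))
    rw [← e1] at e2
    have e3 := Matrix.eq_zero_of_mulVec_eq_zero e2 (v := fun j : Fin (D+1) => (ρ:L)^(j:ℕ)) (by
      ext t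
      rw [Matrix.mulVec, dotProduct, Pi.zero_apply, ← hcon t]
      refine Finset.sum_congr rfl fun j _ => ?_
      congr 1
      simp [M])
    have := congrFun e3 0
    simp at this
  set z : 𝓞 L := ∑ i ∈ range (k+1), ∑ j : Fin (D+1), (a t i j : 𝓞 L) * (a0^i * b0^(k-i) * (u:𝓞 L)^(m*i) * ρ^(j:ℕ)) with hz
  have hzL : (z : L) = b0^k * ∑ j : Fin (D+1), (∑ i ∈ range (k+1), (a t i j : L) * w^i) * (ρ:L)^(j:ℕ) := by
    rw [hz]
    push_cast
    rw [Finset.sum_comm, Finset.mul_sum]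
    refine Finset.sum_congr rfl fun j _ => ?_
    rw [Finset.sum_mul, Finset.mul_sum]
    refine Finset.sum_congr rfl fun i hi => ?_
    have e : (b0:L)^k = b0^(k-i) * b0^i := by rw [← pow_add]; congr 1; have := mem_range.1 hi; omega
    rw [e, hw, div_pow, mul_pow, ← pow_mul]
    have hcast : (((a t i j : 𝓞 L)) : L) = (a t i j : L) := map_intCast (algebraMap (𝓞 L) L) _
    refine Eq.trans (congrArg (· * _) hcast) ?_
    field_simp
  have hz0 : z ≠ 0 := by
    intro h
    have h' : (z:L) = 0 := by rw [h]; simp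
    rw [hzL] at h'
    exact (mul_ne_zero (pow_ne_zero _ hb0L) ht) h'
  have hk2 : ((k:ℝ)+1) ≤ 2^k := by exact_mod_cast Nat.lt_two_pow_self
  have hD1k : ((D:ℝ)+1)^2 ≤ (((D:ℝ)+1)^2)^k := le_self_pow₀ hD1 (by omega)
  have h8Dk : (8:ℝ)^D ≤ ((8:ℝ)^D)^k := le_self_pow₀ h8D (by omega)
  have hGk : G^k = 2^k * (((D:ℝ)+1)^2)^k * ((8:ℝ)^D)^k * ((8:ℝ)^m)^k * A^k * B^k := by
    rw [hG]; simp only [mul_pow]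
  have hother : ∀ τ : L →+* ℂ, ‖τ (z:L)‖ ≤ G^k * (H^(m*k) * (H * H')^D) := by
    intro τ
    have hρn : ‖τ (ρ:L)‖ ≤ H * H' := by
      rw [hρ]; push_cast
      rw [map_mul, norm_mul]
      exact mul_le_mul (hu τ) (by simpa using hu' τ) (norm_nonneg _) (by positivity)
    have hHH : 1 ≤ H * H' := one_le_mul_of_one_le_of_one_le hH hH'
    rw [hz]
    push_cast
    rw [map_sum]
    simp only [map_sum]
    have hterm : ∀ i ∈ range (k+1), ∀ j : Fin (D+1),
      ‖τ ((a t i j : L) * (a0^i * b0^(k-i) * (u:𝓞 L)^(m*i) * ρ^(j:ℕ)))‖ ≤ B^k * (A^k * (H^(m*k) * (H*H')^D)) := by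
      intro i hi j
      have hi' := mem_range.1 hi
      simp only [map_mul, map_pow, norm_mul, norm_pow, map_intCast, Complex.norm_intCast]
      refine mul_le_mul (haB t i j) ?_ (by positivity) (by positivity)
      rw [mul_assoc (‖τ a0‖^i * _)]
      refine mul_le_mul ?_ (mul_le_mul ?_ ?_ (by positivity) (by positivity)) (by positivity) (by positivity)
      · calc _ ≤ A^i * A^(k-i) := by
              have := (hA τ).1; have := (hA τ).2; gcongr
          _ = A^k := by rw [← pow_add]; congr 1; omega
      · calc _ ≤ H^(m*i) := by have := hu τ; gcongr
          _ ≤ _ := pow_le_pow_right₀ hH (by gcongr; omega)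
      · calc _ ≤ (H*H')^(j:ℕ) := by gcongr
          _ ≤ _ := pow_le_pow_right₀ hHH (by omega)
    calc _ ≤ ∑ i ∈ range (k+1), ∑ j : Fin (D+1), B^k * (A^k * (H^(m*k) * (H*H')^D)) := by
          refine norm_sum_le_of_le _ fun i hi => norm_sum_le_of_le _ fun j _ => ?_
          exact hterm i hi j
      _ = ((k:ℝ)+1) * ((D:ℝ)+1) * (B^k * A^k) * (H^(m*k) * (H*H')^D) := by
          simp; ring
      _ ≤ _ := by
          have hDk' : ((D:ℝ)+1) ≤ (((D:ℝ)+1)^2)^k := by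
            refine le_trans ?_ hD1k
            have : (0:ℝ) ≤ D := by positivity
            nlinarith
          have h1 : (1:ℝ) ≤ ((8:ℝ)^D)^k := one_le_pow₀ h8D
          have h2 : (1:ℝ) ≤ ((8:ℝ)^m)^k := one_le_pow₀ h8m
          gcongr
          rw [hGk]
          calc ((k:ℝ)+1) * ((D:ℝ)+1) * (B^k * A^k) ≤ 2^k * (((D:ℝ)+1)^2)^k * (B^k * A^k) := by gcongr
            _ = 2^k * (((D:ℝ)+1)^2)^k * 1 * 1 * A^k * B^k := by ring
            _ ≤ _ := by gcongr
  have hσ : ‖σ (z:L)‖ ≤ G^k * (‖Y - 1‖^((D+1)*k) + ‖Y' - 1‖) := by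
    have hYn : ‖Y‖ ≤ 2 := by
      have := norm_add_le (Y-1) 1; simp at this; linarith
    have hYn' : ‖Y'‖ ≤ 2 := by
      have := norm_add_le (Y'-1) 1; simp at this; linarith
    have hYl' : 1/2 ≤ ‖Y'‖ := by
      have := norm_sub_le Y' (Y'-1); simp at this; norm_num at hY' ⊢; linarith
    have hY0' : Y' ≠ 0 := by intro h; rw [h] at hYl'; norm_num at hYl'
    have hθ0 : θ ≠ 0 := by intro h; rw [hYdef', h] at hY0'; simp at hY0'
    have hσu' : σ (u' : 𝓞 L) ≠ 0 := by intro h; rw [hYdef', h] at hY0'; simp at hY0'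
    have hσb0 : σ b0 ≠ 0 := by simpa using hb0L
    have hσw : σ w = Y^m := by
      rw [hw, map_div₀, map_mul, map_pow, ← hθ, hYdef, mul_pow]; field_simp
    have hσρ : σ (ρ:L) = Y / Y' := by
      have e : (ρ:L) * (u' : 𝓞 L) = (u : 𝓞 L) := by
        rw [hρ]; norm_cast; simp
      have e' : σ (ρ:L) * σ (u' : 𝓞 L) = σ (u : 𝓞 L) := by rw [← map_mul, e]
      rw [hYdef, hYdef', ← e']; field_simp
    have e1 : σ (z:L) = (σ b0)^k * (∑ x ∈ range (k+1) ×ˢ (univ : Finset (Fin (D+1))), (a t x.1 x.2 : ℂ) * Y^(m*x.1+(x.2:ℕ))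
        + ∑ x ∈ range (k+1) ×ˢ (univ : Finset (Fin (D+1))), (a t x.1 x.2 : ℂ) * (Y^(m*x.1+(x.2:ℕ)) * (1/Y'^(x.2:ℕ) - 1))) := by
      rw [hzL, map_mul, map_pow]
      congr 1
      rw [← Finset.sum_add_distrib, Finset.sum_product_right, map_sum]
      refine Finset.sum_congr rfl fun j _ => ?_
      rw [map_mul, map_sum, map_pow, hσρ, Finset.sum_mul]
      refine Finset.sum_congr rfl fun i _ => ?_
      rw [map_mul, map_intCast, map_pow, hσw, ← pow_mul, div_pow, pow_add]
      ring
    have hcardS : ((range (k+1) ×ˢ (univ : Finset (Fin (D+1)))).card : ℝ) = ((k:ℝ)+1) * ((D:ℝ)+1) := by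
      simp
    have hexp : ∀ x ∈ range (k+1) ×ˢ (univ : Finset (Fin (D+1))), m*x.1+(x.2:ℕ) ≤ m*k + D := by
      intro x hx
      have := mem_range.1 (mem_product.1 hx).1
      have h2 := x.2.2
      have : m*x.1 ≤ m*k := by gcongr; omega
      omega
    have b1 := wg_eval_bound (range (k+1) ×ˢ (univ : Finset (Fin (D+1)))) (fun x => a t x.1 x.2)
      (fun x => m*x.1+(x.2:ℕ)) ((D+1)*k) (m*k+D) hexp (by
        have := hdvd t
        rw [Finset.sum_product]; exact this) Y (hY.trans (by norm_num))
    have b1' : ∑ x ∈ range (k+1) ×ˢ (univ : Finset (Fin (D+1))), |(a t x.1 x.2 : ℝ)| * 2^(m*x.1+(x.2:ℕ)) ≤ ((k:ℝ)+1) * ((D:ℝ)+1) * (B^k * 2^(m*k+D)) := by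
      rw [← hcardS, ← nsmul_eq_mul]
      refine Finset.sum_le_card_nsmul _ _ _ fun x hx => ?_
      exact mul_le_mul (haB _ _ _) (pow_le_pow_right₀ (by norm_num) (hexp x hx)) (by positivity) (by positivity)
    have b2 : ‖∑ x ∈ range (k+1) ×ˢ (univ : Finset (Fin (D+1))), (a t x.1 x.2 : ℂ) * (Y^(m*x.1+(x.2:ℕ)) * (1/Y'^(x.2:ℕ) - 1))‖
        ≤ ((k:ℝ)+1) * ((D:ℝ)+1) * (B^k * (2^(m*k+D) * (((D:ℝ)+1) * 4^D * ‖Y'-1‖))) := by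
      rw [← hcardS, ← nsmul_eq_mul]
      refine (norm_sum_le _ _).trans (Finset.sum_le_card_nsmul _ _ _ fun x hx => ?_)
      rw [norm_mul, norm_mul, Complex.norm_intCast, norm_pow]
      refine mul_le_mul (haB _ _ _) (mul_le_mul ?_ ?_ (by positivity) (by positivity)) (by positivity) (by positivity)
      · calc _ ≤ (2:ℝ)^(m*x.1+(x.2:ℕ)) := by gcongr
          _ ≤ _ := pow_le_pow_right₀ (by norm_num) (hexp x hx)
      · have hj : (x.2:ℕ) ≤ D := by omega
        have e2 : 1/Y'^(x.2:ℕ) - 1 = -((Y'^(x.2:ℕ) - 1) * (Y'^(x.2:ℕ))⁻¹) := by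
          field_simp; ring
        rw [e2, norm_neg, norm_mul, norm_inv, norm_pow, ← geom_sum_mul, norm_mul]
        have e3 : (‖Y'‖^(x.2:ℕ))⁻¹ ≤ 2^D := by
          rw [← inv_pow]
          have : ‖Y'‖⁻¹ ≤ 2 := by rw [inv_le_comm₀ (by linarith) (by norm_num)]; linarith
          calc _ ≤ (2:ℝ)^(x.2:ℕ) := by gcongr
            _ ≤ _ := pow_le_pow_right₀ (by norm_num) hj
        have e4 : ‖∑ i ∈ range (x.2:ℕ), Y'^i‖ ≤ ((D:ℝ)+1) * 2^D := by
          refine (norm_sum_le _ _).trans ?_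
          calc _ ≤ ∑ i ∈ range (x.2:ℕ), (2:ℝ)^D := by
                refine Finset.sum_le_sum fun i hi => ?_
                rw [norm_pow]
                calc _ ≤ (2:ℝ)^i := by gcongr
                  _ ≤ _ := pow_le_pow_right₀ (by norm_num) (by have := mem_range.1 hi; omega)
            _ = ((x.2:ℕ):ℝ) * 2^D := by simp
            _ ≤ _ := by
                have : ((x.2:ℕ):ℝ) ≤ D := by exact_mod_cast hj
                gcongr; linarith
        calc _ ≤ ((D:ℝ)+1) * 2^D * ‖Y'-1‖ * 2^D := by gcongr
          _ = _ := by
            have : (4:ℝ)^D = 2^D * 2^D := by rw [← mul_pow]; norm_num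
            rw [this]; ring
    rw [e1, norm_mul, norm_pow]
    have b3 : (2:ℝ)^(m*k+D) * (((D:ℝ)+1) * 4^D) ≤ ((D:ℝ)+1) * 8^D * (8^m)^k := by
      have : (8:ℝ)^D = 2^D * 4^D := by rw [← mul_pow]; norm_num
      rw [pow_add, this, ← pow_mul]
      have : (2:ℝ)^(m*k) ≤ 8^(m*k) := by gcongr; norm_num
      calc _ = ((D:ℝ)+1) * (2^D*4^D) * 2^(m*k) := by ring
        _ ≤ _ := by gcongr
    have h4D : (1:ℝ) ≤ ((D:ℝ)+1) * 4^D := by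
      have : (0:ℝ) ≤ D := by positivity
      exact one_le_mul_of_one_le_of_one_le (by linarith) (one_le_pow₀ (by norm_num))
    calc _ ≤ A^k * (‖Y-1‖^((D+1)*k) * (((k:ℝ)+1) * ((D:ℝ)+1) * (B^k * 2^(m*k+D))) + ((k:ℝ)+1) * ((D:ℝ)+1) * (B^k * (2^(m*k+D) * (((D:ℝ)+1) * 4^D * ‖Y'-1‖)))) := by
          gcongr
          · exact (hA σ).2
          · refine (norm_add_le _ _).trans (add_le_add ?_ b2)
            exact b1.trans (by gcongr)
      _ ≤ A^k * (‖Y-1‖^((D+1)*k) * (((k:ℝ)+1) * ((D:ℝ)+1) * (B^k * (2^(m*k+D) * (((D:ℝ)+1) * 4^D)))) + ((k:ℝ)+1) * ((D:ℝ)+1) * (B^k * (2^(m*k+D) * (((D:ℝ)+1) * 4^D * ‖Y'-1‖)))) := by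
          gcongr
          exact le_mul_of_one_le_right (by positivity) h4D
      _ = A^k * B^k * ((k:ℝ)+1) * ((D:ℝ)+1) * (2^(m*k+D) * (((D:ℝ)+1) * 4^D)) * (‖Y-1‖^((D+1)*k) + ‖Y'-1‖) := by ring
      _ ≤ A^k * B^k * (2:ℝ)^k * ((D:ℝ)+1) * (((D:ℝ)+1) * 8^D * (8^m)^k) * (‖Y-1‖^((D+1)*k) + ‖Y'-1‖) := by
          gcongr
      _ = (2:ℝ)^k * ((D:ℝ)+1)^2 * 8^D * (8^m)^k * A^k * B^k * (‖Y-1‖^((D+1)*k) + ‖Y'-1‖) := by ring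
      _ ≤ _ := by
          rw [hGk]; gcongr
  have hcard : Fintype.card (L →+* ℂ) = n := NumberField.Embeddings.card L ℂ
  have hn1 : 1 ≤ n := Module.finrank_pos
  have hX1 : 1 ≤ H^(m*k) * (H * H')^D := one_le_mul_of_one_le_of_one_le (one_le_pow₀ hH)
    (one_le_pow₀ (one_le_mul_of_one_le_of_one_le hH hH'))
  calc (1:ℝ) ≤ ∏ τ : L →+* ℂ, ‖τ (z:L)‖ := wg_prod_emb z hz0
    _ = ‖σ (z:L)‖ * ∏ τ ∈ univ.erase σ, ‖τ (z:L)‖ := (Finset.mul_prod_erase univ _ (mem_univ σ)).symm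
    _ ≤ (G^k * (‖Y - 1‖^((D+1)*k) + ‖Y' - 1‖)) * ∏ τ ∈ univ.erase σ, (G^k * (H^(m*k) * (H * H')^D)) := by
        refine mul_le_mul hσ (Finset.prod_le_prod (fun _ _ => norm_nonneg _) fun τ _ => hother τ) 
          (Finset.prod_nonneg fun _ _ => norm_nonneg _) (by positivity)
    _ = G^k * (‖Y - 1‖^((D+1)*k) + ‖Y' - 1‖) * ((G^k)^(n-1) * (H^(m*k) * (H * H')^D)^(n-1)) := by
        rw [Finset.prod_const, card_erase_of_mem (mem_univ _), Finset.card_univ, hcard, mul_pow (G^k)]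
    _ ≤ G^k * (‖Y - 1‖^((D+1)*k) + ‖Y' - 1‖) * ((G^k)^(n-1) * (H^(m*k) * (H * H')^D)^n) := by
        gcongr
        omega
    _ = _ := by
        have : G^(k*n) = G^k * (G^k)^(n-1) := by rw [pow_mul, ← pow_succ']; congr 1; omega
        rw [this]; ring
end

section
open NumberField

lemma wg_northcott {L : Type*} [Field L] [NumberField L] (B : ℝ) :
    {u : (𝓞 L)ˣ | ∀ τ : L →+* ℂ, ‖τ (u : 𝓞 L)‖ ≤ B}.Finite := by
  have h := NumberField.Embeddings.finite_of_norm_le L ℂ B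
  refine Set.Finite.of_finite_image (f := fun u : (𝓞 L)ˣ => ((u : 𝓞 L) : L)) (h.subset ?_) ?_
  · rintro _ ⟨u, hu, rfl⟩
    exact ⟨RingOfIntegers.isIntegral_coe _, fun τ => hu τ⟩
  · intro u _ v _ h
    have : (u : 𝓞 L) = v := RingOfIntegers.coe_injective h
    exact Units.ext this

lemma wg_numeric (n D m k δ gG c h h' : ℝ) (hn : 1 ≤ n) (hD : 1 ≤ D) (hm : 2 ≤ m) (hk : 1 ≤ k)
    (hδ : 0 < δ) (h1 : 4*n ≤ δ*(D+1)) (h2 : 16*D*n ≤ δ*m) (hg : 0 ≤ gG) (hc : 0 ≤ c)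
    (hh : n*gG + (D+1)*c + 1 ≤ h) (hh' : h ≤ h') (hk1 : k * (4*n*h) ≤ δ*h')
    (hk2 : δ*h' ≤ k*(8*n*h)) :
    k*n*gG + (D+1)*k*(c - m*δ*h) + n*(m*k*h + D*(h+h')) ≤ -1 ∧
    k*n*gG + (c - m*δ*h') + n*(m*k*h + D*(h+h')) ≤ -1 := by
  have hngG : 0 ≤ n * gG := by positivity
  have hDc : c ≤ (D+1)*c := by nlinarith
  have hh1 : 1 ≤ h := by nlinarith
  have hh1' : 0 ≤ h' := by linarith
  have hkh : 1 ≤ k*h := one_le_mul_of_one_le_of_one_le hk hh1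
  have hA : n*D*(h+h') ≤ 2*D*n*h' := by
    have : n*D*(h+h') ≤ n*D*(h'+h') := by gcongr
    linarith
  have hnm : 2 ≤ n * m := by nlinarith
  have hmd : 16 ≤ m*δ := by nlinarith
  constructor
  · have e1 : k*(n*gG+(D+1)*c) ≤ k*h := by gcongr; linarith
    have e2 : 4*n*(m*k*h) ≤ δ*(D+1)*(m*k*h) := by gcongr
    have e3 : 2*D*n*h' ≤ n*m*(k*h) := by
      have a1 : 16*D*n*(k*n*h) ≤ δ*m*(k*n*h) := by gcongr
      have a2 : (δ*h')*(2*D*n) ≤ (k*(8*n*h))*(2*D*n) := by gcongr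
      have : δ*(2*D*n*h') ≤ δ*(n*m*(k*h)) := by nlinarith
      exact le_of_mul_le_mul_left this hδ
    have e4 : 2*(k*h) ≤ n*m*(k*h) := by gcongr
    nlinarith
  · have e1 : k*(n*gG)+c ≤ k*h + h := by
      have : k*(n*gG) ≤ k*(h-c) := by gcongr; linarith
      nlinarith
    have e2 : m*(k*(4*n*h)) ≤ m*(δ*h') := by gcongr
    have e3 : 16*D*n*h' ≤ δ*m*h' := by gcongr
    have e4 : k*h*4 ≤ δ*h' := by nlinarith
    have e5 : 2*(δ*h') ≤ m*(δ*h') := by gcongr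
    have e6 : 16*h' ≤ m*δ*h' := by gcongr
    nlinarith

set_option maxHeartbeats 1000000 in
lemma wg_thmC {L : Type*} [Field L] [NumberField L] (σ : L →+* ℂ) (D m : ℕ) (hD : 1 ≤ D) (hm : D < m)
    (a0 b0 : 𝓞 L) (ha0 : a0 ≠ 0) (hb0 : b0 ≠ 0) (θ : ℂ) (hθ : θ^m * σ b0 = σ a0)
    (δ c : ℝ) (hδ : 0 < δ) (hc : 0 ≤ c)
    (h1 : 4*(Module.finrank ℚ L : ℝ) ≤ δ*(D+1)) (h2 : 16*D*(Module.finrank ℚ L : ℝ) ≤ δ*m) :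
    {u : (𝓞 L)ˣ | ∃ h : ℝ, 0 ≤ h ∧ (∀ τ : L →+* ℂ, ‖τ (u : 𝓞 L)‖ ≤ Real.exp h ∧ 
      ‖τ ((u⁻¹ : (𝓞 L)ˣ) : 𝓞 L)‖ ≤ Real.exp h) ∧ a0 * (u:𝓞 L)^m ≠ b0 ∧
      ‖θ * σ (u : 𝓞 L) - 1‖ ≤ Real.exp (c - m*δ*h)}.Finite := by
  obtain ⟨G, hG1, hcore⟩ := wg_core σ D m hm a0 b0 ha0 hb0 θ hθ
  by_contra hinf
  have hinf' : ∀ T : ℝ, ∃ u : (𝓞 L)ˣ, ∃ h : ℝ, T ≤ h ∧ (∀ τ : L →+* ℂ, ‖τ (u : 𝓞 L)‖ ≤ Real.exp h ∧ 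
      ‖τ ((u⁻¹ : (𝓞 L)ˣ) : 𝓞 L)‖ ≤ Real.exp h) ∧ a0 * (u:𝓞 L)^m ≠ b0 ∧
      ‖θ * σ (u : 𝓞 L) - 1‖ ≤ Real.exp (c - m*δ*h) := by
    intro T
    by_contra hcon
    push Not at hcon
    refine hinf ((wg_northcott (Real.exp T)).subset ?_)
    rintro u ⟨h, h0, hu, hne, hb⟩ τ
    have : h < T := by
      by_contra hT
      push Not at hT
      exact absurd hb (not_le.2 (hcon u h hT hu hne))
    exact (hu τ).1.trans (Real.exp_le_exp.2 this.le)
  set n := Module.finrank ℚ L with hn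
  have hn1 : (1:ℝ) ≤ n := by exact_mod_cast (Module.finrank_pos : 0 < Module.finrank ℚ L)
  have hD1 : (1:ℝ) ≤ D := by exact_mod_cast hD
  have hm2 : (2:ℝ) ≤ m := by exact_mod_cast (by omega : 2 ≤ m)
  set gG := Real.log G with hgG
  have hgG0 : 0 ≤ gG := Real.log_nonneg hG1
  have hGexp : G = Real.exp gG := (Real.exp_log (by linarith)).symm
  obtain ⟨u, h, hh, hu, hne, hb⟩ := hinf' (n*gG + (D+1)*c + 1)
  have hh1 : 1 ≤ h := by
    have : 0 ≤ n*gG := by positivity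
    nlinarith
  obtain ⟨u', h', hh', hu', hne', hb'⟩ := hinf' (max h (4*n*h/δ))
  have hhh : h ≤ h' := (le_max_left _ _).trans hh'
  have hq : 1 ≤ δ*h'/(4*n*h) := by
    have := (le_max_right _ _).trans hh'
    rw [div_le_iff₀ hδ] at this
    rw [le_div_iff₀ (by positivity)]; linarith
  set k := ⌊δ*h'/(4*n*h)⌋₊ with hk
  have hk1 : 1 ≤ k := Nat.le_floor (by exact_mod_cast hq)
  have hk1r : (1:ℝ) ≤ k := by exact_mod_cast hk1
  have hkle : (k:ℝ) * (4*n*h) ≤ δ*h' := by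
    have := Nat.floor_le (a := δ*h'/(4*n*h)) (by linarith)
    rw [le_div_iff₀ (by positivity)] at this
    exact this
  have hkge : δ*h' ≤ k*(8*n*h) := by
    have := Nat.lt_floor_add_one (δ*h'/(4*n*h))
    rw [div_lt_iff₀ (by positivity), ← hk] at this
    have : ((k:ℝ)+1)*(4*n*h) ≤ (2*k)*(4*n*h) := by gcongr; linarith
    nlinarith
  obtain ⟨E2, E1⟩ := wg_numeric n D m k δ gG c h h' hn1 hD1 hm2 hk1r hδ h1 h2 hgG0 hc hh hhh hkle hkge
  have hmd : 16 ≤ m*δ := by nlinarith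
  have hhalf : Real.exp (-1) < 1/2 := by
    rw [Real.exp_neg, inv_lt_comm₀ (Real.exp_pos _) (by norm_num)]
    have := Real.exp_one_gt_d9; linarith
  have hch : ∀ x : ℝ, h ≤ x → Real.exp (c - m*δ*x) ≤ 1/2 := by
    intro x hx
    refine le_trans (Real.exp_le_exp.2 ?_) hhalf.le
    have : 0 ≤ n*gG := by positivity
    nlinarith
  have key := hcore k hk1 u u' (Real.exp h) (Real.exp h') (Real.one_le_exp (by linarith)) (Real.one_le_exp (by linarith))
    (fun τ => (hu τ).1) (fun τ => (hu' τ).2) hne (hb.trans (hch h le_rfl)) (hb'.trans (hch h' hhh))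
  have hA : ‖θ * σ (u : 𝓞 L) - 1‖^((D+1)*k) ≤ Real.exp ((D+1)*k*(c-m*δ*h)) := by
    calc _ ≤ (Real.exp (c - m*δ*h))^((D+1)*k) := by gcongr
      _ = _ := by rw [← Real.exp_nat_mul]; push_cast; rfl
  have : (1:ℝ) ≤ Real.exp (k*n*gG + (D+1)*k*(c - m*δ*h) + n*(m*k*h + D*(h+h'))) + Real.exp (k*n*gG + (c - m*δ*h') + n*(m*k*h + D*(h+h'))) := by
    calc (1:ℝ) ≤ _ := key
      _ ≤ G^(k*n) * (Real.exp ((D+1)*k*(c-m*δ*h)) + Real.exp (c - m*δ*h')) * ((Real.exp h)^(m*k) * (Real.exp h * Real.exp h')^D)^n := by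
        gcongr
      _ = _ := by
        rw [hGexp, ← Real.exp_nat_mul, ← Real.exp_nat_mul, ← Real.exp_add, ← Real.exp_nat_mul, ← Real.exp_add, ← Real.exp_nat_mul, mul_add, add_mul, ← Real.exp_add, ← Real.exp_add, ← Real.exp_add, ← Real.exp_add]
        push_cast
        rfl
  have e1 := Real.exp_le_exp.2 E1
  have e2 := Real.exp_le_exp.2 E2
  linarith
end

section
open NumberField

lemma wg_units_mod (L : Type*) [Field L] [NumberField L] (m : ℕ) (hm : m ≠ 0) :
    ∃ R : Set (𝓞 L)ˣ, R.Finite ∧ ∀ x : (𝓞 L)ˣ, ∃ r ∈ R, ∃ u : (𝓞 L)ˣ, x = r * u^m := by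
  have : NeZero m := ⟨hm⟩
  have : Group.FG (𝓞 L)ˣ := Group.fg_iff_monoid_fg.2 inferInstance
  have : (powMonoidHom (α := (𝓞 L)ˣ) m).range.FiniteIndex := Subgroup.finiteIndex_range_powMonoidHom_of_fg _ hm
  have : Finite ((𝓞 L)ˣ ⧸ (powMonoidHom (α := (𝓞 L)ˣ) m).range) := inferInstance
  refine ⟨Set.range (Quotient.out : (𝓞 L)ˣ ⧸ (powMonoidHom (α := (𝓞 L)ˣ) m).range → (𝓞 L)ˣ), Set.finite_range _, fun x => ?_⟩
  obtain ⟨h, hh⟩ := QuotientGroup.mk_out_eq_mul (powMonoidHom (α := (𝓞 L)ˣ) m).range x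
  obtain ⟨v, hv⟩ := h.2
  refine ⟨_, ⟨(x : (𝓞 L)ˣ ⧸ (powMonoidHom (α := (𝓞 L)ˣ) m).range), rfl⟩, v⁻¹, ?_⟩
  rw [hh, ← hv]
  simp

lemma wg_root_near (m : ℕ) (hm : 1 ≤ m) (w : ℂ) (hw : ‖w - 1‖ ≤ 1/2) :
    ∃ y : ℂ, y^m = w ∧ ‖y - 1‖ ≤ 3 * ‖w - 1‖ := by
  have hm' : (1:ℝ) ≤ m := by exact_mod_cast hm
  have h1 := Complex.norm_log_one_add_half_le_self hw
  rw [add_sub_cancel] at h1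
  have hw0 : w ≠ 0 := by rintro rfl; norm_num at hw
  have h2 : ‖Complex.log w / m‖ ≤ ‖Complex.log w‖ := by
    rw [norm_div, Complex.norm_natCast]
    exact div_le_self (norm_nonneg _) hm'
  refine ⟨Complex.exp (Complex.log w / m), ?_, ?_⟩
  · rw [← Complex.exp_nat_mul, mul_div_cancel₀ _ (by exact_mod_cast (by omega : m ≠ 0)), Complex.exp_log hw0]
  · refine (Complex.norm_exp_sub_one_le (by linarith)).trans (by linarith)

lemma wg_thmA {L : Type*} [Field L] [NumberField L] (σ : L →+* ℂ)
    (a b : 𝓞 L) (ha : a ≠ 0) (hb : b ≠ 0) (δ c : ℝ) (hδ : 0 < δ) (hc : 0 ≤ c) :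
    {x : (𝓞 L)ˣ | ∃ h : ℝ, 0 ≤ h ∧ (∀ τ : L →+* ℂ, ‖τ (x : 𝓞 L)‖ ≤ Real.exp h ∧ 
      ‖τ ((x⁻¹ : (𝓞 L)ˣ) : 𝓞 L)‖ ≤ Real.exp h) ∧ a * (x:𝓞 L) ≠ b ∧
      ‖σ a * σ (x : 𝓞 L) / σ b - 1‖ ≤ Real.exp (c - δ*h)}.Finite := by
  classical
  obtain ⟨D, hD⟩ := exists_nat_gt (4*(Module.finrank ℚ L : ℝ)/δ)
  obtain ⟨m, hm⟩ := exists_nat_gt (16*((D+1 : ℕ):ℝ)*(Module.finrank ℚ L : ℝ)/δ + D + 1)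
  have hpos : 0 ≤ 16*((D+1 : ℕ):ℝ)*(Module.finrank ℚ L : ℝ)/δ := by positivity
  have hDm : D + 1 < m := by
    have : ((D + 1 : ℕ):ℝ) < m := by push_cast at *; linarith
    exact_mod_cast this
  have hm0 : m ≠ 0 := by omega
  have hmr : (0:ℝ) < m := by positivity
  have c1 : 4*(Module.finrank ℚ L : ℝ) ≤ δ*((D+1 : ℕ)+1) := by
    rw [div_lt_iff₀ hδ] at hD
    push_cast
    nlinarith
  have c2 : 16*((D+1:ℕ):ℝ)*(Module.finrank ℚ L : ℝ) ≤ δ*m := by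
    have : 16*((D+1 : ℕ):ℝ)*(Module.finrank ℚ L : ℝ)/δ < m := by
      have : (0:ℝ) ≤ D := by positivity
      linarith
    rw [div_lt_iff₀ hδ] at this; linarith
  obtain ⟨R, hR, hRx⟩ := wg_units_mod L m hm0
  obtain ⟨r0, hr0, hr⟩ : ∃ r0 : ℝ, 0 ≤ r0 ∧ ∀ r ∈ R, ∀ τ : L →+* ℂ, ‖τ (r : 𝓞 L)‖ ≤ Real.exp r0 ∧ 
      ‖τ ((r⁻¹ : (𝓞 L)ˣ) : 𝓞 L)‖ ≤ Real.exp r0 := by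
    refine ⟨∑ r ∈ hR.toFinset, ∑ τ : L →+* ℂ, (‖τ (r : 𝓞 L)‖ + ‖τ ((r⁻¹ : (𝓞 L)ˣ) : 𝓞 L)‖), by positivity, fun r hr τ => ?_⟩
    have h1 := Finset.single_le_sum (f := fun r : (𝓞 L)ˣ => ∑ τ : L →+* ℂ, (‖τ (r : 𝓞 L)‖ + ‖τ ((r⁻¹ : (𝓞 L)ˣ) : 𝓞 L)‖)) 
      (fun _ _ => by positivity) (hR.mem_toFinset.2 hr)
    have h2 := Finset.single_le_sum (f := fun τ : L →+* ℂ => (‖τ (r : 𝓞 L)‖ + ‖τ ((r⁻¹ : (𝓞 L)ˣ) : 𝓞 L)‖)) 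
      (fun _ _ => by positivity) (Finset.mem_univ τ)
    have h3 := Real.add_one_le_exp (∑ r ∈ hR.toFinset, ∑ τ : L →+* ℂ, (‖τ (r : 𝓞 L)‖ + ‖τ ((r⁻¹ : (𝓞 L)ˣ) : 𝓞 L)‖))
    have h4 := norm_nonneg (τ (r : 𝓞 L))
    have h5 := norm_nonneg (τ ((r⁻¹ : (𝓞 L)ˣ) : 𝓞 L))
    constructor <;> linarith
  have hσb : σ b ≠ 0 := by
    rw [Ne, map_eq_zero]; exact_mod_cast hb
  have hfin := fun (r : (𝓞 L)ˣ) (θ : ℂ) (hθ : θ^m * σ b = σ ((a * r : 𝓞 L))) =>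
    wg_thmC σ (D+1) m (by omega) hDm (a * r) b (mul_ne_zero ha r.ne_zero) hb θ hθ δ (c + δ*r0 + 2) hδ (by positivity) c1 c2
  have hroots : ∀ r : (𝓞 L)ˣ, {θ : ℂ | θ^m * σ b = σ ((a * r : 𝓞 L))}.Finite := by
    intro r
    refine (Multiset.finite_toSet (Polynomial.nthRoots m (σ ((a * r : 𝓞 L)) / σ b))).subset ?_
    intro θ hθ
    rw [Set.mem_ofPred_eq, Polynomial.mem_nthRoots (by omega), eq_div_iff hσb]
    exact hθ
  refine Set.Finite.subset ((wg_northcott (Real.exp ((c+1)/δ))).union 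
    (hR.biUnion (t := fun r => ⋃ θ ∈ {θ : ℂ | θ^m * σ b = σ ((a * r : 𝓞 L))}, (fun u => r * u^m) '' 
      {u : (𝓞 L)ˣ | ∃ h : ℝ, 0 ≤ h ∧ (∀ τ : L →+* ℂ, ‖τ (u : 𝓞 L)‖ ≤ Real.exp h ∧ 
      ‖τ ((u⁻¹ : (𝓞 L)ˣ) : 𝓞 L)‖ ≤ Real.exp h) ∧ (a * r) * (u:𝓞 L)^m ≠ b ∧
      ‖θ * σ (u : 𝓞 L) - 1‖ ≤ Real.exp ((c + δ*r0 + 2) - m*δ*h)}) fun r _ => 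
        (hroots r).biUnion fun θ hθ => (hfin r θ hθ).image _)) ?_
  rintro x ⟨h, h0, hx, hne, hb⟩
  by_cases hlarge : h ≤ (c+1)/δ
  · left
    exact fun τ => (hx τ).1.trans (Real.exp_le_exp.2 hlarge)
  right
  push Not at hlarge
  rw [div_lt_iff₀ hδ] at hlarge
  obtain ⟨r, hrR, u, rfl⟩ := hRx x
  have hhalf : Real.exp (-1) < 1/2 := by
    rw [Real.exp_neg, inv_lt_comm₀ (Real.exp_pos _) (by norm_num)]
    have := Real.exp_one_gt_d9; linarith
  have hb2 : ‖σ a * σ ((r * u^m : (𝓞 L)ˣ) : 𝓞 L) / σ b - 1‖ ≤ 1/2 :=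
    hb.trans ((Real.exp_le_exp.2 (by linarith)).trans hhalf.le)
  obtain ⟨y, hy, hy1⟩ := wg_root_near m (by omega) _ hb2
  have hσu : σ (u : 𝓞 L) ≠ 0 := by
    rw [Ne, map_eq_zero]; exact_mod_cast u.ne_zero
  have hθ : (y / σ (u : 𝓞 L))^m * σ b = σ ((a * r : 𝓞 L)) := by
    rw [div_pow, hy]
    push_cast
    simp only [map_mul, map_pow]
    field_simp
  have hroot : ∀ v : (𝓞 L)ˣ, (∀ τ : L →+* ℂ, ‖τ ((v^m : (𝓞 L)ˣ) : 𝓞 L)‖ ≤ Real.exp (h+r0)) → 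
      ∀ τ : L →+* ℂ, ‖τ (v : 𝓞 L)‖ ≤ Real.exp ((h+r0)/m) := by
    intro v hv τ
    have := hv τ
    push_cast at this
    rw [map_pow, norm_pow] at this
    refine le_of_pow_le_pow_left₀ hm0 (Real.exp_pos _).le ?_
    rw [← Real.exp_nat_mul, mul_div_cancel₀ _ hmr.ne']
    exact this
  refine Set.mem_biUnion hrR (Set.mem_biUnion (x := y / σ (u : 𝓞 L)) hθ ⟨u, ⟨(h+r0)/m, by positivity, fun τ => ⟨?_, ?_⟩, ?_, ?_⟩, rfl⟩)
  · refine hroot u (fun τ => ?_) τ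
    have e : u^m = (r*u^m) * r⁻¹ := by rw [mul_comm, inv_mul_cancel_left]
    rw [e, Units.val_mul, RingOfIntegers.coe_eq_algebraMap, map_mul, map_mul, norm_mul, Real.exp_add]
    exact mul_le_mul (hx τ).1 (hr r hrR τ).2 (norm_nonneg _) (Real.exp_pos _).le
  · refine hroot u⁻¹ (fun τ => ?_) τ
    have e : u⁻¹^m = (r*u^m)⁻¹ * r := by rw [mul_inv, inv_pow]; rw [mul_comm, mul_inv_cancel_left]
    rw [e, Units.val_mul, RingOfIntegers.coe_eq_algebraMap, map_mul, map_mul, norm_mul, Real.exp_add]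
    exact mul_le_mul (hx τ).2 (hr r hrR τ).1 (norm_nonneg _) (Real.exp_pos _).le
  · intro h; apply hne; rw [← h]; push_cast; ring
  · rw [div_mul_cancel₀ _ hσu]
    refine hy1.trans ?_
    have e3 : (3:ℝ) ≤ Real.exp 2 := by have := Real.add_one_le_exp (2:ℝ); linarith
    calc _ ≤ Real.exp 2 * Real.exp (c - δ*h) := by gcongr
      _ = _ := by
        rw [← Real.exp_add]; congr 1; field_simp; ring
end

section
open NumberField

lemma wg_inv_bound {L : Type*} [Field L] [NumberField L] (z : 𝓞 L) (hz : z ≠ 0) (B : ℝ) (hB : 1 ≤ B)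
    (h : ∀ τ : L →+* ℂ, ‖τ z‖ ≤ B) (τ : L →+* ℂ) : ‖τ z‖⁻¹ ≤ B^(Module.finrank ℚ L) := by
  classical
  have h1 := wg_prod_emb z hz
  rw [← Finset.mul_prod_erase Finset.univ _ (Finset.mem_univ τ)] at h1
  have hpos : 0 < ‖τ z‖ := by
    rw [norm_pos_iff, Ne, map_eq_zero]; exact_mod_cast hz
  have h2 : ∏ τ ∈ Finset.univ.erase τ, ‖τ (z:L)‖ ≤ B^(Module.finrank ℚ L) := by
    calc _ ≤ ∏ τ ∈ Finset.univ.erase τ, B := Finset.prod_le_prod (fun _ _ => norm_nonneg _) (fun τ _ => h τ)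
      _ = B^(Module.finrank ℚ L - 1) := by
        rw [Finset.prod_const, Finset.card_erase_of_mem (Finset.mem_univ _), Finset.card_univ, NumberField.Embeddings.card]
      _ ≤ _ := pow_le_pow_right₀ hB (by omega)
  rw [inv_le_iff_one_le_mul₀ hpos]
  calc (1:ℝ) ≤ _ := h1
    _ ≤ ‖τ z‖ * B^(Module.finrank ℚ L) := by gcongr
    _ = _ := mul_comm _ _

lemma wg_unit_inv {L : Type*} [Field L] [NumberField L] (u : (𝓞 L)ˣ) (τ : L →+* ℂ) :
    τ ((u⁻¹ : (𝓞 L)ˣ) : 𝓞 L) = (τ (u : 𝓞 L))⁻¹ := by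
  refine eq_inv_of_mul_eq_one_left ?_
  rw [← map_mul]
  have : ((((u⁻¹ : (𝓞 L)ˣ) : 𝓞 L)) : L) * (u : 𝓞 L) = 1 := by
    have := u.inv_mul
    exact_mod_cast this
  rw [this, map_one]

lemma wg_unit_eq {L : Type*} [Field L] [NumberField L] (a b c : 𝓞 L) (ha : a ≠ 0) (hb : b ≠ 0) (hc : c ≠ 0) :
    {p : (𝓞 L)ˣ × (𝓞 L)ˣ | a * (p.1 : 𝓞 L) + b * (p.2 : 𝓞 L) = c}.Finite := by
  classical
  set n := Module.finrank ℚ L with hn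
  have hne : ∀ (z : 𝓞 L), z ≠ 0 → ∀ τ : L →+* ℂ, τ z ≠ 0 := by
    intro z hz τ
    rw [Ne, map_eq_zero]; exact_mod_cast hz
  obtain ⟨C, hC1, hC⟩ : ∃ C : ℝ, 1 ≤ C ∧ ∀ τ : L →+* ℂ, (‖τ c‖ + ‖τ a‖)/‖τ b‖ ≤ C ∧ ‖τ c‖/‖τ a‖ ≤ C := by
    refine ⟨1 + ∑ τ : L →+* ℂ, ((‖τ c‖ + ‖τ a‖)/‖τ b‖ + ‖τ c‖/‖τ a‖), ?_, fun τ => ?_⟩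
    · have : 0 ≤ ∑ τ : L →+* ℂ, ((‖τ c‖ + ‖τ a‖)/‖τ b‖ + ‖τ c‖/‖τ a‖) := by positivity
      linarith
    · have := Finset.single_le_sum (f := fun τ : L →+* ℂ => ((‖τ c‖ + ‖τ a‖)/‖τ b‖ + ‖τ c‖/‖τ a‖)) (fun _ _ => by positivity) (Finset.mem_univ τ)
      have h1 : 0 ≤ (‖τ c‖ + ‖τ a‖)/‖τ b‖ := by positivity
      have h2 : 0 ≤ ‖τ c‖/‖τ a‖ := by positivity
      constructor <;> linarith
  have hcC : 0 ≤ Real.log (C*C) := Real.log_nonneg (one_le_mul_of_one_le_of_one_le hC1 hC1)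
  have hn0 : (0:ℝ) < n + 1 := by positivity
  have hfin := fun σ : L →+* ℂ => wg_thmA σ (-b) a (neg_ne_zero.2 hb) ha (1/((n:ℝ)+1)) (Real.log (C*C)) (by positivity) hcC
  refine Set.Finite.of_finite_image (f := fun p => p.2 * p.1⁻¹) ((Set.finite_iUnion hfin).subset ?_) ?_
  · rintro _ ⟨⟨x, y⟩, hp, rfl⟩
    change a * (x : 𝓞 L) + b * (y : 𝓞 L) = c at hp
    obtain ⟨σ, hσ⟩ := Finite.exists_max (fun τ : L →+* ℂ => ‖τ (x : 𝓞 L)‖)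
    set M := ‖σ (x : 𝓞 L)‖ with hM
    have hM1 : 1 ≤ M := by
      by_contra hcon
      push Not at hcon
      have h1 := wg_prod_emb (x : 𝓞 L) x.ne_zero
      have h2 : ∏ τ : L →+* ℂ, ‖τ (x:𝓞 L)‖ ≤ ∏ τ : L →+* ℂ, M := 
        Finset.prod_le_prod (fun _ _ => norm_nonneg _) (fun τ _ => hσ τ)
      rw [Finset.prod_const, Finset.card_univ, NumberField.Embeddings.card] at h2
      have h3 : M^(Module.finrank ℚ L) < 1 := pow_lt_one₀ (norm_nonneg _) hcon (Module.finrank_pos).ne'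
      linarith
    have hpL : (a:L) * (x : 𝓞 L) + b * (y : 𝓞 L) = c := by rw [← hp]; push_cast; ring
    have hpτ : ∀ τ : L →+* ℂ, τ a * τ (x : 𝓞 L) + τ b * τ (y : 𝓞 L) = τ c := by
      intro τ; rw [← hpL]; simp
    have hCM : 1 ≤ C*M := one_le_mul_of_one_le_of_one_le hC1 hM1
    have hy : ∀ τ : L →+* ℂ, ‖τ (y : 𝓞 L)‖ ≤ C*M := by
      intro τ
      have e : τ (y : 𝓞 L) = (τ c - τ a * τ (x : 𝓞 L)) / τ b := by
        rw [eq_div_iff (hne b hb τ), ← hpτ τ]; ring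
      have hbp : 0 < ‖τ b‖ := norm_pos_iff.2 (hne b hb τ)
      rw [e, norm_div]
      calc _ ≤ (‖τ c‖ + ‖τ a‖)*M/‖τ b‖ := by
            gcongr
            refine (norm_sub_le _ _).trans ?_
            rw [norm_mul]
            have := hσ τ
            have h3 : ‖τ a‖ * ‖τ (x:𝓞 L)‖ ≤ ‖τ a‖*M := by gcongr
            have h4 : ‖τ c‖ * 1 ≤ ‖τ c‖*M := by gcongr
            linarith
        _ = (‖τ c‖ + ‖τ a‖)/‖τ b‖ * M := by ring
        _ ≤ _ := by gcongr; exact (hC τ).1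
    have hMC : M ≤ C*M := le_mul_of_one_le_left (by linarith) hC1
    have hx : ∀ τ : L →+* ℂ, ‖τ (x : 𝓞 L)‖ ≤ C*M := fun τ => (hσ τ).trans hMC
    have hexp : Real.exp (((n:ℝ)+1) * Real.log (C*M)) = (C*M)^(n+1) := by
      rw [mul_comm, Real.exp_mul, Real.exp_log (by linarith)]
      exact_mod_cast Real.rpow_natCast (C*M) (n+1)
    refine Set.mem_iUnion.2 ⟨σ, ((n:ℝ)+1) * Real.log (C*M), mul_nonneg hn0.le (Real.log_nonneg hCM), fun τ => ⟨?_, ?_⟩, ?_, ?_⟩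
    · rw [hexp, Units.val_mul, RingOfIntegers.coe_eq_algebraMap, map_mul, map_mul, norm_mul, pow_succ']
      have := wg_unit_inv x τ
      refine mul_le_mul (hy τ) ?_ (norm_nonneg _) (by positivity)
      erw [this]
      rw [norm_inv]
      exact wg_inv_bound _ x.ne_zero _ hCM hx τ
    · rw [hexp, mul_inv, inv_inv, mul_comm, Units.val_mul, RingOfIntegers.coe_eq_algebraMap, map_mul, map_mul, norm_mul, pow_succ']
      have := wg_unit_inv y τ
      refine mul_le_mul (hx τ) ?_ (norm_nonneg _) (by positivity)
      erw [this]
      rw [norm_inv]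
      exact wg_inv_bound _ y.ne_zero _ hCM hy τ
    · intro h
      apply hc
      rw [← hp, ← h]
      rw [Units.val_mul]
      have := x.inv_mul
      linear_combination (-b*y) * this
    · have e : σ ((-b : 𝓞 L)) * σ ((y * x⁻¹ : (𝓞 L)ˣ) : 𝓞 L) / σ a - 1 = -(σ c/σ a/σ (x : 𝓞 L)) := by
        have e1 : σ ((y * x⁻¹ : (𝓞 L)ˣ) : 𝓞 L) = σ (y : 𝓞 L) * (σ (x : 𝓞 L))⁻¹ := by
          rw [← wg_unit_inv x σ, ← map_mul]; push_cast; rfl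
        have e2 : σ ((-b : 𝓞 L)) = - σ b := by push_cast; rw [map_neg]
        rw [e1, e2, ← hpτ σ]
        have := hne a ha σ
        have := hne x x.ne_zero σ
        field_simp
        ring
      change ‖σ ((-b : 𝓞 L)) * σ ((y * x⁻¹ : (𝓞 L)ˣ) : 𝓞 L) / σ a - 1‖ ≤ _
      rw [e, norm_neg, norm_div, norm_div, ← hM]
      have e3 : Real.log (C*C) - 1/((n:ℝ)+1) * (((n:ℝ)+1) * Real.log (C*M)) = Real.log ((C*C)/(C*M)) := by
        rw [Real.log_div (by positivity) (by positivity)]; field_simp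
      rw [e3, Real.exp_log (by positivity)]
      calc _ ≤ C / M := by gcongr; exact (hC σ).2
        _ = _ := by field_simp
  · rintro ⟨x, y⟩ hp ⟨x', y'⟩ hp' h
    change a * (x : 𝓞 L) + b * (y : 𝓞 L) = c at hp
    change a * (x' : 𝓞 L) + b * (y' : 𝓞 L) = c at hp'
    change y * x⁻¹ = y' * x'⁻¹ at h
    set z := y * x⁻¹ with hz
    have hy : y = z * x := by rw [hz]; simp
    have hy' : y' = z * x' := by rw [h]; simp
    rw [hy, Units.val_mul] at hp
    rw [hy', Units.val_mul] at hp'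
    have e1 : (a + b * z) * x = c := by rw [← hp]; ring
    have e2 : (a + b * z) * x' = c := by rw [← hp']; ring
    have e3 : a + b * z ≠ 0 := by intro h0; rw [h0, zero_mul] at e1; exact hc e1.symm
    have hxx : x = x' := Units.ext (mul_left_cancel₀ e3 (e1.trans e2.symm))
    rw [hy, hy', hxx]
end

section
open NumberField

lemma wg_exists_L (F : Type*) [Field F] [NumberField F] :
    ∃ (L : Type) (_ : Field L) (_ : NumberField L) (τ0 : L →+* ℂ),
      ∀ χ : F →+* ℂ, ∃ φ : F →+* L, τ0.comp φ = χ := by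
  let N := IntermediateField.normalClosure ℚ F ℂ
  have : FiniteDimensional ℚ N := inferInstance
  have hN : NumberField N := ⟨⟩
  refine ⟨N, inferInstance, hN, algebraMap N ℂ, fun χ => ?_⟩
  let f : F →ₐ[ℚ] ℂ := χ.toRatAlgHom
  have hf := f.fieldRange_le_normalClosure
  refine ⟨(f.codRestrict N.toSubalgebra (fun x => hf ⟨x, rfl⟩)).toRingHom, ?_⟩
  ext x
  rfl

open Polynomial RingOfIntegers

lemma wg_map_aeval {F L : Type*} [Field F] [Field L] (φ : F →+* L) (β : 𝓞 F) (p : ℤ[X]) :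
    mapRingHom φ (aeval β p) = aeval (mapRingHom φ β) p :=
  ((aeval_algHom_apply ((RingOfIntegers.mapRingHom φ).toIntAlgHom) β p).symm)

lemma wg_dvd {F L : Type*} [Field F] [Field L] (β β' : 𝓞 F)
    (hβ : ∀ x : 𝓞 F, ∃ p : ℤ[X], aeval β p = x) (φ ψ : F →+* L) :
    mapRingHom φ β - mapRingHom ψ β ∣ mapRingHom φ β' - mapRingHom ψ β' := by
  obtain ⟨p, rfl⟩ := hβ β'
  rw [wg_map_aeval, wg_map_aeval]
  rw [aeval_def, aeval_def, eval₂_eq_eval_map, eval₂_eq_eval_map]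
  exact sub_dvd_eval_sub _ _ _

lemma wg_assoc {F L : Type*} [Field F] [Field L] (β β' : 𝓞 F)
    (hβ : ∀ x : 𝓞 F, ∃ p : ℤ[X], aeval β p = x) (hβ' : ∀ x : 𝓞 F, ∃ p : ℤ[X], aeval β' p = x)
    (φ ψ : F →+* L) : ∃ u : (𝓞 L)ˣ, (mapRingHom φ β - mapRingHom ψ β) * u =
      mapRingHom φ β' - mapRingHom ψ β' :=
  associated_of_dvd_dvd (wg_dvd β β' hβ φ ψ) (wg_dvd β' β hβ' φ ψ)

lemma wg_sep {F L : Type*} [Field F] [NumberField F] [Field L] (β : 𝓞 F)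
    (hβ : ∀ x : 𝓞 F, ∃ p : ℤ[X], aeval β p = x) (φ ψ : F →+* L) (h : φ β = ψ β) : φ = ψ := by
  have h1 : ∀ x : 𝓞 F, φ x = ψ x := by
    intro x
    obtain ⟨p, rfl⟩ := hβ x
    have := congrArg (fun z : 𝓞 L => (z : L)) (wg_map_aeval φ β p)
    have h2 := congrArg (fun z : 𝓞 L => (z : L)) (wg_map_aeval ψ β p)
    have h3 : mapRingHom φ β = mapRingHom ψ β := RingOfIntegers.ext h
    rw [← h3, ← wg_map_aeval] at h2
    exact h2.symm
  ext x
  obtain ⟨a, b, hb, rfl⟩ := IsFractionRing.div_surjective (A := 𝓞 F) x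
  rw [map_div₀, map_div₀]
  exact congrArg₂ _ (h1 a) (h1 b)

lemma wg_const {F : Type*} [Field F] [NumberField F] (x : 𝓞 F)
    (h : ∀ χ χ' : F →+* ℂ, χ x = χ' x) : ∃ a : ℤ, x = a := by
  have h0 := trace_eq_sum_embeddings ℂ (K := ℚ) (L := F) (x := (x:F))
  obtain ⟨χ0⟩ : Nonempty (F →+* ℂ) := inferInstance
  have hsum : ∑ σ : F →ₐ[ℚ] ℂ, σ (x:F) = (Module.finrank ℚ F : ℂ) * χ0 x := by
    have hs : ∀ σ ∈ (Finset.univ : Finset (F →ₐ[ℚ] ℂ)), σ (x:F) = χ0 x := fun σ _ => h (σ : F →+* ℂ) χ0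
    rw [Finset.sum_congr rfl hs, Finset.sum_const, Finset.card_univ, AlgHom.card]
    simp
  rw [hsum, eq_ratCast] at h0
  have hn : (Module.finrank ℚ F : ℚ) ≠ 0 := by exact_mod_cast (Module.finrank_pos).ne'
  set t : ℚ := Algebra.trace ℚ F x / Module.finrank ℚ F with ht
  have hx : (x:F) = (t : F) := by
    apply χ0.injective
    rw [map_ratCast, ht]
    push_cast
    rw [h0]
    have : (Module.finrank ℚ F : ℂ) ≠ 0 := by exact_mod_cast hn
    field_simp
  have hintegral : IsIntegral ℤ t := by
    have : IsIntegral ℤ (x:F) := RingOfIntegers.isIntegral_coe x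
    rw [hx] at this
    have h2 : IsIntegral ℤ (algebraMap ℚ F t) := by rwa [eq_ratCast]
    exact (isIntegral_algebraMap_iff (algebraMap ℚ F).injective).1 h2
  obtain ⟨a, ha⟩ := IsIntegrallyClosed.isIntegral_iff.1 hintegral
  refine ⟨a, RingOfIntegers.ext ?_⟩
  rw [hx, ← ha]
  simp
end

section
open NumberField
open Polynomial RingOfIntegers

/-- the complex embeddings of `F` are exactly `τ ∘ φ`. -/
lemma wg_bij {F L : Type*} [Field F] [NumberField F] [Field L] [NumberField L] (τ0 : L →+* ℂ)
    (hτ0 : ∀ χ : F →+* ℂ, ∃ φ : F →+* L, τ0.comp φ = χ) (τ : L →+* ℂ) :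
    Function.Bijective (fun φ : F →+* L => τ.comp φ) := by
  have hinj : ∀ τ : L →+* ℂ, Function.Injective (fun φ : F →+* L => τ.comp φ) := by
    intro τ φ ψ h
    ext x
    exact τ.injective (RingHom.congr_fun h x)
  have : Finite (F →+* L) := Finite.of_injective _ (hinj τ0)
  refine ⟨hinj τ, ?_⟩
  have e : (F →+* L) ≃ (F →+* ℂ) := Equiv.ofBijective (fun φ : F →+* L => τ0.comp φ) ⟨hinj τ0, hτ0⟩
  exact ((hinj τ).bijective_of_nat_card_le (Nat.card_congr e).ge).2

lemma wg_gyory {F : Type*} [Field F] [NumberField F] :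
    ∃ T : Set (𝓞 F), T.Finite ∧ (∀ η ∈ T, ∀ x : 𝓞 F, ∃ p : ℤ[X], aeval η p = x) ∧
      ∀ β : 𝓞 F, (∀ x : 𝓞 F, ∃ p : ℤ[X], aeval β p = x) → ∃ η ∈ T, ∃ a : ℤ, β = η + a := by
  classical
  set Gens : Set (𝓞 F) := {β | ∀ x : 𝓞 F, ∃ p : ℤ[X], aeval β p = x} with hGens
  obtain ⟨L, _, _, τ0, hτ0⟩ := wg_exists_L F
  have : Finite (F →+* L) := Finite.of_injective _ (wg_bij τ0 hτ0 τ0).1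
  have : Fintype (F →+* L) := Fintype.ofFinite _
  let Δ : 𝓞 F → ((F →+* L) × (F →+* L) → 𝓞 L) := fun β p =>
    RingOfIntegers.mapRingHom p.1 β - RingOfIntegers.mapRingHom p.2 β
  suffices hfin : (Δ '' Gens).Finite by
    obtain ⟨T, hTG, hTfin, hT⟩ := hfin.exists_subset_finite_image_eq subset_rfl
    refine ⟨T, hTfin, fun η hη => hTG hη, fun β hβ => ?_⟩
    have hm : Δ β ∈ Δ '' T := by rw [hT]; exact ⟨β, hβ, rfl⟩
    obtain ⟨η, hη, hηβ⟩ := hm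
    refine ⟨η, hη, ?_⟩
    obtain ⟨a, ha⟩ := wg_const (β - η) (by
      intro χ χ'
      obtain ⟨φ, rfl⟩ := hτ0 χ
      obtain ⟨φ', rfl⟩ := hτ0 χ'
      have h1 : (φ (η:F)) - φ' (η:F) = φ (β:F) - φ' (β:F) := 
        congrArg (fun z : 𝓞 L => (z:L)) (congrFun hηβ (φ, φ'))
      have h2 : φ (β:F) - φ (η:F) = φ' (β:F) - φ' (η:F) := by linear_combination -h1
      have h3 := congrArg τ0 h2
      rw [map_sub, map_sub] at h3
      push_cast
      simp only [RingHom.comp_apply, map_sub]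
      exact h3)
    exact ⟨a, by rw [← ha]; ring⟩
  by_cases hsub : ∀ φ ψ : F →+* L, φ = ψ
  · refine (Set.finite_singleton (0 : (F →+* L) × (F →+* L) → 𝓞 L)).subset ?_
    rintro _ ⟨β, _, rfl⟩
    refine funext fun p => ?_
    change RingOfIntegers.mapRingHom p.1 β - RingOfIntegers.mapRingHom p.2 β = 0
    rw [hsub p.1 p.2, sub_self]
  push Not at hsub
  obtain ⟨φ0, φ1, h01⟩ := hsub
  by_cases hG : ∀ β, β ∉ Gens
  · have : Gens = ∅ := Set.eq_empty_iff_forall_notMem.2 hG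
    rw [this]; simp
  push Not at hG
  obtain ⟨β0, hβ0⟩ := hG
  have hΔ0 : ∀ β ∈ Gens, ∀ φ ψ, φ ≠ ψ → Δ β (φ, ψ) ≠ 0 := by
    intro β hβ φ ψ hne h
    apply hne
    refine wg_sep β hβ φ ψ ?_
    exact congrArg (fun z : 𝓞 L => (z:L)) (sub_eq_zero.1 h)
  have hadd : ∀ β φ ψ χ, Δ β (φ, ψ) + Δ β (ψ, χ) = Δ β (φ, χ) := by
    intro β φ ψ χ
    simp only [Δ]; ring
  have hunit : ∀ β ∈ Gens, ∃ u : (F →+* L) × (F →+* L) → (𝓞 L)ˣ, ∀ p, Δ β p = Δ β0 p * u p := by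
    intro β hβ
    choose u hu using fun p : (F →+* L) × (F →+* L) => wg_assoc β0 β hβ0 hβ p.1 p.2
    exact ⟨u, fun p => (hu p).symm⟩
  let r : 𝓞 F → (F →+* L) → L := fun β φ => (Δ β (φ0, φ) : L) / (Δ β (φ0, φ1) : L)
  have hrfin : (r '' Gens).Finite := by
    have hV : ∀ φ : F →+* L, ((fun β => r β φ) '' Gens).Finite := by
      intro φ
      by_cases h0 : φ = φ0
      · refine (Set.finite_singleton (0:L)).subset ?_
        rintro _ ⟨β, _, rfl⟩
        simp [r, Δ, h0]
      by_cases h1 : φ = φ1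
      · refine (Set.finite_singleton (1:L)).subset ?_
        rintro _ ⟨β, hβ, rfl⟩
        have := hΔ0 β hβ φ0 φ1 h01
        have h2 : (Δ β (φ0, φ1) : L) ≠ 0 := by exact_mod_cast this
        simp only [r, h1, Set.mem_singleton_iff]
        exact div_self h2
      have ue := wg_unit_eq (Δ β0 (φ0, φ)) (-Δ β0 (φ1, φ)) (Δ β0 (φ0, φ1)) (hΔ0 _ hβ0 _ _ (Ne.symm h0))
        (neg_ne_zero.2 (hΔ0 _ hβ0 _ _ (Ne.symm h1))) (hΔ0 _ hβ0 _ _ h01)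
      refine (ue.image (fun p => ((Δ β0 (φ0, φ) * (p.1 : 𝓞 L) : 𝓞 L) : L) / (Δ β0 (φ0, φ1) : L))).subset ?_
      rintro _ ⟨β, hβ, rfl⟩
      obtain ⟨u, hu⟩ := hunit β hβ
      refine ⟨(u (φ0, φ) * (u (φ0, φ1))⁻¹, u (φ1, φ) * (u (φ0, φ1))⁻¹), ?_, ?_⟩
      · have h := hadd β φ0 φ1 φ
        rw [hu, hu, hu] at h
        change Δ β0 (φ0, φ) * ((u (φ0, φ) * (u (φ0, φ1))⁻¹ : (𝓞 L)ˣ) : 𝓞 L) + (-Δ β0 (φ1, φ)) * ((u (φ1, φ) * (u (φ0, φ1))⁻¹ : (𝓞 L)ˣ) : 𝓞 L) = Δ β0 (φ0, φ1)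
        rw [Units.val_mul, Units.val_mul]
        have h3 := (u (φ0, φ1)).mul_inv
        linear_combination (-(((u (φ0, φ1))⁻¹ : (𝓞 L)ˣ) : 𝓞 L)) * h + (Δ β0 (φ0, φ1)) * h3
      · change ((Δ β0 (φ0, φ) * ((u (φ0, φ) * (u (φ0, φ1))⁻¹ : (𝓞 L)ˣ) : 𝓞 L) : 𝓞 L) : L) / (Δ β0 (φ0, φ1) : L) = (Δ β (φ0, φ) : L) / (Δ β (φ0, φ1) : L)
        have e1 : (Δ β0 (φ0, φ1) : L) ≠ 0 := by exact_mod_cast hΔ0 _ hβ0 _ _ h01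
        have e2 : (Δ β (φ0, φ1) : L) ≠ 0 := by exact_mod_cast hΔ0 _ hβ _ _ h01
        rw [div_eq_div_iff e1 e2, hu (φ0, φ1), hu (φ0, φ)]
        have h3 := (u (φ0, φ1)).mul_inv
        have h4 : Δ β0 (φ0, φ) * ((u (φ0, φ) * (u (φ0, φ1))⁻¹ : (𝓞 L)ˣ) : 𝓞 L) * (Δ β0 (φ0, φ1) * u (φ0, φ1)) = Δ β0 (φ0, φ) * u (φ0, φ) * Δ β0 (φ0, φ1) := by
          rw [Units.val_mul]
          linear_combination (Δ β0 (φ0, φ) * u (φ0, φ) * Δ β0 (φ0, φ1)) * h3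
        exact_mod_cast h4
    refine (Set.Finite.pi' hV).subset ?_
    rintro _ ⟨β, hβ, rfl⟩ φ
    exact ⟨β, hβ, rfl⟩
  -- the sum of absolute values of differences
  let S : 𝓞 F → ℝ := fun β => ∑ p : (F →+* ℂ) × (F →+* ℂ), ‖p.1 β - p.2 β‖
  have hS : ∀ β, ∀ τ : L →+* ℂ, ∑ p : (F →+* L) × (F →+* L), ‖τ (Δ β p)‖ = S β := by
    intro β τ
    have hb := Function.Bijective.sum_comp (e := Prod.map (fun φ : F →+* L => τ.comp φ) (fun φ : F →+* L => τ.comp φ))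
      ((wg_bij τ0 hτ0 τ).prodMap (wg_bij τ0 hτ0 τ)) (fun p : (F →+* ℂ) × (F →+* ℂ) => ‖p.1 β - p.2 β‖)
    refine Eq.trans (Finset.sum_congr rfl fun p _ => ?_) hb
    change ‖τ (p.1 (β:F) - p.2 (β:F))‖ = ‖τ (p.1 (β:F)) - τ (p.2 (β:F))‖
    rw [map_sub]
  have hSpos : ∀ β ∈ Gens, 0 < S β := by
    intro β hβ
    rw [← hS β τ0]
    refine Finset.sum_pos' (fun _ _ => norm_nonneg _) ⟨(φ0, φ1), Finset.mem_univ _, ?_⟩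
    rw [norm_pos_iff, Ne, map_eq_zero]
    exact_mod_cast hΔ0 β hβ _ _ h01
  refine (hrfin.biUnion (t := fun ρ => Δ '' {β | β ∈ Gens ∧ r β = ρ}) ?_).subset ?_
  · rintro _ ⟨β1, hβ1, rfl⟩
    refine ((wg_northcott (L := L) 1).image (fun u : (𝓞 L)ˣ => fun p => Δ β1 p * (u : 𝓞 L))).subset ?_
    rintro _ ⟨β, ⟨hβ, hr⟩, rfl⟩
    obtain ⟨u, hu⟩ := wg_assoc β1 β hβ1 hβ φ0 φ1
    change Δ β1 (φ0, φ1) * u = Δ β (φ0, φ1) at hu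
    have e1 : (Δ β1 (φ0, φ1) : L) ≠ 0 := by exact_mod_cast hΔ0 _ hβ1 _ _ h01
    have e2 : (Δ β (φ0, φ1) : L) ≠ 0 := by exact_mod_cast hΔ0 _ hβ _ _ h01
    have h0φ : ∀ φ, Δ β1 (φ0, φ) * u = Δ β (φ0, φ) := by
      intro φ
      have h2 : (Δ β (φ0, φ) : L) / (Δ β (φ0, φ1) : L) = (Δ β1 (φ0, φ) : L) / (Δ β1 (φ0, φ1) : L) := congrFun hr φ
      rw [div_eq_div_iff e2 e1] at h2
      have h3 : Δ β (φ0, φ) * Δ β1 (φ0, φ1) = Δ β1 (φ0, φ) * Δ β (φ0, φ1) := by exact_mod_cast h2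
      rw [← hu] at h3
      refine mul_right_cancel₀ (hΔ0 _ hβ1 _ _ h01) ?_
      rw [h3]; ring
    have hall : ∀ p, Δ β1 p * u = Δ β p := by
      rintro ⟨φ, ψ⟩
      have a1 := hadd β φ0 φ ψ
      have a2 := hadd β1 φ0 φ ψ
      have a3 := h0φ φ
      have a4 := h0φ ψ
      linear_combination a4 - a3 + (u : 𝓞 L) * a2 - a1
    refine ⟨u, ?_, funext hall⟩
    have hτ : ∀ τ : L →+* ℂ, ‖τ (u : 𝓞 L)‖ = S β / S β1 := by
      intro τ
      rw [eq_div_iff (hSpos β1 hβ1).ne', ← hS β τ, ← hS β1 τ, Finset.mul_sum]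
      refine Finset.sum_congr rfl fun p _ => ?_
      rw [← hall p, ← norm_mul, ← map_mul]
      congr 2
      push_cast
      ring
    intro τ
    rw [hτ τ]
    have h1 := wg_prod_emb ((u⁻¹ : (𝓞 L)ˣ) : 𝓞 L) (u⁻¹).ne_zero
    have h2 : ∀ τ : L →+* ℂ, ‖τ ((u⁻¹ : (𝓞 L)ˣ) : 𝓞 L)‖ = (S β / S β1)⁻¹ := by
      intro τ
      rw [wg_unit_inv, norm_inv, hτ]
    rw [Finset.prod_congr rfl (fun τ _ => h2 τ), Finset.prod_const, Finset.card_univ, NumberField.Embeddings.card] at h1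
    by_contra hcon
    push Not at hcon
    have h3 : ((S β / S β1)⁻¹)^(Module.finrank ℚ L) < 1 := 
      pow_lt_one₀ (by positivity) (inv_lt_one_of_one_lt₀ hcon) (Module.finrank_pos).ne'
    linarith
  · rintro _ ⟨β, hβ, rfl⟩
    exact Set.mem_biUnion ⟨β, hβ, rfl⟩ ⟨β, ⟨hβ, rfl⟩, rfl⟩
end

section
open NumberField

lemma wg_sieg_alg (e0 e1 e2 n0 n1 n2 a q : ℂ) (h0 : e0 = (n0+a)^2-4*q) (h1 : e1 = (n1+a)^2-4*q)
    (h2 : e2 = (n2+a)^2-4*q) (he2 : e2 ≠ 0) (h10 : n1 - n0 ≠ 0) :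
    e1*(n2-n0)/(e2*(n1-n0)) - 1 = (n1-n2)*((n1-n0)*(n2-n0)-e0)/(e2*(n1-n0)) := by
  have : e2 * (n1-n0) ≠ 0 := mul_ne_zero he2 h10
  rw [div_sub_one this]
  congr 1
  subst h0 h1 h2
  ring

lemma wg_sieg_low (e0 e2 n0 n2 : ℂ) (a : ℝ) (q : ℂ) (h0 : e0 = (n0+a)^2-4*q)
    (h2 : e2 = (n2+a)^2-4*q) (C0 c1 : ℝ) (_hc1 : 0 < c1) (hn0 : ‖n0‖ ≤ C0)
    (hn2 : ‖n2‖ ≤ C0) (h20 : c1 ≤ ‖n2-n0‖) (ha : 2*C0 ≤ |a|) : c1*|a| ≤ ‖e2 - e0‖ := by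
  have h : e2 - e0 = (n2-n0)*(2*a + (n2+n0)) := by subst h0 h2; ring
  rw [h, norm_mul]
  have h1 : |a| ≤ ‖(2*a:ℂ) + (n2+n0)‖ := by
    have h3 := norm_sub_norm_le (2*a:ℂ) (-(n2+n0))
    rw [sub_neg_eq_add, norm_neg] at h3
    have h4 := norm_add_le n2 n0
    have h5 : ‖(2*a:ℂ)‖ = 2*|a| := by simp
    linarith
  gcongr

lemma wg_sieg_w (e0 e1 e2 n0 n1 n2 : ℂ) (a : ℝ) (q : ℂ) (h0 : e0 = (n0+a)^2-4*q) (h1 : e1 = (n1+a)^2-4*q)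
    (h2 : e2 = (n2+a)^2-4*q) (C0 c1 : ℝ) (hC0 : 1 ≤ C0) (hc1 : 0 < c1) (hn0 : ‖n0‖ ≤ C0) (hn1 : ‖n1‖ ≤ C0)
    (hn2 : ‖n2‖ ≤ C0) (h10 : c1 ≤ ‖n1-n0‖) (h20 : c1 ≤ ‖n2-n0‖) (h12 : c1 ≤ ‖n1-n2‖)
    (ha : 2*C0 ≤ |a|) (ha' : 2 ≤ c1*|a|) (he : ‖e0‖ ≤ 1) (he' : ‖e0‖ < c1^2) :
    0 < ‖e1*(n2-n0)/(e2*(n1-n0)) - 1‖ ∧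
      ‖e1*(n2-n0)/(e2*(n1-n0)) - 1‖ ≤ (2*C0*(4*C0^2+1)*2/c1^2) / |a| := by
  have hlow := wg_sieg_low e0 e2 n0 n2 a q h0 h2 C0 c1 hc1 hn0 hn2 h20 ha
  have hapos : 0 < |a| := by linarith
  have he2 : c1*|a|/2 ≤ ‖e2‖ := by
    have := norm_sub_le e2 e0
    linarith
  have he2p : 0 < ‖e2‖ := lt_of_lt_of_le (by positivity) he2
  have he20 : e2 ≠ 0 := norm_pos_iff.1 he2p
  have h100 : n1 - n0 ≠ 0 := norm_pos_iff.1 (by linarith)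
  rw [wg_sieg_alg e0 e1 e2 n0 n1 n2 a q h0 h1 h2 he20 h100, norm_div, norm_mul, norm_mul]
  have hm : 0 < ‖(n1-n0)*(n2-n0)-e0‖ := by
    have := norm_sub_norm_le ((n1-n0)*(n2-n0)) e0
    rw [norm_mul] at this
    have h3 : c1^2 ≤ ‖n1-n0‖*‖n2-n0‖ := by rw [sq]; gcongr
    linarith
  constructor
  · have : 0 < ‖n1-n2‖ := by linarith
    have : 0 < ‖n1-n0‖ := by linarith
    positivity
  · have b1 := norm_sub_le n1 n2
    have b2 := norm_sub_le n1 n0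
    have b3 := norm_sub_le n2 n0
    have b4 : ‖(n1-n0)*(n2-n0)-e0‖ ≤ 4*C0^2+1 := by
      have := norm_sub_le ((n1-n0)*(n2-n0)) e0
      rw [norm_mul] at this
      have : ‖n1-n0‖*‖n2-n0‖ ≤ (2*C0)*(2*C0) := by gcongr <;> linarith
      nlinarith
    calc ‖n1-n2‖ * ‖(n1-n0)*(n2-n0)-e0‖ / (‖e2‖*‖n1-n0‖) ≤ (2*C0)*(4*C0^2+1)/((c1*|a|/2)*c1) := by
          gcongr; linarith
      _ = _ := by field_simp

lemma wg_sieg_up (e0 e1 n0 n1 : ℂ) (a : ℝ) (q : ℂ) (h0 : e0 = (n0+a)^2-4*q) (h1 : e1 = (n1+a)^2-4*q)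
    (C0 : ℝ) (hC0 : 1 ≤ C0) (hn0 : ‖n0‖ ≤ C0) (hn1 : ‖n1‖ ≤ C0)
    (ha : 2*C0 ≤ |a|) (he : ‖e0‖ ≤ 1) : ‖e1‖ ≤ 9*|a|^2 := by
  have h : e1 = e0 + ((n1+a)^2 - (n0+a)^2) := by subst h0 h1; ring
  have b0 : ‖n0+a‖ ≤ 2*|a| := by
    have := norm_add_le n0 (a:ℂ)
    have h5 : ‖(a:ℂ)‖ = |a| := by simp
    linarith
  have b1 : ‖n1+a‖ ≤ 2*|a| := by
    have := norm_add_le n1 (a:ℂ)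
    have h5 : ‖(a:ℂ)‖ = |a| := by simp
    linarith
  have := norm_add_le e0 ((n1+a)^2 - (n0+a)^2)
  have h2 := norm_sub_le ((n1+a)^2) ((n0+a)^2)
  rw [norm_pow, norm_pow] at h2
  have h3 : ‖n0+a‖^2 ≤ (2*|a|)^2 := by gcongr
  have h4 : ‖n1+a‖^2 ≤ (2*|a|)^2 := by gcongr
  rw [h]
  nlinarith

lemma wg_triple {F : Type*} [Field F] [NumberField F] (η ε0 : 𝓞 F) (hε0 : ε0 ≠ 0) (χ0 χ1 χ2 : F →+* ℂ)
    (C0 c1 : ℝ) (hC0 : 1 ≤ C0) (hc1 : 0 < c1) (hη : ∀ χ : F →+* ℂ, ‖χ η‖ ≤ C0)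
    (h10 : c1 ≤ ‖χ1 η - χ0 η‖) (h20 : c1 ≤ ‖χ2 η - χ0 η‖) (h12 : c1 ≤ ‖χ1 η - χ2 η‖) :
    {a : ℤ | 2*C0 ≤ |(a:ℝ)| ∧ 2 ≤ c1*|(a:ℝ)| ∧ ∃ q : ℤ, ∃ v : (𝓞 F)ˣ,
      (∀ χ : F →+* ℂ, χ ε0 * χ (v : 𝓞 F) = (χ η + (a:ℝ))^2 - 4*(q:ℂ)) ∧
      ‖χ0 ε0 * χ0 (v : 𝓞 F)‖ ≤ 1 ∧ ‖χ0 ε0 * χ0 (v : 𝓞 F)‖ < c1^2}.Finite := by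
  classical
  obtain ⟨L, _, _, τ0, hτ0⟩ := wg_exists_L F
  obtain ⟨φ0, rfl⟩ := hτ0 χ0
  obtain ⟨φ1, rfl⟩ := hτ0 χ1
  obtain ⟨φ2, rfl⟩ := hτ0 χ2
  let A : 𝓞 L := RingOfIntegers.mapRingHom φ1 ε0 * (RingOfIntegers.mapRingHom φ2 η - RingOfIntegers.mapRingHom φ0 η)
  let B : 𝓞 L := RingOfIntegers.mapRingHom φ2 ε0 * (RingOfIntegers.mapRingHom φ1 η - RingOfIntegers.mapRingHom φ0 η)
  have hχε : ∀ χ : F →+* ℂ, χ ε0 ≠ 0 := fun χ => by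
    rw [Ne, map_eq_zero]; exact_mod_cast hε0
  have hA : τ0 A = τ0 (φ1 ε0) * (τ0 (φ2 η) - τ0 (φ0 η)) := by
    change τ0 (φ1 (ε0:F) * (φ2 (η:F) - φ0 (η:F))) = _
    rw [map_mul, map_sub]
  have hB : τ0 B = τ0 (φ2 ε0) * (τ0 (φ1 η) - τ0 (φ0 η)) := by
    change τ0 (φ2 (ε0:F) * (φ1 (η:F) - φ0 (η:F))) = _
    rw [map_mul, map_sub]
  have hA0 : A ≠ 0 := by
    intro h
    have h2 : τ0 A = 0 := by rw [h]; simp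
    rw [hA] at h2
    rcases mul_eq_zero.1 h2 with h3 | h3
    · exact hχε (τ0.comp φ1) h3
    · have := norm_pos_iff.1 (hc1.trans_le h20); exact this h3
  have hB0 : B ≠ 0 := by
    intro h
    have h2 : τ0 B = 0 := by rw [h]; simp
    rw [hB] at h2
    rcases mul_eq_zero.1 h2 with h3 | h3
    · exact hχε (τ0.comp φ2) h3
    · have := norm_pos_iff.1 (hc1.trans_le h10); exact this h3
  obtain ⟨D, hD1, hD⟩ : ∃ D : ℝ, 1 ≤ D ∧ ∀ χ : F →+* ℂ, ‖χ ε0‖⁻¹ ≤ D := by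
    refine ⟨1 + ∑ χ : F →+* ℂ, ‖χ ε0‖⁻¹, ?_, fun χ => ?_⟩
    · have : 0 ≤ ∑ χ : F →+* ℂ, ‖χ ε0‖⁻¹ := Finset.sum_nonneg fun _ _ => by positivity
      linarith
    · have := Finset.single_le_sum (f := fun χ : F →+* ℂ => ‖χ ε0‖⁻¹) (fun _ _ => by positivity) (Finset.mem_univ χ)
      linarith
  set C3 : ℝ := 9*D
  have hC3 : 1 ≤ C3 := by simp only [C3]; linarith
  set C : ℝ := max 1 (2*C0*(4*C0^2+1)*2/c1^2)
  have hC1 : 1 ≤ C := le_max_left _ _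
  set n := Module.finrank ℚ F
  have hX := wg_thmA τ0 A B hA0 hB0 (1/(2*((n:ℝ)+1))) (Real.log (C*C3)) (by positivity)
    (Real.log_nonneg (one_le_mul_of_one_le_of_one_le hC1 hC3))
  refine (hX.biUnion (t := fun x => {a : ℤ | |(a:ℝ)| ≤ C / ‖τ0 A * τ0 (x : 𝓞 L) / τ0 B - 1‖}) ?_).subset ?_
  · intro x _
    refine (Set.finite_Icc (-⌊C / ‖τ0 A * τ0 (x : 𝓞 L) / τ0 B - 1‖⌋) ⌊C / ‖τ0 A * τ0 (x : 𝓞 L) / τ0 B - 1‖⌋).subset ?_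
    intro a ha
    have h1 : |a| ≤ ⌊C / ‖τ0 A * τ0 (x : 𝓞 L) / τ0 B - 1‖⌋ := by
      rw [Int.le_floor]; push_cast; exact ha
    exact abs_le.1 h1
  · rintro a ⟨ha1, ha2, q, v, hv, hv1, hv2⟩
    have hapos : 0 < |(a:ℝ)| := by linarith
    have ha1' : 1 ≤ |(a:ℝ)| := by linarith
    obtain ⟨hw0, hw1⟩ := wg_sieg_w _ _ _ _ _ _ (a:ℝ) (q:ℂ) (hv (τ0.comp φ0)) (hv (τ0.comp φ1)) (hv (τ0.comp φ2))
      C0 c1 hC0 hc1 (hη _) (hη _) (hη _) h10 h20 h12 ha1 ha2 hv1 hv2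
    have hup : ∀ χ : F →+* ℂ, ‖χ (v : 𝓞 F)‖ ≤ (C3*|(a:ℝ)|)^2 := by
      intro χ
      have h1 := wg_sieg_up _ _ _ _ (a:ℝ) (q:ℂ) (hv (τ0.comp φ0)) (hv χ) C0 hC0 (hη _) (hη _) ha1 hv1
      rw [norm_mul] at h1
      have h2 : 0 < ‖χ ε0‖ := norm_pos_iff.2 (hχε χ)
      calc ‖χ (v : 𝓞 F)‖ = ‖χ ε0‖⁻¹ * (‖χ ε0‖ * ‖χ (v : 𝓞 F)‖) := by field_simp
        _ ≤ D * (9*|(a:ℝ)|^2) := by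
          gcongr
          exact hD χ
        _ = C3 * |(a:ℝ)|^2 := by simp only [C3]; ring
        _ ≤ _ := by
          rw [mul_pow]; gcongr; nlinarith
    have hM : 1 ≤ C3*|(a:ℝ)| := one_le_mul_of_one_le_of_one_le hC3 ha1'
    have hM2 : 1 ≤ (C3*|(a:ℝ)|)^2 := one_le_pow₀ hM
    have hinv : ∀ χ : F →+* ℂ, ‖χ (v : 𝓞 F)‖⁻¹ ≤ ((C3*|(a:ℝ)|)^2)^n := 
      wg_inv_bound (v : 𝓞 F) v.ne_zero _ hM2 hup
    let u1 : (𝓞 L)ˣ := Units.map (RingOfIntegers.mapRingHom φ1 : 𝓞 F →* 𝓞 L) v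
    let u2 : (𝓞 L)ˣ := Units.map (RingOfIntegers.mapRingHom φ2 : 𝓞 F →* 𝓞 L) v
    have hu1 : ∀ τ : L →+* ℂ, τ (u1 : 𝓞 L) = (τ.comp φ1) (v : 𝓞 F) := fun τ => rfl
    have hu2 : ∀ τ : L →+* ℂ, τ (u2 : 𝓞 L) = (τ.comp φ2) (v : 𝓞 F) := fun τ => rfl
    have hx : ∀ τ : L →+* ℂ, τ ((u1 * u2⁻¹ : (𝓞 L)ˣ) : 𝓞 L) = (τ.comp φ1) (v : 𝓞 F) * ((τ.comp φ2) (v : 𝓞 F))⁻¹ := by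
      intro τ
      rw [Units.val_mul, RingOfIntegers.coe_eq_algebraMap, map_mul, map_mul, ← RingOfIntegers.coe_eq_algebraMap, ← RingOfIntegers.coe_eq_algebraMap, wg_unit_inv, hu1, hu2]
    have hweq : τ0 A * τ0 ((u1 * u2⁻¹ : (𝓞 L)ˣ) : 𝓞 L) / τ0 B =
       ((τ0.comp φ1) ε0 * (τ0.comp φ1) (v : 𝓞 F)) * ((τ0.comp φ2) η - (τ0.comp φ0) η) /
        (((τ0.comp φ2) ε0 * (τ0.comp φ2) (v : 𝓞 F)) * ((τ0.comp φ1) η - (τ0.comp φ0) η)) := by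
      rw [hx, hA, hB]
      simp only [RingHom.comp_apply]
      rw [div_eq_mul_inv, div_eq_mul_inv, mul_inv, mul_inv, mul_inv]
      ring
    rw [← hweq] at hw0 hw1
    have hw1' : ‖τ0 A * τ0 ((u1 * u2⁻¹ : (𝓞 L)ˣ) : 𝓞 L) / τ0 B - 1‖ ≤ C / |(a:ℝ)| :=
      hw1.trans (by gcongr; exact le_max_right _ _)
    have hexp : Real.exp (2*((n:ℝ)+1)*Real.log (C3*|(a:ℝ)|)) = ((C3*|(a:ℝ)|)^2)^(n+1) := by
      rw [← Real.exp_log (show (0:ℝ) < ((C3*|(a:ℝ)|)^2)^(n+1) by positivity)]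
      rw [Real.log_pow, Real.log_pow]; push_cast; congr 1; ring
    have hbd : ∀ χ χ' : F →+* ℂ, ‖χ (v : 𝓞 F) * (χ' (v : 𝓞 F))⁻¹‖ ≤ ((C3*|(a:ℝ)|)^2)^(n+1) := by
      intro χ χ'
      rw [norm_mul, norm_inv, pow_succ, mul_comm]
      gcongr
      · exact hinv χ'
      · exact hup χ
    rw [Set.mem_iUnion₂]
    refine ⟨u1 * u2⁻¹, ⟨2*((n:ℝ)+1)*Real.log (C3*|(a:ℝ)|), ?_, ?_, ?_, ?_⟩, ?_⟩
    · have := Real.log_nonneg hM; positivity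
    · intro τ
      rw [hexp, wg_unit_inv, hx]
      refine ⟨hbd _ _, ?_⟩
      rw [mul_inv, inv_inv, mul_comm]
      exact hbd _ _
    · intro h
      rw [norm_pos_iff] at hw0
      apply hw0
      have h2 : τ0 A * τ0 ((u1 * u2⁻¹ : (𝓞 L)ˣ) : 𝓞 L) = τ0 B := by
        rw [← h, ← map_mul]; push_cast; rfl
      rw [h2, div_self, sub_self]
      rw [Ne, map_eq_zero]; exact_mod_cast hB0
    · refine hw1'.trans (le_of_eq ?_)
      have e : 1/(2*((n:ℝ)+1)) * (2*((n:ℝ)+1)*Real.log (C3*|(a:ℝ)|)) = Real.log (C3*|(a:ℝ)|) := by field_simp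
      rw [e, Real.exp_sub, Real.exp_log (by positivity), Real.exp_log (by positivity)]
      field_simp
    · change |(a:ℝ)| ≤ _
      rw [le_div_iff₀ hw0]
      rw [le_div_iff₀ hapos] at hw1'
      linarith
end

section
open NumberField Polynomial

lemma wg_unit_prod {F : Type*} [Field F] [NumberField F] (v : (𝓞 F)ˣ) :
    ∏ χ : F →+* ℂ, ‖χ (v : 𝓞 F)‖ = 1 := by
  have h1 := wg_prod_emb (v : 𝓞 F) v.ne_zero
  have h2 := wg_prod_emb ((v⁻¹ : (𝓞 F)ˣ) : 𝓞 F) (v⁻¹).ne_zero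
  have h3 : ∏ χ : F →+* ℂ, ‖χ ((v⁻¹ : (𝓞 F)ˣ) : 𝓞 F)‖ = (∏ χ : F →+* ℂ, ‖χ (v : 𝓞 F)‖)⁻¹ := by
    rw [← Finset.prod_inv_distrib]
    refine Finset.prod_congr rfl fun χ _ => ?_
    rw [wg_unit_inv, norm_inv]
  rw [h3] at h2
  refine le_antisymm ?_ h1
  rwa [one_le_inv₀ (by linarith)] at h2

lemma wg_siegel {F : Type*} [Field F] [NumberField F] (hg : 3 ≤ Module.finrank ℚ F) (η ε0 : 𝓞 F)
    (hη : ∀ x : 𝓞 F, ∃ p : ℤ[X], aeval η p = x) (hε0 : ε0 ≠ 0) :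
    {p : ℤ × ℤ | ∃ v : (𝓞 F)ˣ, ε0 * v = (η + p.1)^2 - 4 * p.2}.Finite := by
  classical
  set N0 : ℝ := ∏ χ : F →+* ℂ, ‖χ ε0‖ with hN0
  have hN0n : 0 ≤ N0 := Finset.prod_nonneg fun _ _ => norm_nonneg _
  have hprod : ∀ v : (𝓞 F)ˣ, ∏ χ : F →+* ℂ, ‖χ ε0 * χ (v : 𝓞 F)‖ = N0 := by
    intro v
    simp_rw [norm_mul]
    rw [Finset.prod_mul_distrib, wg_unit_prod, mul_one]
  have hcard : Fintype.card (F →+* ℂ) = Module.finrank ℚ F := Embeddings.card F ℂ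
  obtain ⟨C0, hC0, hηC⟩ : ∃ C0 : ℝ, 1 ≤ C0 ∧ ∀ χ : F →+* ℂ, ‖χ η‖ ≤ C0 := by
    refine ⟨1 + ∑ χ : F →+* ℂ, ‖χ η‖, ?_, fun χ => ?_⟩
    · have : 0 ≤ ∑ χ : F →+* ℂ, ‖χ η‖ := Finset.sum_nonneg fun _ _ => by positivity
      linarith
    · have := Finset.single_le_sum (f := fun χ : F →+* ℂ => ‖χ η‖) (fun _ _ => by positivity) (Finset.mem_univ χ)
      linarith
  obtain ⟨c1, hc1, hηc⟩ : ∃ c1 : ℝ, 0 < c1 ∧ ∀ χ χ' : F →+* ℂ, χ ≠ χ' → c1 ≤ ‖χ η - χ' η‖ := by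
    have hs : 0 ≤ ∑ p : (F →+* ℂ) × (F →+* ℂ), ‖p.1 η - p.2 η‖⁻¹ := Finset.sum_nonneg fun _ _ => by positivity
    refine ⟨(1 + ∑ p : (F →+* ℂ) × (F →+* ℂ), ‖p.1 η - p.2 η‖⁻¹)⁻¹, by positivity, fun χ χ' h => ?_⟩
    have h1 : 0 < ‖χ η - χ' η‖ := by
      rw [norm_pos_iff, sub_ne_zero]
      exact fun h2 => h (wg_sep η hη χ χ' h2)
    have := Finset.single_le_sum (f := fun p : (F →+* ℂ) × (F →+* ℂ) => ‖p.1 η - p.2 η‖⁻¹) (fun _ _ => by positivity) (Finset.mem_univ (χ, χ'))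
    rw [inv_le_comm₀ (by positivity) h1]
    simp only at this
    linarith
  have hconv : ∀ (a q : ℤ) (v : (𝓞 F)ˣ), ε0 * v = (η + a)^2 - 4 * q →
      ∀ χ : F →+* ℂ, χ ε0 * χ (v : 𝓞 F) = (χ η + (a:ℝ))^2 - 4*(q:ℂ) := by
    intro a q v h χ
    have h0 : (ε0 : F) * ((v : 𝓞 F) : F) = ((η : F) + ((a : 𝓞 F) : F))^2 - (4:F) * ((q : 𝓞 F) : F) :=
      congrArg (fun z : 𝓞 F => (z:F)) h
    have h1 := congrArg χ h0
    have h4 : χ (4:F) = 4 := map_ofNat χ 4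
    rw [map_sub, map_mul, map_mul, h4] at h1
    simpa using h1
  have hne : Nonempty (F →+* ℂ) := inferInstance
  set δ0 : ℝ := min 1 (c1^2/2) with hδ0
  have hδ0p : 0 < δ0 := by rw [hδ0]; positivity
  have hδ01 : δ0 ≤ 1 := min_le_left _ _
  have hc1sq : 0 < c1^2 := by positivity
  have hδ02 : δ0 < c1^2 := (min_le_right _ _).trans_lt (by linarith)
  set n := Module.finrank ℚ F with hn
  set A0 : ℝ := 2*C0 + 2/c1 + (2*N0/(c1*δ0^(n-1)) + 1) with hA0
  have hfinA : {a : ℤ | ∃ q : ℤ, ∃ v : (𝓞 F)ˣ, ε0 * v = (η + a)^2 - 4 * q}.Finite := by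
    have hbig : (⋃ t : {t : (F →+* ℂ) × (F →+* ℂ) × (F →+* ℂ) // t.2.1 ≠ t.1 ∧ t.2.2 ≠ t.1 ∧ t.2.1 ≠ t.2.2}, 
      {a : ℤ | 2*C0 ≤ |(a:ℝ)| ∧ 2 ≤ c1*|(a:ℝ)| ∧ ∃ q : ℤ, ∃ v : (𝓞 F)ˣ,
      (∀ χ : F →+* ℂ, χ ε0 * χ (v : 𝓞 F) = (χ η + (a:ℝ))^2 - 4*(q:ℂ)) ∧
      ‖t.1.1 ε0 * t.1.1 (v : 𝓞 F)‖ ≤ 1 ∧ ‖t.1.1 ε0 * t.1.1 (v : 𝓞 F)‖ < c1^2}).Finite := by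
      refine Set.finite_iUnion fun t => ?_
      exact wg_triple η ε0 hε0 t.1.1 t.1.2.1 t.1.2.2 C0 c1 hC0 hc1 hηC (hηc _ _ t.2.1) (hηc _ _ t.2.2.1) (hηc _ _ t.2.2.2)
    refine ((Set.finite_Icc (-⌊A0⌋) ⌊A0⌋).union hbig).subset ?_
    rintro a ⟨q, v, hv⟩
    by_cases ha : |(a:ℝ)| ≤ A0
    · left
      have h1 : |a| ≤ ⌊A0⌋ := by rw [Int.le_floor]; push_cast; exact ha
      exact abs_le.1 h1
    right
    push Not at ha
    have hv' := hconv a q v hv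
    have hp1 : 0 < 2/c1 := by positivity
    have hp2 : 0 ≤ 2*N0/(c1*δ0^(n-1)) := by positivity
    have ha1 : 2*C0 ≤ |(a:ℝ)| := by linarith
    have ha2 : 2 ≤ c1*|(a:ℝ)| := by
      have : 2/c1 ≤ |(a:ℝ)| := by linarith
      rw [div_le_iff₀ hc1] at this; linarith
    have ha3 : 2*N0 < |(a:ℝ)| * (c1*δ0^(n-1)) := by
      rw [← div_lt_iff₀ (by positivity)]; linarith
    obtain ⟨χ0, hχ0⟩ : ∃ χ0 : F →+* ℂ, ‖χ0 ε0 * χ0 (v : 𝓞 F)‖ ≤ δ0 := by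
      by_contra! hcon
      obtain ⟨χ, χ', hχχ⟩ : ∃ χ χ' : F →+* ℂ, χ ≠ χ' :=
        Fintype.exists_pair_of_one_lt_card (by omega)
      obtain ⟨ψ, hψ⟩ : ∃ ψ : F →+* ℂ, c1*|(a:ℝ)|/2 ≤ ‖ψ ε0 * ψ (v : 𝓞 F)‖ := by
        by_contra! hc2
        have h1 := wg_sieg_low _ _ _ _ (a:ℝ) (q:ℂ) (hv' χ) (hv' χ') C0 c1 hc1 (hηC _) (hηC _) (hηc _ _ hχχ.symm) ha1
        have h2 := norm_sub_le (χ' ε0 * χ' (v : 𝓞 F)) (χ ε0 * χ (v : 𝓞 F))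
        have h3 := hc2 χ
        have h4 := hc2 χ'
        linarith
      have h1 := hprod v
      rw [← Finset.mul_prod_erase Finset.univ _ (Finset.mem_univ ψ)] at h1
      have h2 : δ0^(n-1) ≤ ∏ χ ∈ Finset.univ.erase ψ, ‖χ ε0 * χ (v : 𝓞 F)‖ := by
        calc δ0^(n-1) = ∏ χ ∈ Finset.univ.erase ψ, δ0 := by
              rw [Finset.prod_const, Finset.card_erase_of_mem (Finset.mem_univ _), Finset.card_univ, hcard]
          _ ≤ _ := Finset.prod_le_prod (fun _ _ => hδ0p.le) (fun χ _ => (hcon χ).le)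
      have h3 : c1*|(a:ℝ)|/2 * δ0^(n-1) ≤ N0 := by
        rw [← h1]; gcongr
      linarith
    obtain ⟨χ1, hχ1⟩ : ∃ χ1, χ1 ∉ ({χ0} : Finset (F →+* ℂ)) := by
      by_contra! h
      have := Finset.card_le_card (fun x _ => h x : (Finset.univ : Finset (F →+* ℂ)) ⊆ _)
      rw [Finset.card_univ, hcard, Finset.card_singleton] at this
      omega
    obtain ⟨χ2, hχ2⟩ : ∃ χ2, χ2 ∉ ({χ0, χ1} : Finset (F →+* ℂ)) := by
      by_contra! h
      have := Finset.card_le_card (fun x _ => h x : (Finset.univ : Finset (F →+* ℂ)) ⊆ _)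
      rw [Finset.card_univ, hcard] at this
      have h2 : ({χ0, χ1} : Finset (F →+* ℂ)).card ≤ 2 := Finset.card_le_two
      omega
    simp only [Finset.mem_singleton, Finset.mem_insert, not_or] at hχ1 hχ2
    rw [Set.mem_iUnion]
    exact ⟨⟨(χ0, χ1, χ2), hχ1, hχ2.1, Ne.symm hχ2.2⟩, ha1, ha2, q, v, hv', hχ0.trans hδ01, hχ0.trans_lt hδ02⟩
  refine (hfinA.biUnion (t := fun a => (fun q => (a, q)) '' {q : ℤ | |(q:ℝ)| ≤ (C0+|(a:ℝ)|)^2 + 1 + N0}) ?_).subset ?_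
  · intro a _
    refine Set.Finite.image _ ?_
    refine (Set.finite_Icc (-⌊(C0+|(a:ℝ)|)^2 + 1 + N0⌋) ⌊(C0+|(a:ℝ)|)^2 + 1 + N0⌋).subset ?_
    intro q hq
    have h1 : |q| ≤ ⌊(C0+|(a:ℝ)|)^2 + 1 + N0⌋ := by rw [Int.le_floor]; push_cast; exact hq
    exact abs_le.1 h1
  · rintro ⟨a, q⟩ ⟨v, hv⟩
    rw [Set.mem_iUnion₂]
    refine ⟨a, ⟨q, v, hv⟩, q, ?_, rfl⟩
    change |(q:ℝ)| ≤ _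
    have hv' := hconv a q v hv
    obtain ⟨χ, hχ⟩ : ∃ χ : F →+* ℂ, ‖χ ε0 * χ (v : 𝓞 F)‖ ≤ 1 + N0 := by
      by_contra! hcon
      have h1 : (1+N0)^n ≤ N0 := by
        calc (1+N0)^n = ∏ χ : F →+* ℂ, (1+N0) := by
              rw [Finset.prod_const, Finset.card_univ, hcard]
          _ ≤ ∏ χ : F →+* ℂ, ‖χ ε0 * χ (v : 𝓞 F)‖ := 
            Finset.prod_le_prod (fun _ _ => by positivity) (fun χ _ => (hcon χ).le)
          _ = _ := hprod v
      have h2 : (1+N0) ≤ (1+N0)^n := le_self_pow₀ (by linarith) (by omega)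
      linarith
    have h4 : (4*q:ℂ) = (χ η + (a:ℝ))^2 - χ ε0 * χ (v : 𝓞 F) := by rw [hv' χ]; ring
    have h5 := norm_sub_le ((χ η + (a:ℝ))^2) (χ ε0 * χ (v : 𝓞 F))
    rw [← h4, norm_pow] at h5
    have h6 : ‖(4*q:ℂ)‖ = 4*|(q:ℝ)| := by simp
    have h7 : ‖χ η + (a:ℝ)‖ ≤ C0 + |(a:ℝ)| := by
      have := norm_add_le (χ η) ((a:ℝ):ℂ)
      have h8 : ‖((a:ℝ):ℂ)‖ = |(a:ℝ)| := by simp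
      have := hηC χ
      linarith
    have h8 : ‖χ η + (a:ℝ)‖^2 ≤ (C0 + |(a:ℝ)|)^2 := by gcongr
    have := abs_nonneg (q:ℝ)
    linarith

lemma wg_abstract {F : Type*} [Field F] [NumberField F] (hg : 3 ≤ Module.finrank ℚ F) (ε0 : 𝓞 F) (hε0 : ε0 ≠ 0) :
    {p : 𝓞 F × ℤ | (∀ x : 𝓞 F, ∃ r : ℤ[X], aeval p.1 r = x) ∧ Associated ε0 (p.1^2 - 4 * p.2)}.Finite := by
  obtain ⟨T, hT, hTg, hTs⟩ := wg_gyory (F := F)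
  refine (hT.biUnion (t := fun η => (fun p : ℤ × ℤ => (η + (p.1 : 𝓞 F), p.2)) ''
    {p : ℤ × ℤ | ∃ v : (𝓞 F)ˣ, ε0 * v = (η + p.1)^2 - 4 * p.2}) fun η hη =>
      (wg_siegel hg η ε0 (hTg η hη) hε0).image _).subset ?_
  rintro ⟨β, q⟩ ⟨hβ, v, hv⟩
  obtain ⟨η, hη, a, rfl⟩ := hTs β hβ
  rw [Set.mem_iUnion₂]
  exact ⟨η, hη, (a, q), ⟨v, hv⟩, rfl⟩
end

section
open NumberField Polynomial

lemma wg_invol {K : Type*} [Field K] [NumberField K] 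
    (c : K ≃+* K) (hc : ∀ φ : K →+* ℂ, ∀ x : K, φ (c x) = (starRingEnd ℂ) (φ x)) (x : K) : c (c x) = x := by
  obtain ⟨φ⟩ : Nonempty (K →+* ℂ) := inferInstance
  apply φ.injective
  rw [hc, hc, Complex.conj_conj]

/-- the fixed field. -/
lemma wg_fixed {K : Type*} [Field K] [NumberField K] (hK : TotallyImaginary K)
    (c : K ≃+* K) (hc : ∀ φ : K →+* ℂ, ∀ x : K, φ (c x) = (starRingEnd ℂ) (φ x)) :
    ∃ F : IntermediateField ℚ K, (∀ x, x ∈ F ↔ c x = x) ∧ Module.finrank ℚ F * 2 = Module.finrank ℚ K := by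
  let c' : K ≃ₐ[ℚ] K := AlgEquiv.ofRingEquiv (f := c) (fun r => by simp)
  have hcc : ∀ x, c' x = c x := fun x => rfl
  have hsq : c' ^ 2 = 1 := by
    ext x
    rw [sq]
    exact wg_invol c hc x
  have hne : c' ≠ 1 := by
    intro h
    obtain ⟨φ⟩ : Nonempty (K →+* ℂ) := inferInstance
    obtain ⟨x, hx⟩ := hK φ
    apply hx
    rw [← hc]
    have : c' x = x := by rw [h]; rfl
    rw [← hcc, this]
  have hord : orderOf c' = 2 := orderOf_eq_prime hsq hne
  refine ⟨IntermediateField.fixedField (Subgroup.zpowers c'), fun x => ?_, ?_⟩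
  · rw [IntermediateField.mem_fixedField_iff]
    constructor
    · intro h; exact h c' (Subgroup.mem_zpowers c')
    · intro h f hf
      rw [Subgroup.mem_zpowers_iff] at hf
      obtain ⟨k, rfl⟩ := hf
      have h1 : c' ∈ MulAction.stabilizer (K ≃ₐ[ℚ] K) x := h
      exact Subgroup.zpow_mem _ h1 k
  · have h1 := IntermediateField.finrank_fixedField_eq_card (Subgroup.zpowers c')
    rw [Nat.card_zpowers, hord] at h1
    have h2 := Module.finrank_mul_finrank ℚ (IntermediateField.fixedField (Subgroup.zpowers c')) K
    rw [h1] at h2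
    exact h2

/-- Every integer is `p(β) + α r(β)`. -/
lemma wg_repr {K : Type*} [Field K] (c : K ≃+* K) (α β : K) (n : ℤ) (hn : α * c α = n) (hβ : β = α + c α)
    (x : K) (hx : x ∈ Algebra.adjoin ℤ ({α, c α} : Set K)) : ∃ p r : ℤ[X], x = aeval β p + α * aeval β r := by
  induction hx using Algebra.adjoin_induction with
  | mem x hx =>
    rcases hx with rfl | rfl
    · exact ⟨0, 1, by simp⟩
    · exact ⟨X, -1, by simp [hβ]⟩
  | algebraMap r => exact ⟨C r, 0, by simp⟩
  | add x y _ _ hx hy =>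
    obtain ⟨p, r, rfl⟩ := hx
    obtain ⟨p', r', rfl⟩ := hy
    exact ⟨p + p', r + r', by simp only [map_add]; ring⟩
  | mul x y _ _ hx hy =>
    obtain ⟨p, r, rfl⟩ := hx
    obtain ⟨p', r', rfl⟩ := hy
    refine ⟨p * p' - C n * r * r', p * r' + p' * r + X * r * r', ?_⟩
    simp only [map_add, map_mul, map_sub, aeval_C, aeval_X, algebraMap_int_eq, Int.coe_castRingHom]
    have : α * α = β * α - n := by rw [hβ, ← hn]; ring
    linear_combination (aeval β r * aeval β r') * this

lemma wg_fix_aeval {K : Type*} [Field K] (c : K ≃+* K) (β : K) (hβ : c β = β) (p : ℤ[X]) : 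
    c (aeval β p) = aeval β p := by
  have := (aeval_algHom_apply ((c : K →+* K).toIntAlgHom) β p)
  change aeval (c β) p = c (aeval β p) at this
  rw [← this, hβ]

theorem wg_main (g : ℕ) (hg : 3 ≤ g) (K : Type*) [Field K] [NumberField K]
    (hdeg : Module.finrank ℚ K = 2 * g) (hK : TotallyImaginary K)
    (c : K ≃+* K) (hc : ∀ φ : K →+* ℂ, ∀ x : K, φ (c x) = (starRingEnd ℂ) (φ x)) :
    {α : K | IsWeilGenerator K c α}.Finite := by
  classical
  have hinv := wg_invol c hc
  obtain ⟨F, hF, hFdeg⟩ := wg_fixed hK c hc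
  have hg3 : 3 ≤ Module.finrank ℚ F := by omega
  rcases Set.eq_empty_or_nonempty {α : K | IsWeilGenerator K c α} with he | ⟨α0, hα0⟩
  · rw [he]; exact Set.finite_empty
  -- integrality transfer
  have hintegral : ∀ x : K, x ∈ integralClosure ℤ K → c x = x → ∃ y : 𝓞 F, ((y : F) : K) = x := by
    intro x hx hcx
    refine ⟨⟨⟨x, (hF x).2 hcx⟩, ?_⟩, rfl⟩
    change IsIntegral ℤ _
    have : IsIntegral ℤ (algebraMap F K ⟨x, (hF x).2 hcx⟩) := hx
    exact (isIntegral_algebraMap_iff (algebraMap F K).injective).1 this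
  have hintc : ∀ x : K, x ∈ integralClosure ℤ K → c x ∈ integralClosure ℤ K := by
    intro x hx
    have : IsIntegral ℤ x := hx
    exact this.map ((c : K →+* K).toIntAlgHom)
  have hcF : ∀ y : 𝓞 F, c ((y : F) : K) = ((y : F) : K) := fun y => (hF _).1 (y : F).2
  have hyint : ∀ y : 𝓞 F, ((y : F) : K) ∈ integralClosure ℤ K := by
    intro y
    have : IsIntegral ℤ (y : F) := y.2
    exact this.map ((algebraMap F K).toIntAlgHom)
  have hinj : ∀ y z : 𝓞 F, ((y : F) : K) = ((z : F) : K) → y = z := by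
    intro y z h
    exact RingOfIntegers.ext (Subtype.ext h)
  have haev : ∀ (b : 𝓞 F) (p : ℤ[X]), (((aeval b p : 𝓞 F) : F) : K) = aeval ((b : F) : K) p := by
    intro b p
    exact (aeval_algHom_apply (((algebraMap F K).comp (algebraMap (𝓞 F) F)).toIntAlgHom) b p).symm
  -- the map α ↦ (β, n)
  have hβ : ∀ α : K, IsWeilGenerator K c α → ∃ b : 𝓞 F, ((b : F) : K) = α + c α := by
    intro α hα
    refine hintegral _ (add_mem hα.1 (hintc _ hα.1)) ?_
    rw [map_add, hinv, add_comm]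
  have hne : ∀ α : K, IsWeilGenerator K c α → α ≠ c α := by
    rintro α ⟨_, _, hadj⟩ h
    obtain ⟨φ⟩ : Nonempty (K →+* ℂ) := inferInstance
    obtain ⟨x, hx⟩ := hK φ
    apply hx
    rw [← hc]
    have h1 : ∀ y ∈ integralClosure ℤ K, c y = y := by
      intro y hy
      rw [← hadj] at hy
      induction hy using Algebra.adjoin_induction with
      | mem y hy =>
        rcases hy with rfl | rfl
        · exact h.symm
        · rw [← h]; exact h.symm
      | algebraMap r => simp
      | add x y _ _ hx hy => rw [map_add, hx, hy]
      | mul x y _ _ hx hy => rw [map_mul, hx, hy]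
    obtain ⟨a, b, hb, rfl⟩ := IsFractionRing.div_surjective (A := 𝓞 K) x
    rw [map_div₀ c]
    congr 2
    · exact h1 _ a.2
    · exact h1 _ b.2
  have hgen : ∀ α : K, IsWeilGenerator K c α → ∀ b : 𝓞 F, ((b : F) : K) = α + c α →
      ∀ x : 𝓞 F, ∃ p : ℤ[X], aeval b p = x := by
    intro α hα b hb x
    obtain ⟨n, hn⟩ := hα.2.1
    have hx := hyint x
    rw [← hα.2.2] at hx
    obtain ⟨p, r, hpr⟩ := wg_repr c α _ n hn hb _ hx
    refine ⟨p, hinj _ _ ?_⟩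
    rw [haev]
    have h1 := congrArg c hpr
    rw [map_add, map_mul, wg_fix_aeval c _ (hcF b), wg_fix_aeval c _ (hcF b), hcF, hpr] at h1
    have h2 : (α - c α) * aeval ((b : F) : K) r = 0 := by linear_combination h1
    rcases mul_eq_zero.1 h2 with h3 | h3
    · exact absurd (sub_eq_zero.1 h3) (hne α hα)
    · rw [hpr, h3]; ring
  have hdiv : ∀ α α' : K, IsWeilGenerator K c α → IsWeilGenerator K c α' → ∀ b b' : 𝓞 F, ∀ n n' : ℤ,
      ((b : F) : K) = α + c α → ((b' : F) : K) = α' + c α' → α * c α = n → α' * c α' = n' →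
      b^2 - 4 * n ∣ b'^2 - 4 * n' := by
    intro α α' hα hα' b b' n n' hb hb' hn hn'
    have hx : α' ∈ Algebra.adjoin ℤ ({α, c α} : Set K) := by rw [hα.2.2]; exact hα'.1
    obtain ⟨p, r, hpr⟩ := wg_repr c α _ n hn hb _ hx
    refine ⟨(aeval b r)^2, hinj _ _ ?_⟩
    have h1 := congrArg c hpr
    rw [map_add, map_mul, wg_fix_aeval c _ (hcF b), wg_fix_aeval c _ (hcF b)] at h1
    have h2 : α' - c α' = (α - c α) * aeval ((b : F) : K) r := by linear_combination hpr - h1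
    change ((b' : F) : K)^2 - 4 * (((n' : 𝓞 F) : F) : K) = 
      (((b : F) : K)^2 - 4 * (((n : 𝓞 F) : F) : K)) * (((aeval b r : 𝓞 F) : F) : K)^2
    have e : ∀ m : ℤ, (((m : 𝓞 F) : F) : K) = m := by intro m; simp
    rw [haev, e, e, ← hn, ← hn', hb']
    have h3 : ((b : F) : K)^2 = (α + c α)^2 := by rw [hb]
    linear_combination (α' - c α' + (α - c α) * aeval ((b : F) : K) r) * h2 - (aeval ((b : F) : K) r)^2 * h3
  obtain ⟨b0, hb0⟩ := hβ α0 hα0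
  obtain ⟨n0, hn0⟩ := hα0.2.1
  have hε0 : b0^2 - 4 * (n0 : 𝓞 F) ≠ 0 := by
    intro h
    have h1 := congrArg (fun z : 𝓞 F => ((z : F) : K)) h
    change ((b0 : F) : K)^2 - 4 * (((n0 : 𝓞 F) : F) : K) = 0 at h1
    have e : ∀ m : ℤ, (((m : 𝓞 F) : F) : K) = m := by intro m; simp
    rw [hb0, e, ← hn0] at h1
    have h2 : (α0 - c α0)^2 = 0 := by linear_combination h1
    exact hne α0 hα0 (sub_eq_zero.1 (pow_eq_zero_iff (two_ne_zero)|>.1 h2))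
  have hfin := wg_abstract hg3 (b0^2 - 4 * (n0 : 𝓞 F)) hε0
  refine (hfin.biUnion (t := fun p => {α : K | α^2 - ((p.1 : F) : K) * α + p.2 = 0}) ?_).subset ?_
  · rintro ⟨b, n⟩ _
    have hP : (X^2 - C ((b : F) : K) * X + C (n : K) : K[X]) ≠ 0 := by
      apply Monic.ne_zero
      monicity!
    refine ((X^2 - C ((b : F) : K) * X + C (n : K) : K[X]).roots.toFinset.finite_toSet).subset ?_
    intro α hα
    rw [Finset.mem_coe, Multiset.mem_toFinset, mem_roots hP]
    simpa using hα
  · intro α hα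
    obtain ⟨b, hb⟩ := hβ α hα
    obtain ⟨n, hn⟩ := hα.2.1
    rw [Set.mem_iUnion₂]
    refine ⟨(b, n), ⟨hgen α hα b hb, associated_of_dvd_dvd (hdiv _ _ hα0 hα _ _ _ _ hb0 hb hn0 hn)
      (hdiv _ _ hα hα0 _ _ _ _ hb hb0 hn hn0)⟩, ?_⟩
    change α^2 - ((b : F) : K) * α + (n : K) = 0
    rw [hb, ← hn]; ring
end

/-- Let `K` be a CM field of degree `2g` with `g ≥ 3` (with complex
conjugation `c`).  Then the set of Weil generators of `K` is finite. -/
theorem stmt14 (g : ℕ) (hg : 3 ≤ g) (K : Type*) [Field K] [NumberField K]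
    (hdeg : Module.finrank ℚ K = 2 * g) (hK : TotallyImaginary K)
    (c : K ≃+* K) (hc : ∀ φ : K →+* ℂ, ∀ x : K, φ (c x) = (starRingEnd ℂ) (φ x)) :
    {α : K | IsWeilGenerator K c α}.Finite := by
  exact wg_main g hg K hdeg hK c hc
end
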